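/- arXiv:2304.14267 — 2 statements merged into one kernel-verified Lean document; each statement's English description precedes it below -/
import Mathlib

section
/- Fix λ > 1 and for real X ≥ 2 set H = H(X) = (log X)^λ. Then limsup_{X→∞} (π(X+H) − π(X)) / (H / log X) > 1 and liminf_{X→∞} (π(X+H) − π(X)) / (H / log X) < 1. -/
open Filter

/-- The prime counting function at a real argument: `π(X) = #{p ≤ X : p prime}`. -/
noncomputable def primePi (X : ℝ) : ℕ :=
  ((Finset.range (⌊X⌋₊ + 1)).filter Nat.Prime).card

namespace Maier

open Complex MeasureTheory Set Topology

lemma sum_range_period {q : ℕ} [NeZero q] (f : ZMod q → ℂ) (n : ℕ) :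
    ∑ k ∈ Finset.range q, f ((n + k : ℕ) : ZMod q) = ∑ a : ZMod q, f a := by
  refine Finset.sum_nbij' (fun k ↦ ((n + k : ℕ) : ZMod q)) (fun a ↦ (a - n).val) ?_ ?_ ?_ ?_ ?_
  · simp
  · intro a _; simpa using ZMod.val_lt _
  · intro k hk
    simp only [Nat.cast_add, add_sub_cancel_left]
    exact ZMod.val_cast_of_lt (Finset.mem_range.mp hk)
  · intro a _; simp
  · simp

lemma norm_sum_range_char_le {q : ℕ} [NeZero q] {χ : DirichletCharacter ℂ q} (hχ : χ ≠ 1) (n : ℕ) :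
    ‖∑ k ∈ Finset.range n, χ (k : ZMod q)‖ ≤ q := by
  induction n using Nat.strong_induction_on with
  | _ n ih =>
    rcases lt_or_ge n q with h | h
    · refine (norm_sum_le_of_le _ fun k _ ↦ χ.norm_le_one _).trans ?_
      simpa using mod_cast h.le
    · obtain ⟨m, rfl⟩ := Nat.exists_eq_add_of_le' h
      rw [Finset.sum_range_add, sum_range_period (fun a ↦ χ a),
        χ.sum_eq_zero_of_ne_one hχ, add_zero]
      exact ih m (by have := NeZero.pos q; omega)

lemma char_zero_eq {q : ℕ} [NeZero q] {χ : DirichletCharacter ℂ q} (hχ : χ ≠ 1) : χ 0 = 0 := by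
  refine χ.map_zero' ?_
  rintro rfl
  exact hχ (DirichletCharacter.level_one χ)

/-- Partial sums of a Dirichlet character. -/
noncomputable def charSum {q : ℕ} (χ : DirichletCharacter ℂ q) (n : ℕ) : ℂ :=
  ∑ k ∈ Finset.Icc 1 n, χ (k : ZMod q)

lemma norm_charSum_le_mod {q : ℕ} [NeZero q] {χ : DirichletCharacter ℂ q} (hχ : χ ≠ 1) (n : ℕ) :
    ‖charSum χ n‖ ≤ q := by
  have := norm_sum_range_char_le hχ (n + 1)
  rw [Finset.sum_range_succ', Nat.cast_zero, char_zero_eq hχ, add_zero] at this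
  rw [Finset.range_eq_Ico, Finset.sum_Ico_add' (fun k : ℕ ↦ χ (k : ZMod q)), zero_add,
    Finset.Ico_add_one_right_eq_Icc] at this
  exact this

lemma norm_charSum_le {q : ℕ} (χ : DirichletCharacter ℂ q) (n : ℕ) :
    ‖charSum χ n‖ ≤ n := by
  refine (norm_sum_le_of_le _ fun k _ ↦ χ.norm_le_one _).trans ?_
  simp

/-- The Mellin-type integral representing `L(s, χ) / s`. -/
noncomputable def charInt {q : ℕ} (χ : DirichletCharacter ℂ q) (s : ℂ) : ℂ :=
  ∫ t in Ioi (1 : ℝ), charSum χ ⌊t⌋₊ * (t : ℂ) ^ (-(s + 1))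

lemma measurable_charSum_floor {q : ℕ} (χ : DirichletCharacter ℂ q) :
    Measurable fun t : ℝ ↦ charSum χ ⌊t⌋₊ :=
  (measurable_from_top (f := charSum χ)).comp Nat.measurable_floor

lemma differentiableAt_charInt {q : ℕ} [NeZero q] {χ : DirichletCharacter ℂ q} (hχ : χ ≠ 1) {s : ℂ}
    (hs : 0 < s.re) : DifferentiableAt ℂ (charInt χ) s := by
  set g : ℝ → ℂ := (Ioi (1 : ℝ)).indicator fun t ↦ charSum χ ⌊t⌋₊ with hg
  have hgb (t : ℝ) : ‖g t‖ ≤ q := by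
    by_cases ht : t ∈ Ioi (1 : ℝ)
    · simpa [hg, Set.indicator_of_mem ht] using norm_charSum_le_mod hχ _
    · simp [hg, Set.indicator_of_notMem ht]
  have hgm : Measurable g := (measurable_charSum_floor χ).indicator measurableSet_Ioi
  have key : charInt χ = fun s ↦ mellin g (-s) := by
    ext s
    rw [charInt, mellin]
    have : ∀ t : ℝ, (t : ℂ) ^ (-s - 1) • g t =
        (Ioi (1 : ℝ)).indicator (fun t : ℝ ↦ charSum χ ⌊t⌋₊ * (t : ℂ) ^ (-(s + 1))) t := by
      intro t
      by_cases ht : t ∈ Ioi (1 : ℝ)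
      · rw [hg, Set.indicator_of_mem ht, Set.indicator_of_mem ht, smul_eq_mul, mul_comm]
        ring_nf
      · rw [hg, Set.indicator_of_notMem ht, Set.indicator_of_notMem ht, smul_zero]
    simp_rw [this]
    rw [setIntegral_indicator measurableSet_Ioi]
    congr 2
    ext t; simp only [mem_Ioi, mem_inter_iff]; constructor
    · intro h; exact ⟨by linarith, h⟩
    · exact fun h ↦ h.2
  rw [key]
  have hd : DifferentiableAt ℂ (mellin g) (-s) := by
    refine mellin_differentiableAt_of_isBigO_rpow (a := 0) (b := (-s).re - 1) ?_ ?_ ?_ ?_ ?_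
    · refine LocallyIntegrable.locallyIntegrableOn ?_ _
      refine (locallyIntegrable_const (q : ℝ)).mono hgm.aestronglyMeasurable ?_
      refine Eventually.of_forall fun t ↦ ?_
      simpa using hgb t
    · refine Asymptotics.IsBigO.of_bound q (Eventually.of_forall fun t ↦ ?_)
      simpa using hgb t
    · simpa using hs
    · refine Asymptotics.IsBigO.of_bound 1 ?_
      filter_upwards [Ioo_mem_nhdsGT (show (0 : ℝ) < 1 by norm_num)] with t ht
      rw [hg, Set.indicator_of_notMem (by simpa using ht.2.le)]
      simp only [norm_zero]; positivity
    · simp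
  exact DifferentiableAt.comp (g := mellin g) s hd differentiableAt_id.neg

lemma LFunction_eq_mul_charInt {q : ℕ} [NeZero q] {χ : DirichletCharacter ℂ q} (hχ : χ ≠ 1) {s : ℂ}
    (hs : 0 < s.re) : DirichletCharacter.LFunction χ s = s * charInt χ s := by
  have hopen : IsOpen {s : ℂ | 0 < s.re} := isOpen_lt continuous_const continuous_re
  have hconn : IsPreconnected {s : ℂ | 0 < s.re} := (convex_halfSpace_re_gt 0).isPreconnected
  have h1 : AnalyticOnNhd ℂ (DirichletCharacter.LFunction χ) {s : ℂ | 0 < s.re} :=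
    (DirichletCharacter.differentiable_LFunction hχ).differentiableOn.analyticOnNhd hopen
  have h2 : AnalyticOnNhd ℂ (fun s ↦ s * charInt χ s) {s : ℂ | 0 < s.re} := by
    refine DifferentiableOn.analyticOnNhd (fun s hs ↦ ?_) hopen
    exact (differentiableAt_id.mul (differentiableAt_charInt hχ hs)).differentiableWithinAt
  refine h1.eqOn_of_preconnected_of_eventuallyEq h2 hconn (z₀ := 2) (by simp) ?_ hs
  have : {z : ℂ | 1 < z.re} ∈ 𝓝 (2 : ℂ) :=
    (isOpen_lt continuous_const continuous_re).mem_nhds (by simp)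
  filter_upwards [this] with z hz
  rw [DirichletCharacter.LFunction_eq_LSeries χ hz]
  refine LSeries_eq_mul_integral _ le_rfl (by linarith [show 1 < z.re from hz])
    (ZMod.LSeriesSummable_of_one_lt_re χ hz) ?_
  refine Asymptotics.IsBigO.of_bound q (Eventually.of_forall fun n ↦ ?_)
  simpa [charSum] using norm_charSum_le_mod hχ n

lemma norm_charInt_le {q : ℕ} [NeZero q] {χ : DirichletCharacter ℂ q} (hχ : χ ≠ 1) {l : ℝ}
    (hl : 2 ≤ l) (hq : Real.log q ≤ l) {s : ℂ} (hs : 1 - 1 / l ≤ s.re) :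
    ‖charInt χ s‖ ≤ 8 * l := by
  have hl0 : 0 < l := by linarith
  have hlinv : 1 / l ≤ 1 / 2 := one_div_le_one_div_of_le (by norm_num) hl
  have hlpos : 0 < 1 / l := by positivity
  have hq0 : (0 : ℝ) < q := mod_cast NeZero.pos q
  have hqd : (q : ℝ) ^ (2 / l) ≤ 8 := by
    rw [Real.rpow_def_of_pos hq0]
    have h1 : Real.log q * (2 / l) ≤ 2 := by
      rw [mul_div_assoc', div_le_iff₀ hl0]; linarith
    have h2 : Real.exp 2 ≤ 8 := by
      have := Real.exp_one_lt_d9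
      rw [show (2 : ℝ) = 1 + 1 by norm_num, Real.exp_add]
      nlinarith [Real.exp_pos 1]
    exact (Real.exp_le_exp.mpr h1).trans h2
  have hintg : IntegrableOn (fun t : ℝ ↦ 8 * t ^ (-(1 + 1 / l))) (Ioi 1) :=
    (integrableOn_Ioi_rpow_of_lt (by linarith) one_pos).const_mul 8
  have hb : ‖charInt χ s‖ ≤ ∫ t in Ioi (1 : ℝ), 8 * t ^ (-(1 + 1 / l)) := by
    refine norm_integral_le_of_norm_le hintg ?_
    filter_upwards [ae_restrict_mem measurableSet_Ioi] with t ht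
    have ht1 : (1 : ℝ) < t := ht
    have ht0 : 0 < t := by linarith
    rw [norm_mul, norm_cpow_eq_rpow_re_of_pos ht0]
    have hS : ‖charSum χ ⌊t⌋₊‖ ≤ t ^ (1 - 2 / l) * 8 := by
      have h1 : ‖charSum χ ⌊t⌋₊‖ ≤ t :=
        (norm_charSum_le χ _).trans (Nat.floor_le ht0.le)
      have h2 := norm_charSum_le_mod hχ ⌊t⌋₊
      have h3 : ‖charSum χ ⌊t⌋₊‖ = ‖charSum χ ⌊t⌋₊‖ ^ (1 - 2 / l) * ‖charSum χ ⌊t⌋₊‖ ^ (2 / l) := by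
        rw [← Real.rpow_add_of_nonneg (norm_nonneg _)]
        · simp
        · rw [sub_nonneg, div_le_one hl0]; exact hl
        · positivity
      rw [h3]
      have h4 : 0 ≤ 1 - 2 / l := by rw [sub_nonneg, div_le_one hl0]; exact hl
      gcongr
      exact (Real.rpow_le_rpow (norm_nonneg _) h2 (by positivity)).trans hqd
    calc ‖charSum χ ⌊t⌋₊‖ * t ^ (-(s + 1)).re
        ≤ (t ^ (1 - 2 / l) * 8) * t ^ (-(2 - 1 / l)) := by
          gcongr
          · exact ht1.le
          · simp only [neg_re, add_re, one_re]; linarith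
      _ = 8 * t ^ (-(1 + 1 / l)) := by
          rw [mul_right_comm, ← Real.rpow_add ht0, mul_comm]
          congr 2; ring
  refine hb.trans (le_of_eq ?_)
  rw [integral_const_mul, integral_Ioi_rpow_of_lt (by linarith) one_pos, Real.one_rpow]
  field_simp
  ring

lemma norm_LFunction_le {q : ℕ} [NeZero q] {χ : DirichletCharacter ℂ q} (hχ : χ ≠ 1) {l : ℝ}
    (hl : 2 ≤ l) (hq : Real.log q ≤ l) {s : ℂ} (hs : ‖s - 1‖ ≤ 1 / l) :
    ‖DirichletCharacter.LFunction χ s‖ ≤ 16 * l := by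
  have hlinv : 1 / l ≤ 1 / 2 := one_div_le_one_div_of_le (by norm_num) hl
  have hre : 1 - 1 / l ≤ s.re := by
    have := (abs_le.mp ((abs_re_le_norm (s - 1)).trans hs)).1
    simp only [sub_re, one_re] at this; linarith
  rw [LFunction_eq_mul_charInt hχ (by linarith), norm_mul]
  have h2 : ‖s‖ ≤ 2 := by
    calc ‖s‖ = ‖(s - 1) + 1‖ := by simp
      _ ≤ ‖s - 1‖ + ‖(1 : ℂ)‖ := norm_add_le _ _
      _ ≤ 2 := by rw [norm_one]; linarith
  have h3 := norm_charInt_le hχ hl hq hre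
  nlinarith [norm_nonneg (charInt χ s), norm_nonneg s]

lemma norm_deriv_LFunction_le {q : ℕ} [NeZero q] {χ : DirichletCharacter ℂ q} (hχ : χ ≠ 1) {l : ℝ}
    (hl : 2 ≤ l) (hq : Real.log q ≤ l) {s : ℂ} (hs : ‖s - 1‖ ≤ 1 / (2 * l)) :
    ‖deriv (DirichletCharacter.LFunction χ) s‖ ≤ 32 * l ^ 2 := by
  have hl0 : 0 < l := by linarith
  have := norm_deriv_le_of_forall_mem_sphere_norm_le (f := DirichletCharacter.LFunction χ) (c := s)
    (R := 1 / (2 * l)) (C := 16 * l) (by positivity)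
    (DirichletCharacter.differentiable_LFunction hχ).diffContOnCl ?_
  · refine this.trans (le_of_eq ?_); field_simp; ring
  · intro z hz
    refine norm_LFunction_le hχ hl hq ?_
    rw [mem_sphere_iff_norm] at hz
    calc ‖z - 1‖ = ‖(z - s) + (s - 1)‖ := by ring_nf
      _ ≤ ‖z - s‖ + ‖s - 1‖ := norm_add_le _ _
      _ ≤ 1 / (2 * l) + 1 / (2 * l) := by rw [hz]; gcongr
      _ = 1 / l := by field_simp; ring

lemma re_log_triple_nonneg {a : ℝ} (ha₀ : 0 ≤ a) (ha₁ : a < 1) {u v : ℂ} (hu : ‖u‖ = 1)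
    (hv : ‖v‖ = 1) :
    0 ≤ 3 * (-log (1 - a)).re + 2 * (-log (1 - a * u)).re + 2 * (-log (1 - a * v)).re +
      2 * (-log (1 - a * (u * v⁻¹))).re := by
  have hac₀ : ‖(a : ℂ)‖ < 1 := by
    simp only [Complex.norm_of_nonneg ha₀, ha₁]
  have h (w : ℂ) (hw : ‖w‖ = 1) : ‖(a : ℂ) * w‖ < 1 := by rwa [norm_mul, hw, mul_one]
  have huv : ‖u * v⁻¹‖ = 1 := by simp [hu, hv]
  rw [← ((((hasSum_re <| hasSum_taylorSeries_neg_log hac₀).mul_left 3).add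
    ((hasSum_re <| hasSum_taylorSeries_neg_log (h u hu)).mul_left 2)).add
    ((hasSum_re <| hasSum_taylorSeries_neg_log (h v hv)).mul_left 2) |>.add
    ((hasSum_re <| hasSum_taylorSeries_neg_log (h _ huv)).mul_left 2)).tsum_eq]
  refine tsum_nonneg fun n ↦ ?_
  have key (b c : ℂ) (hb : ‖b‖ = 1) (hc : ‖c‖ = 1) :
      0 ≤ 3 + 2 * b.re + 2 * c.re + 2 * (b * c⁻¹).re := by
    have hc' : c⁻¹ = (starRingEnd ℂ) c := by
      rw [Complex.inv_def, Complex.normSq_eq_norm_sq, hc]; simp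
    have e1 : b.re ^ 2 + b.im ^ 2 = 1 := by
      have := Complex.normSq_eq_norm_sq b
      rw [hb, Complex.normSq_apply] at this; linarith
    have e2 : c.re ^ 2 + c.im ^ 2 = 1 := by
      have := Complex.normSq_eq_norm_sq c
      rw [hc, Complex.normSq_apply] at this; linarith
    rw [hc']
    simp only [mul_re, conj_re, conj_im]
    nlinarith [sq_nonneg (1 + b.re + c.re), sq_nonneg (b.im + c.im)]
  have k := key (u ^ n) (v ^ n) (by simp [hu]) (by simp [hv])
  have e : (3 * ((a : ℂ) ^ n / n).re + 2 * ((a * u) ^ n / n : ℂ).re + 2 * ((a * v) ^ n / n : ℂ).re +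
      2 * ((a * (u * v⁻¹)) ^ n / n : ℂ).re) = a ^ n * (3 + 2 * (u ^ n).re + 2 * (v ^ n).re +
        2 * (u ^ n * (v ^ n)⁻¹).re) / n := by
    simp only [← ofReal_pow, div_natCast_re, ofReal_re, mul_pow, re_ofReal_mul, inv_pow]
    ring
  rw [e]
  positivity

lemma norm_LSeries_triple_ge_one {N : ℕ} (χ₁ χ₂ : DirichletCharacter ℂ N) {x : ℝ} (hx : 0 < x) :
    1 ≤ ‖LSeries (fun n ↦ (1 : DirichletCharacter ℂ N) n) (1 + x) ^ 3 *
      LSeries (fun n ↦ χ₁ n) (1 + x) ^ 2 * LSeries (fun n ↦ χ₂ n) (1 + x) ^ 2 *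
      LSeries (fun n ↦ (χ₁ * χ₂⁻¹) n) (1 + x) ^ 2‖ := by
  have h₀ : 1 < (1 + x : ℂ).re := by simp [hx]
  have H₀ := DirichletCharacter.summable_neg_log_one_sub_mul_prime_cpow (N := N) 1 h₀
  have H₁ := DirichletCharacter.summable_neg_log_one_sub_mul_prime_cpow χ₁ h₀
  have H₂ := DirichletCharacter.summable_neg_log_one_sub_mul_prime_cpow χ₂ h₀
  have H₃ := DirichletCharacter.summable_neg_log_one_sub_mul_prime_cpow (χ₁ * χ₂⁻¹) h₀
  have s₀ := (hasSum_re H₀.hasSum).summable.mul_left 3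
  have s₁ := (hasSum_re H₁.hasSum).summable.mul_left 2
  have s₂ := (hasSum_re H₂.hasSum).summable.mul_left 2
  have s₃ := (hasSum_re H₃.hasSum).summable.mul_left 2
  rw [← DirichletCharacter.LSeries_eulerProduct_exp_log _ h₀,
    ← DirichletCharacter.LSeries_eulerProduct_exp_log χ₁ h₀,
    ← DirichletCharacter.LSeries_eulerProduct_exp_log χ₂ h₀,
    ← DirichletCharacter.LSeries_eulerProduct_exp_log (χ₁ * χ₂⁻¹) h₀]
  simp only [← exp_nat_mul, Nat.cast_ofNat, ← exp_add, norm_exp, add_re, mul_re,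
    re_ofNat, im_ofNat, zero_mul, sub_zero, Real.one_le_exp_iff]
  rw [re_tsum H₀, re_tsum H₁, re_tsum H₂, re_tsum H₃, ← tsum_mul_left, ← tsum_mul_left,
    ← tsum_mul_left, ← tsum_mul_left,
    ← s₀.tsum_add s₁, ← (s₀.add s₁).tsum_add s₂, ← ((s₀.add s₁).add s₂).tsum_add s₃]
  refine tsum_nonneg fun p ↦ ?_
  by_cases hn' : IsUnit ((p : ℕ) : ZMod N)
  · have hn : ((p : ℕ) : ℝ) ^ (-(1 + x)) < 1 := by
      rw [Real.rpow_neg (Nat.cast_nonneg _), inv_lt_one_iff₀]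
      exact .inr <| Real.one_lt_rpow (mod_cast p.2.one_lt) (by linarith)
    have hz (χ : DirichletCharacter ℂ N) : ‖χ (p : ℕ)‖ = 1 := by
      rw [← hn'.unit_spec, DirichletCharacter.unit_norm_eq_one χ hn'.unit]
    have := re_log_triple_nonneg (by positivity) hn (hz χ₁) (hz χ₂)
    have e : (((((p : ℕ) : ℝ) ^ (-(1 + x)) : ℝ)) : ℂ) = ((p : ℕ) : ℂ) ^ (-(1 + x : ℂ)) := by
      rw [ofReal_cpow (Nat.cast_nonneg _)]; simp
    rw [e] at this
    have e2 : (χ₁ * χ₂⁻¹) ((p : ℕ) : ZMod N) = χ₁ (p : ℕ) * (χ₂ (p : ℕ))⁻¹ := by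
      rw [MulChar.mul_apply, MulChar.inv_apply_eq_inv']
    rw [MulChar.one_apply hn', one_mul, e2]
    simpa only [mul_comm] using this
  · simp only [MulChar.map_nonunit _ hn', zero_mul, sub_zero, log_one, neg_zero, zero_re, mul_zero,
      add_zero, le_refl]

lemma tsum_one_div_rpow_le {x : ℝ} (hx : 0 < x) :
    ∑' n : ℕ, 1 / ((n : ℝ) + 1) ^ (1 + x) ≤ 1 + 1 / x := by
  have h := ZetaAsymptotics.zeta_limit_aux1 (s := 1 + x) (by linarith)
  have h2 : 0 ≤ ZetaAsymptotics.termTSum (1 + x) :=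
    tsum_nonneg fun n ↦ ZetaAsymptotics.term_nonneg _ _
  have e : (1 + x) - 1 = x := by ring
  rw [e] at h
  nlinarith

lemma norm_LFunction_one_add_le {N : ℕ} [NeZero N] (χ : DirichletCharacter ℂ N) {x : ℝ}
    (hx : 0 < x) : ‖DirichletCharacter.LFunction χ (1 + x)‖ ≤ 1 + 1 / x := by
  have h₀ : 1 < (1 + x : ℂ).re := by simp [hx]
  rw [χ.LFunction_eq_LSeries h₀]
  refine le_trans ?_ (tsum_one_div_rpow_le hx)
  have hs : Summable fun n : ℕ ↦ 1 / ((n : ℝ)) ^ (1 + x) :=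
    Real.summable_one_div_nat_rpow.mpr (by linarith)
  have hle (n : ℕ) : ‖LSeries.term (fun n ↦ χ n) (1 + x) n‖ ≤ 1 / ((n : ℝ)) ^ (1 + x) := by
    rcases Nat.eq_zero_or_pos n with rfl | hn
    · simp; positivity
    · rw [LSeries.term_of_ne_zero hn.ne', norm_div, norm_natCast_cpow_of_pos hn]
      simp only [add_re, one_re, ofReal_re]
      gcongr
      exact χ.norm_le_one _
  refine (tsum_of_norm_bounded hs.hasSum hle).trans ?_
  rw [hs.tsum_eq_zero_add]
  simp
  rw [Real.zero_rpow (by linarith)]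

lemma small_LFunction_unique {P : ℕ} [NeZero P] {l : ℝ} (hl : 2 ≤ l) (hP : Real.log P ≤ l)
    {χ₁ χ₂ : DirichletCharacter ℂ P} {x : ℝ}
    (hx : x = 1 / (10 ^ 13 * l ^ 10))
    (b₁ : ‖DirichletCharacter.LFunction χ₁ (1 + x)‖ ≤ 192 * x * l ^ 2)
    (b₂ : ‖DirichletCharacter.LFunction χ₂ (1 + x)‖ ≤ 192 * x * l ^ 2) : χ₁ = χ₂ := by
  by_contra hne
  have h₃ : χ₁ * χ₂⁻¹ ≠ 1 := fun h ↦ hne (mul_inv_eq_one.mp h)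
  have hl0 : 0 < l := by linarith
  have hx0 : 0 < x := by rw [hx]; positivity
  have hl10 : l ≤ l ^ 10 := le_self_pow₀ (by linarith) (by norm_num)
  have hxl : x ≤ 1 / l := by
    rw [hx]
    apply one_div_le_one_div_of_le hl0
    nlinarith
  have hx1 : x ≤ 1 := hxl.trans (by rw [div_le_one hl0]; linarith)
  have b₃ : ‖DirichletCharacter.LFunction (χ₁ * χ₂⁻¹) (1 + x)‖ ≤ 16 * l := by
    refine norm_LFunction_le h₃ hl hP ?_
    simp only [add_sub_cancel_left, norm_real, Real.norm_eq_abs, abs_of_pos hx0]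
    exact hxl
  have b₀ : ‖DirichletCharacter.LFunction (1 : DirichletCharacter ℂ P) (1 + x)‖ ≤ 2 / x := by
    refine (norm_LFunction_one_add_le _ hx0).trans ?_
    rw [← sub_nonneg]
    have : 2 / x - (1 + 1 / x) = (1 - x) / x := by field_simp; ring
    rw [this]
    exact div_nonneg (by linarith) hx0.le
  have key := norm_LSeries_triple_ge_one χ₁ χ₂ hx0
  have h₀ : 1 < (1 + x : ℂ).re := by simp [hx0]
  rw [← DirichletCharacter.LFunction_eq_LSeries _ h₀,
    ← DirichletCharacter.LFunction_eq_LSeries _ h₀, ← DirichletCharacter.LFunction_eq_LSeries _ h₀,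
    ← DirichletCharacter.LFunction_eq_LSeries _ h₀] at key
  simp only [norm_mul, norm_pow] at key
  have : ‖DirichletCharacter.LFunction (1 : DirichletCharacter ℂ P) (1 + x)‖ ^ 3 *
      ‖DirichletCharacter.LFunction χ₁ (1 + x)‖ ^ 2 *
        ‖DirichletCharacter.LFunction χ₂ (1 + x)‖ ^ 2 *
      ‖DirichletCharacter.LFunction (χ₁ * χ₂⁻¹) (1 + x)‖ ^ 2 ≤
      (2 / x) ^ 3 * (192 * x * l ^ 2) ^ 2 * (192 * x * l ^ 2) ^ 2 * (16 * l) ^ 2 := by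
    gcongr
  have e : (2 / x) ^ 3 * (192 * x * l ^ 2) ^ 2 * (192 * x * l ^ 2) ^ 2 * (16 * l) ^ 2
      = 2048 * 192 ^ 4 * (x * l ^ 10) := by field_simp; ring
  have e2 : x * l ^ 10 = 1 / 10 ^ 13 := by rw [hx]; field_simp
  rw [e, e2] at this
  have := key.trans this
  norm_num at this

lemma norm_LFunction_changeLevel_le {S : Finset ℕ} (hS : ∀ p ∈ S, p.Prime) {p : ℕ} (hp : p ∈ S)
    [NeZero (∏ r ∈ S, r)] [NeZero (∏ r ∈ S.erase p, r)]
    (hd : (∏ r ∈ S.erase p, r) ∣ ∏ r ∈ S, r)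
    {χ : DirichletCharacter ℂ (∏ r ∈ S.erase p, r)} (hχ : χ ≠ 1) {x : ℝ} (hx : 0 < x) :
    ‖DirichletCharacter.LFunction (DirichletCharacter.changeLevel hd χ) (1 + x)‖ ≤
      2 * ‖DirichletCharacter.LFunction χ (1 + x)‖ := by
  rw [DirichletCharacter.LFunction_changeLevel hd χ (.inl hχ), norm_mul, mul_comm]
  gcongr
  rw [Nat.primeFactors_prod hS, Finset.prod_eq_single_of_mem p hp]
  · refine (norm_sub_le _ _).trans ?_
    rw [norm_one, norm_mul, norm_natCast_cpow_of_pos (hS p hp).pos]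
    have h1 := χ.norm_le_one p
    have h2 : (p : ℝ) ^ (-(1 + x : ℂ)).re ≤ 1 :=
      Real.rpow_le_one_of_one_le_of_nonpos (mod_cast (hS p hp).one_le) (by simp; linarith)
    have h3 : 0 ≤ (p : ℝ) ^ (-(1 + x : ℂ)).re := by positivity
    nlinarith [norm_nonneg (χ p)]
  · intro r hrS hrp
    have hr : r ∈ S.erase p := Finset.mem_erase.mpr ⟨hrp, hrS⟩
    have : χ (r : ℕ) = 0 := by
      refine χ.map_nonunit ?_
      rw [ZMod.isUnit_iff_coprime]
      intro hc
      have : r ∣ 1 := hc ▸ Nat.dvd_gcd dvd_rfl (Finset.dvd_prod_of_mem _ hr)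
      exact (hS r (Finset.mem_of_mem_erase hr)).one_lt.ne' (Nat.dvd_one.mp this)
    rw [this]; simp

lemma exists_not_factorsThrough {S : Finset ℕ} (hS : ∀ p ∈ S, p.Prime) [NeZero (∏ r ∈ S, r)]
    {χ : DirichletCharacter ℂ (∏ r ∈ S, r)} (hχ : χ ≠ 1) :
    ∃ p ∈ S, ¬ χ.FactorsThrough (∏ r ∈ S.erase p, r) := by
  have hc : χ.conductor ≠ 1 := fun h ↦ hχ (χ.eq_one_iff_conductor_eq_one.mpr h)
  obtain ⟨p, hp, hpc⟩ := Nat.exists_prime_and_dvd hc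
  have hpS : p ∈ S := by
    obtain ⟨r, hr, hpr⟩ := (hp.prime.dvd_finsetProd_iff _).mp (hpc.trans χ.conductor_dvd_level)
    rwa [(Nat.prime_dvd_prime_iff_eq hp (hS r hr)).mp hpr]
  refine ⟨p, hpS, fun h ↦ ?_⟩
  have h1 := hpc.trans (χ.conductor_dvd_of_mem_conductorSet h)
  obtain ⟨r, hr, hpr⟩ := (hp.prime.dvd_finsetProd_iff _).mp h1
  rw [Finset.mem_erase] at hr
  exact hr.1 ((Nat.prime_dvd_prime_iff_eq hp (hS r hr.2)).mp hpr).symm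

/-- No nontrivial `L`-function modulo `q` vanishes within distance `x` of `1`, with control on
the logarithmic derivatives. -/
def GoodModulus (q : ℕ) (x : ℝ) : Prop :=
  ∃ _ : NeZero q, ∀ χ : DirichletCharacter ℂ q, χ ≠ 1 → ∀ s : ℂ, ‖s - 1‖ ≤ x →
    DirichletCharacter.LFunction χ s ≠ 0 ∧
      ‖deriv (DirichletCharacter.LFunction χ) s / DirichletCharacter.LFunction χ s‖ ≤ 1 / x

lemma goodModulus_aux {q : ℕ} [NeZero q] {χ : DirichletCharacter ℂ q} (hχ : χ ≠ 1) {l x : ℝ}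
    (hl : 2 ≤ l) (hq : Real.log q ≤ l) (hx : 0 < x) (hxl : x ≤ 1 / (2 * l))
    (h : 96 * x * l ^ 2 ≤ ‖DirichletCharacter.LFunction χ (1 + x)‖) {s : ℂ} (hs : ‖s - 1‖ ≤ x) :
    DirichletCharacter.LFunction χ s ≠ 0 ∧
      ‖deriv (DirichletCharacter.LFunction χ) s / DirichletCharacter.LFunction χ s‖ ≤ 1 / x := by
  have hl0 : 0 < l := by linarith
  have hder : ∀ w ∈ Metric.closedBall (1 : ℂ) x,
      ‖deriv (DirichletCharacter.LFunction χ) w‖ ≤ 32 * l ^ 2 := fun w hw ↦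
    norm_deriv_LFunction_le hχ hl hq ((mem_closedBall_iff_norm.mp hw).trans hxl)
  have hsm : s ∈ Metric.closedBall (1 : ℂ) x := mem_closedBall_iff_norm.mpr hs
  have hxm : (1 + x : ℂ) ∈ Metric.closedBall (1 : ℂ) x := by
    rw [mem_closedBall_iff_norm]; simp [abs_of_pos hx]
  have hmv := (convex_closedBall (1 : ℂ) x).norm_image_sub_le_of_norm_deriv_le
    (fun w _ ↦ (DirichletCharacter.differentiable_LFunction hχ).differentiableAt) hder hsm hxm
  have hd : ‖(1 + x : ℂ) - s‖ ≤ 2 * x := by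
    calc ‖(1 + x : ℂ) - s‖ = ‖(x : ℂ) - (s - 1)‖ := by ring_nf
      _ ≤ ‖(x : ℂ)‖ + ‖s - 1‖ := norm_sub_le _ _
      _ ≤ 2 * x := by rw [norm_real, Real.norm_eq_abs, abs_of_pos hx]; linarith
  have h2 := norm_sub_norm_le (DirichletCharacter.LFunction χ (1 + x))
    (DirichletCharacter.LFunction χ s)
  have h3 : 32 * l ^ 2 * ‖(1 + x : ℂ) - s‖ ≤ 32 * l ^ 2 * (2 * x) := by gcongr
  have hlow : 32 * x * l ^ 2 ≤ ‖DirichletCharacter.LFunction χ s‖ := by nlinarith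
  have hpos : 0 < ‖DirichletCharacter.LFunction χ s‖ := lt_of_lt_of_le (by positivity) hlow
  refine ⟨norm_pos_iff.mp hpos, ?_⟩
  rw [norm_div, div_le_div_iff₀ hpos hx]
  nlinarith [hder s hsm]

theorem exists_goodModulus {S : Finset ℕ} (hS : ∀ p ∈ S, p.Prime) (hne : S.Nonempty) {l : ℝ}
    (hl : 2 ≤ l) (hP : Real.log (∏ r ∈ S, r : ℕ) ≤ l) :
    ∃ p ∈ S, GoodModulus (∏ r ∈ S.erase p, r) (1 / (10 ^ 13 * l ^ 10)) := by
  set x : ℝ := 1 / (10 ^ 13 * l ^ 10) with hx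
  have hl0 : 0 < l := by linarith
  have hx0 : 0 < x := by positivity
  have hl10 : l ≤ l ^ 10 := le_self_pow₀ (by linarith) (by norm_num)
  have hxl : x ≤ 1 / (2 * l) := by
    rw [hx]
    apply one_div_le_one_div_of_le (by positivity)
    nlinarith
  have : NeZero (∏ r ∈ S, r) := ⟨Finset.prod_ne_zero_iff.mpr fun r hr ↦ (hS r hr).ne_zero⟩
  have hNZ (p : ℕ) : NeZero (∏ r ∈ S.erase p, r) :=
    ⟨Finset.prod_ne_zero_iff.mpr fun r hr ↦ (hS r (Finset.mem_of_mem_erase hr)).ne_zero⟩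
  have hdv (p : ℕ) : (∏ r ∈ S.erase p, r) ∣ ∏ r ∈ S, r :=
    Finset.prod_dvd_prod_of_subset _ _ _ (Finset.erase_subset _ _)
  have main (p : ℕ) (hp : p ∈ S) (hgood : ∀ χ : DirichletCharacter ℂ (∏ r ∈ S.erase p, r), χ ≠ 1 →
      192 * x * l ^ 2 ≤ ‖DirichletCharacter.LFunction
        (DirichletCharacter.changeLevel (hdv p) χ) (1 + x)‖) :
      GoodModulus (∏ r ∈ S.erase p, r) x := by
    refine ⟨hNZ p, fun χ hχ s hs ↦ ?_⟩
    have := hNZ p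
    refine goodModulus_aux hχ hl (le_trans ?_ hP) hx0 hxl ?_ hs
    · exact Real.log_le_log (mod_cast Nat.pos_of_ne_zero (NeZero.ne _))
        (mod_cast Nat.le_of_dvd (Nat.pos_of_ne_zero (NeZero.ne _)) (hdv p))
    · have h1 := hgood χ hχ
      have h2 := norm_LFunction_changeLevel_le hS hp (hdv p) hχ hx0
      linarith
  by_cases hbad : ∃ χ₁ : DirichletCharacter ℂ (∏ r ∈ S, r), χ₁ ≠ 1 ∧
      ‖DirichletCharacter.LFunction χ₁ (1 + x)‖ ≤ 192 * x * l ^ 2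
  · obtain ⟨χ₁, h1, hb⟩ := hbad
    obtain ⟨p, hp, hpf⟩ := exists_not_factorsThrough hS h1
    refine ⟨p, hp, main p hp fun χ hχ ↦ ?_⟩
    by_contra! hlt
    have := small_LFunction_unique hl hP hx hb hlt.le
    exact hpf ⟨hdv p, χ, this⟩
  · push Not at hbad
    obtain ⟨p, hp⟩ := hne
    refine ⟨p, hp, main p hp fun χ hχ ↦ (hbad _ ?_).le⟩
    have := hNZ p
    rwa [ne_eq, DirichletCharacter.changeLevel_eq_one_iff]

/-- The weight `(log n)^k n^{-1-η}`. -/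
noncomputable def wt (η : ℝ) (k : ℕ) (x : ℝ) : ℝ := Real.log x ^ k * x ^ (-(1 + η))

lemma term_logMul_iterate (f : ℕ → ℝ) (k : ℕ) {η : ℝ} (hη : 0 < η) (n : ℕ) :
    LSeries.term (LSeries.logMul^[k] (fun n ↦ (f n : ℂ))) (1 + η) n =
      ((f n * wt η k n : ℝ) : ℂ) := by
  have hit : ∀ m, (LSeries.logMul^[k] (fun n ↦ (f n : ℂ))) m = (Complex.log m) ^ k * f m := by
    induction k with
    | zero => simp
    | succ k ih =>
      intro m
      rw [Function.iterate_succ', Function.comp_apply, LSeries.logMul, ih, pow_succ]; ring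
  rcases Nat.eq_zero_or_pos n with rfl | hn
  · simp [wt]
    right; right
    rw [Real.zero_rpow (by linarith)]
  · rw [LSeries.term_of_ne_zero hn.ne', hit, wt, ← natCast_log]
    push_cast
    rw [ofReal_cpow (Nat.cast_nonneg _)]
    push_cast
    rw [cpow_neg]
    field_simp

lemma dirichlet_moment {f : ℕ → ℝ} (hf : LSeries.abscissaOfAbsConv (fun n ↦ (f n : ℂ)) ≤ 1)
    {g : ℂ → ℂ} {A M R : ℝ} (hg : ∀ s, ‖s - 1‖ ≤ R → DifferentiableAt ℂ g s ∧ ‖g s‖ ≤ M)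
    (hfg : ∀ s : ℂ, 1 < s.re → LSeries (fun n ↦ (f n : ℂ)) s = A * (s - 1)⁻¹ + g s)
    {η : ℝ} (hη : 0 < η) (hηR : 3 * η ≤ R) (k : ℕ) :
    Summable (fun n : ℕ ↦ f n * wt η k n) ∧
      |∑' n : ℕ, f n * wt η k n - A * (k.factorial / η ^ (k + 1))| ≤
        k.factorial * M / (2 * η) ^ k := by
  have h1 : (1 : ℝ) < (1 + η : ℂ).re := by simp [hη]
  have hab : LSeries.abscissaOfAbsConv (fun n ↦ (f n : ℂ)) < ((1 + η : ℂ).re : EReal) :=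
    lt_of_le_of_lt hf (mod_cast h1)
  have hsum : LSeriesSummable (LSeries.logMul^[k] (fun n ↦ (f n : ℂ))) (1 + η) := by
    apply LSeriesSummable_of_abscissaOfAbsConv_lt_re
    rwa [LSeries.absicssaOfAbsConv_logPowMul]
  unfold LSeriesSummable at hsum
  have hterm := funext (term_logMul_iterate f k hη)
  rw [hterm] at hsum
  have hsum' := Complex.summable_ofReal.mp hsum
  refine ⟨hsum', ?_⟩
  have hL : LSeries (LSeries.logMul^[k] (fun n ↦ (f n : ℂ))) (1 + η) =
      ((∑' n : ℕ, f n * wt η k n : ℝ) : ℂ) := by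
    rw [LSeries, hterm, Complex.ofReal_tsum]
  have hder := LSeries_iteratedDeriv k hab
  rw [hL] at hder
  have hball (s : ℂ) (hs : s ∈ Metric.closedBall (1 + η : ℂ) (2 * η)) : ‖s - 1‖ ≤ R := by
    rw [mem_closedBall_iff_norm] at hs
    calc ‖s - 1‖ = ‖(s - (1 + η)) + η‖ := by ring_nf
      _ ≤ ‖s - (1 + η)‖ + ‖(η : ℂ)‖ := norm_add_le _ _
      _ ≤ R := by rw [norm_real, Real.norm_eq_abs, abs_of_pos hη]; linarith
  have hcau : ‖iteratedDeriv k g (1 + η)‖ ≤ k.factorial * M / (2 * η) ^ k := by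
    refine norm_iteratedDeriv_le_of_forall_mem_sphere_norm_le k (by positivity) ?_ ?_
    · refine DifferentiableOn.diffContOnCl fun s hs ↦ ?_
      exact (hg s (hball s (Metric.closure_ball_subset_closedBall hs))).1.differentiableWithinAt
    · intro s hs
      exact (hg s (hball s (Metric.sphere_subset_closedBall hs))).2
  have hgan : ContDiffAt ℂ k g (1 + η) := by
    have : DifferentiableOn ℂ g (Metric.ball (1 + η : ℂ) (2 * η)) := fun s hs ↦
      (hg s (hball s (Metric.ball_subset_closedBall hs))).1.differentiableWithinAt
    exact (this.analyticAt (Metric.ball_mem_nhds _ (by positivity))).contDiffAt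
  have hne : (1 + η : ℂ) - 1 ≠ 0 := by simp [hη.ne']
  have hinv : ContDiffAt ℂ k (fun s : ℂ ↦ (A : ℂ) * (s - 1)⁻¹) (1 + η) := by
    exact contDiffAt_const.mul ((contDiffAt_id.sub contDiffAt_const).inv hne)
  have heq : LSeries (fun n ↦ (f n : ℂ)) =ᶠ[𝓝 (1 + η : ℂ)]
      (fun s ↦ (A : ℂ) * (s - 1)⁻¹) + g := by
    have : {s : ℂ | 1 < s.re} ∈ 𝓝 (1 + η : ℂ) :=
      (isOpen_lt continuous_const continuous_re).mem_nhds h1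
    filter_upwards [this] with s hs using hfg s hs
  rw [heq.iteratedDeriv_eq, iteratedDeriv_add hinv hgan, iteratedDeriv_const_mul_field,
    iteratedDeriv_eq_iterate] at hder
  have hi := congrFun (iter_deriv_inv_linear_sub (𝕜 := ℂ) k 1 1) (1 + η)
  simp only [one_mul, one_pow, mul_one] at hi
  rw [hi, add_sub_cancel_left] at hder
  have hfin : (((∑' n : ℕ, f n * wt η k n - A * (k.factorial / η ^ (k + 1)) : ℝ)) : ℂ) =
      (-1) ^ k * iteratedDeriv k g (1 + η) := by
    have h2 : ((-1 : ℂ) ^ k) * ((-1) ^ k) = 1 := by rw [← mul_pow]; simp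
    have h3 : ((η : ℂ) ^ (-1 - (k : ℤ))) = 1 / (η : ℂ) ^ (k + 1) := by
      rw [show (-1 - (k : ℤ)) = -((k + 1 : ℕ) : ℤ) by push_cast; ring, zpow_neg, zpow_natCast,
        one_div]
    rw [h3] at hder
    push_cast at hder ⊢
    linear_combination (-(-1) ^ k) * hder - (∑' n : ℕ, (f n : ℂ) * wt η k n) * h2 +
      A * (k.factorial / η ^ (k + 1)) * h2
  rw [← Real.norm_eq_abs, ← norm_real, hfin, norm_mul, norm_pow, norm_neg, norm_one, one_pow,
    one_mul]
  exact hcau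

open DirichletCharacter (LFunctionTrivChar₁ LFunctionTrivChar LFunction)
open ArithmeticFunction.vonMangoldt (residueClass LFunctionResidueClassAux)

lemma LFunctionTrivChar₁_one_one : LFunctionTrivChar₁ 1 1 = 1 := by simp

lemma LFunctionTrivChar₁_one_of_ne {s : ℂ} (hs : s ≠ 1) :
    LFunctionTrivChar₁ 1 s = (s - 1) * riemannZeta s := by
  simp [Function.update_of_ne hs]

lemma exists_zeta_moment : ∃ M : ℝ, ∀ η : ℝ, 0 < η → η ≤ 1 / 3 → ∀ k : ℕ,
    Summable (fun n : ℕ ↦ wt η k n) ∧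
      |∑' n : ℕ, wt η k n - k.factorial / η ^ (k + 1)| ≤ k.factorial * M / (2 * η) ^ k := by
  set g := dslope (LFunctionTrivChar₁ 1) 1 with hg
  have hgd : Differentiable ℂ g := by
    have := (Complex.differentiableOn_dslope (s := univ) (c := 1) Filter.univ_mem).mpr
      (DirichletCharacter.differentiable_LFunctionTrivChar₁ 1).differentiableOn
    exact differentiableOn_univ.mp this
  obtain ⟨M, hM⟩ := (isCompact_closedBall (1 : ℂ) 1).exists_bound_of_continuousOn
    hgd.continuous.continuousOn
  refine ⟨M, fun η hη hη3 k ↦ ?_⟩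
  have := dirichlet_moment (f := fun _ ↦ 1) (g := g) (A := 1) (M := M) (R := 1) ?_
    (fun s hs ↦ ⟨hgd s, hM s (mem_closedBall_iff_norm.mpr hs)⟩) ?_ hη (by linarith) k
  · simpa using this
  · have := LSeries.abscissaOfAbsConv_one.le
    have e : (fun _ : ℕ ↦ ((1 : ℝ) : ℂ)) = 1 := by ext; simp
    rwa [e]
  · intro s hs
    have hs1 : s ≠ 1 := by rintro rfl; simp at hs
    have h1 : s - 1 ≠ 0 := sub_ne_zero.mpr hs1
    have e : LSeries (fun _ : ℕ ↦ ((1 : ℝ) : ℂ)) s = riemannZeta s := by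
      rw [← LSeries_one_eq_riemannZeta hs]; congr 1
    rw [e, hg, dslope_of_ne _ hs1, slope_def_field, LFunctionTrivChar₁_one_one,
      LFunctionTrivChar₁_one_of_ne hs1]
    push_cast
    field_simp
    ring

lemma LFunctionTrivChar₁_eq (q : ℕ) [NeZero q] :
    LFunctionTrivChar₁ q = fun s ↦
      (∏ p ∈ q.primeFactors, (1 - (p : ℂ) ^ (-s))) * LFunctionTrivChar₁ 1 s := by
  funext s
  rcases eq_or_ne s 1 with rfl | hs
  · rw [LFunctionTrivChar₁_one_one, LFunctionTrivChar₁, Function.update_self]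
    simp [cpow_neg]
  · rw [LFunctionTrivChar₁_one_of_ne hs, LFunctionTrivChar₁, Function.update_of_ne hs,
      DirichletCharacter.LFunctionTrivChar_eq_mul_riemannZeta hs]
    ring

lemma eulerFactor_ne_zero_and_logDeriv_le {p : ℕ} (hp : p.Prime) {s : ℂ} (hs : 1 / 2 ≤ s.re) :
    1 - (p : ℂ) ^ (-s) ≠ 0 ∧ DifferentiableAt ℂ (fun w : ℂ ↦ 1 - (p : ℂ) ^ (-w)) s ∧
      ‖logDeriv (fun w : ℂ ↦ 1 - (p : ℂ) ^ (-w)) s‖ ≤ 3 * Real.log p := by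
  have hn : ‖(p : ℂ) ^ (-s)‖ ≤ 3 / 4 := by
    rw [norm_natCast_cpow_of_pos hp.pos, neg_re]
    calc (p : ℝ) ^ (-s.re) ≤ (p : ℝ) ^ (-(1 / 2) : ℝ) :=
          Real.rpow_le_rpow_of_exponent_le (mod_cast hp.one_le) (by linarith)
      _ ≤ 2 ^ (-(1 / 2) : ℝ) :=
          Real.rpow_le_rpow_of_nonpos (by norm_num) (mod_cast hp.two_le) (by norm_num)
      _ ≤ 3 / 4 := by
          rw [Real.rpow_neg (by norm_num), ← Real.sqrt_eq_rpow]
          rw [inv_le_comm₀ (by positivity) (by norm_num)]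
          apply Real.le_sqrt_of_sq_le; norm_num
  have hlow : 1 / 4 ≤ ‖1 - (p : ℂ) ^ (-s)‖ := by
    have := norm_sub_norm_le (1 : ℂ) ((p : ℂ) ^ (-s))
    rw [norm_one] at this; linarith
  have h0 : 1 - (p : ℂ) ^ (-s) ≠ 0 := norm_pos_iff.mp (by linarith)
  have hp0 : (p : ℂ) ≠ 0 := mod_cast hp.ne_zero
  have hd : HasDerivAt (fun w : ℂ ↦ 1 - (p : ℂ) ^ (-w)) ((p : ℂ) ^ (-s) * Complex.log p) s := by
    have := ((hasDerivAt_neg s).const_cpow (c := (p : ℂ)) (.inl hp0)).const_sub 1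
    convert! this using 1
    ring
  refine ⟨h0, hd.differentiableAt, ?_⟩
  rw [logDeriv_apply, hd.deriv, norm_div, norm_mul, ← natCast_log, norm_real, Real.norm_eq_abs,
    abs_of_nonneg (Real.log_natCast_nonneg p), div_le_iff₀ (by linarith)]
  nlinarith [Real.log_natCast_nonneg p]

lemma exists_logDeriv_trivChar₁_le : ∃ r C : ℝ, 0 < r ∧ r ≤ 1 / 2 ∧ 0 ≤ C ∧
    ∀ (q : ℕ) [NeZero q] (s : ℂ), ‖s - 1‖ ≤ r → LFunctionTrivChar₁ q s ≠ 0 ∧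
      ‖logDeriv (LFunctionTrivChar₁ q) s‖ ≤ C + 3 * Real.log q := by
  have hZd := DirichletCharacter.differentiable_LFunctionTrivChar₁ 1
  have hcont : ContinuousAt (logDeriv (LFunctionTrivChar₁ 1)) 1 := by
    refine ContinuousAt.div ?_ hZd.continuous.continuousAt ?_
    · exact (hZd.contDiff.continuous_deriv le_rfl).continuousAt
    · rw [LFunctionTrivChar₁_one_one]; exact one_ne_zero
  have h1 : ∀ᶠ s in 𝓝 (1 : ℂ), ‖logDeriv (LFunctionTrivChar₁ 1) s‖ <
      ‖logDeriv (LFunctionTrivChar₁ 1) 1‖ + 1 :=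
    hcont.norm.eventually_lt continuousAt_const (by linarith)
  have h2 : ∀ᶠ s in 𝓝 (1 : ℂ), LFunctionTrivChar₁ 1 s ≠ 0 :=
    hZd.continuous.continuousAt.eventually_ne
      (by rw [LFunctionTrivChar₁_one_one]; exact one_ne_zero)
  obtain ⟨ε, hε, hball⟩ := Metric.eventually_nhds_iff.mp (h1.and h2)
  refine ⟨min (ε / 2) (1 / 2), ‖logDeriv (LFunctionTrivChar₁ 1) 1‖ + 1, by positivity,
    min_le_right _ _, by positivity, fun q _ s hs ↦ ?_⟩
  have hb := hball (y := s) (by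
    rw [dist_eq_norm]; exact (hs.trans (min_le_left _ _)).trans_lt (by linarith))
  have hre : 1 / 2 ≤ s.re := by
    have := (abs_le.mp ((abs_re_le_norm (s - 1)).trans (hs.trans (min_le_right _ _)))).1
    simp only [sub_re, one_re] at this; linarith
  have hE (p : ℕ) (hp : p ∈ q.primeFactors) :=
    eulerFactor_ne_zero_and_logDeriv_le (Nat.prime_of_mem_primeFactors hp) hre
  have hprod : ∏ p ∈ q.primeFactors, (1 - (p : ℂ) ^ (-s)) ≠ 0 :=
    Finset.prod_ne_zero_iff.mpr fun p hp ↦ (hE p hp).1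
  have hpd : DifferentiableAt ℂ (fun s ↦ ∏ p ∈ q.primeFactors, (1 - (p : ℂ) ^ (-s))) s :=
    DifferentiableAt.fun_finsetProd fun p hp ↦ (hE p hp).2.1
  rw [LFunctionTrivChar₁_eq q]
  refine ⟨mul_ne_zero hprod hb.2, ?_⟩
  rw [logDeriv_mul s hprod hb.2 hpd (hZd s), logDeriv_prod (fun p hp ↦ (hE p hp).1)
    (fun p hp ↦ (hE p hp).2.1), add_comm]
  refine (norm_add_le _ _).trans (add_le_add hb.1.le ?_)
  refine (norm_sum_le_of_le _ fun p hp ↦ (hE p hp).2.2).trans ?_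
  rw [← Finset.mul_sum]
  gcongr
  rw [← Real.log_prod fun p hp ↦ (mod_cast (Nat.prime_of_mem_primeFactors hp).ne_zero),
    ← Nat.cast_prod]
  refine Real.log_le_log (mod_cast Finset.prod_pos fun p hp ↦
    (Nat.prime_of_mem_primeFactors hp).pos) ?_
  exact_mod_cast Nat.le_of_dvd (Nat.pos_of_ne_zero (NeZero.ne q)) (Nat.prod_primeFactors_dvd q)

theorem exists_residueClass_moment : ∃ r C : ℝ, 0 < r ∧ r ≤ 1 / 2 ∧ 0 ≤ C ∧
    ∀ (q : ℕ) (x : ℝ), GoodModulus q x → 0 < x → x ≤ r → 3 * Real.log q ≤ 1 / x →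
    ∀ a : ZMod q, IsUnit a → ∀ η : ℝ, 0 < η → 3 * η ≤ x → ∀ k : ℕ,
    Summable (fun n : ℕ ↦ residueClass a n * wt η k n) ∧
      |∑' n : ℕ, residueClass a n * wt η k n - (q.totient : ℝ)⁻¹ * (k.factorial / η ^ (k + 1))| ≤
        k.factorial * (C / x) / (2 * η) ^ k := by
  obtain ⟨r, C, hr, hr2, hC, H⟩ := exists_logDeriv_trivChar₁_le
  refine ⟨r, C + 2, hr, hr2, by linarith, fun q x ⟨_, hG⟩ hx hxr hlq a ha η hη hηx k ↦ ?_⟩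
  have hx1 : 1 ≤ 1 / x := by rw [le_div_iff₀ hx]; linarith
  refine dirichlet_moment (g := LFunctionResidueClassAux a)
    (ArithmeticFunction.vonMangoldt.abscissaOfAbsConv_residueClass_le_one a) (R := x)
    (fun s hs ↦ ⟨?_, ?_⟩) ?_ hη hηx k
  · unfold LFunctionResidueClassAux
    refine DifferentiableAt.const_mul (DifferentiableAt.sub ?_ ?_) _
    · refine DifferentiableAt.div ?_ ?_ (H q s (hs.trans hxr)).1
      · exact (((DirichletCharacter.differentiable_LFunctionTrivChar₁ q).contDiff
          (n := 2)).differentiable_deriv_two s).neg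
      · exact (DirichletCharacter.differentiable_LFunctionTrivChar₁ q) s
    · refine DifferentiableAt.fun_sum fun χ hχ ↦ ?_
      have hχ : χ ≠ 1 := by simpa using hχ
      have hd := DirichletCharacter.differentiable_LFunction hχ
      refine DifferentiableAt.div (DifferentiableAt.const_mul ?_ _) (hd s) (hG χ hχ s hs).1
      exact (hd.contDiff (n := 2)).differentiable_deriv_two s
  · unfold LFunctionResidueClassAux
    have hφ : 0 < (q.totient : ℝ) := mod_cast Nat.totient_pos.mpr (Nat.pos_of_ne_zero (NeZero.ne q))
    rw [norm_mul, norm_inv, norm_natCast, inv_mul_le_iff₀ hφ]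
    have h1 := (H q s (hs.trans hxr)).2
    rw [logDeriv_apply] at h1
    refine (norm_sub_le _ _).trans ((add_le_add (b := C + 3 * Real.log q)
      (d := q.totient * (1 / x)) (by rwa [neg_div, norm_neg]) ?_).trans ?_)
    · refine (norm_sum_le_of_le (f := fun χ : DirichletCharacter ℂ q ↦
        χ a⁻¹ * deriv (LFunction χ) s / LFunction χ s) (n := fun _ ↦ 1 / x) _
        fun χ hχ ↦ ?_).trans ?_
      · have hχ : χ ≠ 1 := by simpa using hχ
        rw [mul_div_assoc, norm_mul]
        have := (hG χ hχ s hs).2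
        nlinarith [χ.norm_le_one a⁻¹, norm_nonneg (χ a⁻¹),
          norm_nonneg (deriv (LFunction χ) s / LFunction χ s)]
      · rw [Finset.sum_const, nsmul_eq_mul]
        gcongr
        refine (Finset.card_le_univ _).trans_eq ?_
        rw [← Nat.card_eq_fintype_card,
          DirichletCharacter.card_eq_totient_of_hasEnoughRootsOfUnity ℂ q]
    · have hφ1 : (1 : ℝ) ≤ q.totient :=
        mod_cast Nat.totient_pos.mpr (Nat.pos_of_ne_zero (NeZero.ne q))
      have h3 : (C + 1) * (1 / x) ≤ q.totient * ((C + 1) * (1 / x)) :=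
        le_mul_of_one_le_left (by positivity) hφ1
      have h4 : C ≤ C * (1 / x) := le_mul_of_one_le_right hC hx1
      rw [div_eq_mul_one_div (C + 2)]
      nlinarith
  · intro s hs
    have := ArithmeticFunction.vonMangoldt.eqOn_LFunctionResidueClassAux ha hs
    rw [this]
    push_cast
    ring

/-- The integers whose logarithm is within `εY` of `Y`. -/
noncomputable def mid (Y ε : ℝ) : Finset ℕ :=
  (Finset.range (⌊Real.exp ((1 + ε) * Y)⌋₊ + 1)).filter fun n ↦ |Real.log n - Y| ≤ ε * Y

lemma mem_mid {Y ε : ℝ} {n : ℕ} :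
    n ∈ mid Y ε ↔ |Real.log n - Y| ≤ ε * Y := by
  rw [mid, Finset.mem_filter, and_iff_right_iff_imp]
  intro h
  rw [Finset.mem_range, Nat.lt_succ_iff]
  apply Nat.le_floor
  rcases Nat.eq_zero_or_pos n with rfl | hn
  · simp; positivity
  · rw [← Real.log_le_iff_le_exp (mod_cast hn)]
    linarith [(abs_le.mp h).2]

lemma wt_nonneg (η : ℝ) (k n : ℕ) : 0 ≤ wt η k n := by
  have := Real.log_natCast_nonneg n
  unfold wt; positivity

/-- The moments of order at least `k` of `f` match those of a simple pole of residue `A`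
with relative error `E`. -/
def Moments (f : ℕ → ℝ) (A η : ℝ) (k : ℕ) (E : ℝ) : Prop :=
  ∀ i, k ≤ i → Summable (fun n : ℕ ↦ f n * wt η i n) ∧
    |∑' n : ℕ, f n * wt η i n - A * (i.factorial / η ^ (i + 1))| ≤
      E * (A * (i.factorial / η ^ (i + 1)))

lemma Moments.le {f : ℕ → ℝ} {A η E : ℝ} {k : ℕ} (h : Moments f A η k E) :
    ∑' n : ℕ, f n * wt η k n ≤ (1 + E) * (A * (k.factorial / η ^ (k + 1))) := by
  have := (abs_le.mp (h k le_rfl).2).2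
  linarith

lemma Moments.le_sum_mid {f : ℕ → ℝ} {A η E : ℝ} {k : ℕ} (h : Moments f A η k E)
    (hf : ∀ n, 0 ≤ f n) (hA : 0 ≤ A) (hη : 0 < η) (hk : 1 ≤ k) (hE : 0 ≤ E) {ε : ℝ} (hε : 0 < ε) :
    (1 - E - (3 / k + 11 * E) / ε ^ 2) * (A * (k.factorial / η ^ (k + 1))) ≤
      ∑ n ∈ mid (k / η) ε, f n * wt η k n := by
  have hk0 : (0 : ℝ) < k := mod_cast hk
  have hk1 : (1 : ℝ) ≤ k := mod_cast hk
  set Y := (k : ℝ) / η with hY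
  have hY0 : 0 < Y := by positivity
  set m := A * (k.factorial / η ^ (k + 1)) with hm
  have hm0 : 0 ≤ m := by positivity
  obtain ⟨s0, e0⟩ := h k le_rfl
  obtain ⟨s1, e1⟩ := h (k + 1) (by lia)
  obtain ⟨s2, e2⟩ := h (k + 2) (by lia)
  have m1 : A * ((k + 1).factorial / η ^ (k + 1 + 1)) = m * ((k + 1) / η) := by
    rw [hm, Nat.factorial_succ]; push_cast; field_simp; ring
  have m2 : A * ((k + 2).factorial / η ^ (k + 2 + 1)) = m * ((k + 1) * (k + 2) / η ^ 2) := by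
    rw [hm, Nat.factorial_succ, Nat.factorial_succ]; push_cast; field_simp; ring
  rw [m1] at e1
  rw [m2] at e2
  set D0 := ∑' n : ℕ, f n * wt η k n
  set D1 := ∑' n : ℕ, f n * wt η (k + 1) n
  set D2 := ∑' n : ℕ, f n * wt η (k + 2) n
  have hw1 (n : ℕ) : wt η (k + 1) n = Real.log n * wt η k n := by unfold wt; ring
  have hw2 (n : ℕ) : wt η (k + 2) n = Real.log n ^ 2 * wt η k n := by unfold wt; ring
  have hV : HasSum (fun n : ℕ ↦ f n * wt η k n * (Real.log n - Y) ^ 2)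
      (D2 - 2 * Y * D1 + Y ^ 2 * D0) := by
    have := (s2.hasSum.sub (s1.hasSum.mul_left (2 * Y))).add (s0.hasSum.mul_left (Y ^ 2))
    convert! this using 1
    funext n; rw [hw1, hw2]; ring
  have hVle : D2 - 2 * Y * D1 + Y ^ 2 * D0 ≤ Y ^ 2 * (3 / k + 11 * E) * m := by
    have a2 := (abs_le.mp e2).2
    have a1 := (abs_le.mp e1).1
    have a0 := (abs_le.mp e0).2
    have b1 : 2 * Y * (m * ((k + 1) / η) - E * (m * ((k + 1) / η))) ≤ 2 * Y * D1 := by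
      gcongr; linarith
    have b0 : Y ^ 2 * D0 ≤ Y ^ 2 * (m + E * m) := by gcongr; linarith
    have : D2 - 2 * Y * D1 + Y ^ 2 * D0 ≤ (m * ((k + 1) * (k + 2) / η ^ 2)
        + E * (m * ((k + 1) * (k + 2) / η ^ 2))) -
        2 * Y * (m * ((k + 1) / η) - E * (m * ((k + 1) / η))) + Y ^ 2 * (m + E * m) := by
      linarith
    refine this.trans ?_
    have e : (m * ((k + 1) * (k + 2) / η ^ 2)
        + E * (m * ((k + 1) * (k + 2) / η ^ 2))) -
        2 * Y * (m * ((k + 1) / η) - E * (m * ((k + 1) / η))) + Y ^ 2 * (m + E * m) =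
        m / η ^ 2 * ((k + 2) + E * (4 * k ^ 2 + 5 * k + 2)) := by
      rw [hY]; field_simp; ring
    have e' : Y ^ 2 * (3 / k + 11 * E) * m = m / η ^ 2 * (3 * k + E * (11 * k ^ 2)) := by
      rw [hY]; field_simp
    rw [e, e']
    gcongr
    · linarith
    · nlinarith
  have hfin : ∑ n ∈ mid Y ε, f n * wt η k n + ((3 / k + 11 * E) / ε ^ 2) * m ≥ D0 := by
    have hs : HasSum (fun n : ℕ ↦ (if n ∈ mid Y ε then f n * wt η k n else 0) +
        f n * wt η k n * (Real.log n - Y) ^ 2 * (1 / (ε * Y) ^ 2))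
        (∑ n ∈ mid Y ε, f n * wt η k n +
          (D2 - 2 * Y * D1 + Y ^ 2 * D0) * (1 / (ε * Y) ^ 2)) := by
      refine HasSum.add ?_ (hV.mul_right _)
      have : HasSum (fun n : ℕ ↦ if n ∈ mid Y ε then f n * wt η k n else 0)
          (∑ n ∈ mid Y ε, if n ∈ mid Y ε then f n * wt η k n else 0) :=
        hasSum_sum_of_ne_finset_zero fun n hn ↦ if_neg hn
      rwa [Finset.sum_congr rfl (g := fun n : ℕ ↦ f n * wt η k n)
        (fun n hn ↦ by simp [hn])] at this
    have hle := hasSum_le (fun n ↦ ?_) s0.hasSum hs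
    · refine hle.trans (add_le_add le_rfl ?_)
      calc (D2 - 2 * Y * D1 + Y ^ 2 * D0) * (1 / (ε * Y) ^ 2)
          ≤ (Y ^ 2 * (3 / k + 11 * E) * m) * (1 / (ε * Y) ^ 2) := by gcongr
        _ = _ := by field_simp
    · have h0 : 0 ≤ f n * wt η k n := mul_nonneg (hf n) (wt_nonneg _ _ _)
      by_cases hn : n ∈ mid Y ε
      · simp only [hn, if_true]
        have : 0 ≤ f n * wt η k n * (Real.log n - Y) ^ 2 * (1 / (ε * Y) ^ 2) := by positivity
        linarith
      · simp only [hn, if_false, zero_add]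
        rw [mem_mid, not_le] at hn
        have : 1 ≤ (Real.log n - Y) ^ 2 * (1 / (ε * Y) ^ 2) := by
          rw [mul_one_div, one_le_div (by positivity), ← sq_abs (Real.log n - Y)]
          gcongr
        rw [mul_assoc]
        exact le_mul_of_one_le_right h0 this
  have := (abs_le.mp e0).1
  nlinarith

theorem exists_moments : ∃ C : ℝ, 0 ≤ C ∧ ∀ᶠ z : ℕ in atTop, ∀ η : ℝ, 0 < η →
    3 * η ≤ 1 / (10 ^ 13 * (2 * z : ℝ) ^ 10) →
    Moments (fun _ ↦ 1) 1 η (10 * z) (C * (1 / 2) ^ z) ∧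
    ∀ q : ℕ, GoodModulus q (1 / (10 ^ 13 * (2 * z : ℝ) ^ 10)) → q ≤ 4 ^ z →
    ∀ a : ZMod q, IsUnit a →
      Moments (residueClass a) (q.totient : ℝ)⁻¹ η (10 * z) (C * (1 / 2) ^ z) := by
  obtain ⟨M, hM⟩ := exists_zeta_moment
  obtain ⟨r, C, hr, hr2, hC, H⟩ := exists_residueClass_moment
  refine ⟨max C |M|, le_max_of_le_left hC, ?_⟩
  have hlim : ∀ᶠ z : ℕ in atTop, 1 / r ≤ (z : ℝ) :=
    tendsto_natCast_atTop_atTop.eventually_ge_atTop _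
  filter_upwards [hlim, eventually_ge_atTop 1] with z hz hz1 η hη hηx
  have hz1' : (1 : ℝ) ≤ z := mod_cast hz1
  set x : ℝ := 1 / (10 ^ 13 * (2 * z : ℝ) ^ 10) with hx
  have hx0 : 0 < x := by positivity
  have hzx : 10 * z ≤ 1 / x := by
    rw [hx, one_div_one_div]
    have : (2 * z : ℝ) ≤ (2 * z : ℝ) ^ 10 := le_self_pow₀ (by linarith) (by norm_num)
    nlinarith
  have hxr : x ≤ r := by
    rw [div_le_iff₀ hr] at hz
    rw [le_div_iff₀ hx0] at hzx
    nlinarith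
  have hη3 : 3 * η ≤ 1 / 2 := hηx.trans (hxr.trans hr2)
  have hpow (i : ℕ) (hi : 10 * z ≤ i) : ((1 / 2 : ℝ)) ^ i ≤ (1 / 2) ^ z * (1 / 4) ^ z := by
    calc ((1 / 2 : ℝ)) ^ i ≤ (1 / 2) ^ (3 * z) :=
          pow_le_pow_of_le_one (by norm_num) (by norm_num) (by lia)
      _ = _ := by rw [← mul_pow, pow_mul]; norm_num
  have h4 : ((1 / 4 : ℝ)) ^ z ≤ 1 := pow_le_one₀ (by norm_num) (by norm_num)
  constructor
  · intro i hi
    obtain ⟨s, hs⟩ := hM η hη (by linarith) i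
    simp only [one_mul]
    refine ⟨s, hs.trans ?_⟩
    have e : i.factorial * M / (2 * η) ^ i =
        (M * η * (1 / 2) ^ i) * (i.factorial / η ^ (i + 1)) := by
      rw [mul_pow, one_div_pow, pow_succ]; field_simp
    rw [e]
    refine mul_le_mul_of_nonneg_right ?_ (by positivity)
    calc M * η * (1 / 2) ^ i ≤ |M| * 1 * ((1 / 2) ^ z * (1 / 4) ^ z) := by
          have := hpow i hi
          have h1 := le_abs_self M
          gcongr
          linarith
      _ ≤ max C |M| * 1 * ((1 / 2) ^ z * 1) := by gcongr; exact le_max_right _ _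
      _ = _ := by ring
  · intro q hG hq a ha i hi
    have hq0 : 0 < q := by obtain ⟨h, _⟩ := hG; exact Nat.pos_of_ne_zero h.out
    have hqlog : Real.log q ≤ 2 * z := by
      calc Real.log q ≤ Real.log ((4 : ℝ) ^ z) :=
            Real.log_le_log (mod_cast hq0) (mod_cast hq)
        _ = z * Real.log 4 := by rw [Real.log_pow]
        _ ≤ z * 2 := by
            gcongr
            rw [show (4 : ℝ) = 2 ^ 2 by norm_num, Real.log_pow]
            have := Real.log_two_lt_d9
            push_cast; linarith
        _ = _ := by ring
    obtain ⟨s, hs⟩ := H q x hG hx0 hxr (by linarith) a ha η hη hηx i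
    refine ⟨s, hs.trans ?_⟩
    have hφ : (0 : ℝ) < q.totient := mod_cast Nat.totient_pos.mpr hq0
    have hφq : (q.totient : ℝ) ≤ 4 ^ z := mod_cast (Nat.totient_le q).trans hq
    have e : i.factorial * (C / x) / (2 * η) ^ i = (C * (η / x) * q.totient * (1 / 2) ^ i) *
        ((q.totient : ℝ)⁻¹ * (i.factorial / η ^ (i + 1))) := by
      rw [mul_pow, one_div_pow, pow_succ]; field_simp
    rw [e]
    refine mul_le_mul_of_nonneg_right ?_ (by positivity)
    have hηx1 : η / x ≤ 1 := by rw [div_le_one hx0]; linarith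
    calc C * (η / x) * q.totient * (1 / 2) ^ i
        ≤ C * 1 * 4 ^ z * ((1 / 2) ^ z * (1 / 4) ^ z) := by
          have := hpow i hi
          gcongr
      _ = C * (1 / 2) ^ z * (4 * (1 / 4)) ^ z := by rw [mul_pow]; ring
      _ = C * (1 / 2) ^ z := by norm_num
      _ ≤ _ := by gcongr; exact le_max_left _ _

/-- The expansion of `∏ p ∈ S, (1 - 1 / p)`, restricted to products of fewer than `K` primes. -/
noncomputable def truncProd (K : ℕ) (S : Finset ℕ) : ℝ :=
  ∑ T ∈ S.powerset, if T.card < K then (-1) ^ T.card * ∏ p ∈ T, (p : ℝ)⁻¹ else 0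

/-- The signed error in the truncation of `∏ p ∈ S, (1 - 1 / p)`. -/
noncomputable def truncError (K : ℕ) (S : Finset ℕ) : ℝ :=
  (-1) ^ K * (∏ p ∈ S, (1 - (p : ℝ)⁻¹) - truncProd K S)

lemma truncProd_insert (K : ℕ) {S : Finset ℕ} {p : ℕ} (hp : p ∉ S) :
    truncProd (K + 1) (insert p S) = truncProd (K + 1) S - (p : ℝ)⁻¹ * truncProd K S := by
  unfold truncProd
  rw [Finset.sum_powerset_insert hp, sub_eq_add_neg, Finset.mul_sum, ← Finset.sum_neg_distrib]
  congr 1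
  refine Finset.sum_congr rfl fun T hT ↦ ?_
  have hpT : p ∉ T := fun h ↦ hp (Finset.mem_powerset.mp hT h)
  rw [Finset.card_insert_of_notMem hpT, Finset.prod_insert hpT]
  by_cases h : T.card < K
  · simp [h, pow_succ]; ring
  · simp [h]

lemma truncError_zero (S : Finset ℕ) : truncError 0 S = ∏ p ∈ S, (1 - (p : ℝ)⁻¹) := by
  simp [truncError, truncProd]

lemma truncError_insert (K : ℕ) {S : Finset ℕ} {p : ℕ} (hp : p ∉ S) :
    truncError (K + 1) (insert p S) = truncError (K + 1) S + (p : ℝ)⁻¹ * truncError K S := by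
  unfold truncError
  rw [truncProd_insert K hp, Finset.prod_insert hp, pow_succ]
  ring

lemma pow_succ_sub_le {m M : ℝ} (hm : 0 ≤ m) (h : m ≤ M) (K : ℕ) :
    M ^ (K + 1) - m ^ (K + 1) ≤ (K + 1) * (M - m) * M ^ K := by
  induction K with
  | zero => simp
  | succ K ih =>
    have h1 : m ^ (K + 1) ≤ M ^ (K + 1) := by gcongr
    have h2 := mul_le_mul_of_nonneg_right h1 (sub_nonneg.mpr h)
    have h3 := mul_le_mul_of_nonneg_right ih (hm.trans h)
    push_cast
    rw [pow_succ M (K + 1), pow_succ m (K + 1)]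
    rw [pow_succ M K] at h2 h3 ⊢
    nlinarith

lemma half_le_prod {S : Finset ℕ} (h : ∑ p ∈ S, (p : ℝ)⁻¹ ≤ 1 / 2) :
    1 / 2 ≤ ∏ p ∈ S, (1 - (p : ℝ)⁻¹) := by
  have key : ∀ S : Finset ℕ, ∑ p ∈ S, (p : ℝ)⁻¹ ≤ 1 / 2 →
      1 - ∑ p ∈ S, (p : ℝ)⁻¹ ≤ ∏ p ∈ S, (1 - (p : ℝ)⁻¹) ∧ ∏ p ∈ S, (1 - (p : ℝ)⁻¹) ≤ 1 := by
    intro S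
    induction S using Finset.induction_on with
    | empty => simp
    | insert p S hp ih =>
      intro h
      rw [Finset.sum_insert hp] at h ⊢
      rw [Finset.prod_insert hp]
      have hp0 : 0 ≤ (p : ℝ)⁻¹ := by positivity
      have hs0 : 0 ≤ ∑ p ∈ S, (p : ℝ)⁻¹ := by positivity
      obtain ⟨h1, h2⟩ := ih (by linarith)
      constructor <;> nlinarith
  linarith [(key S h).1]

lemma le_truncError {ε : ℝ} (hε : 0 ≤ ε) {S : Finset ℕ} (hS : ∀ p ∈ S, (p : ℝ)⁻¹ ≤ ε)
    (h : ∑ p ∈ S, (p : ℝ)⁻¹ ≤ 1 / 2) (K : ℕ) :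
    (1 / 2) * (max (∑ p ∈ S, (p : ℝ)⁻¹ - K * ε) 0 ^ K / K.factorial) ≤ truncError K S := by
  induction S using Finset.induction_on generalizing K with
  | empty =>
    cases K with
    | zero => simp [truncError_zero]; norm_num
    | succ K =>
      have : max (-(((K + 1 : ℕ) : ℝ) * ε)) 0 = 0 := max_eq_right (by simp; positivity)
      simp only [Finset.sum_empty, zero_sub, this]
      simp [truncError, truncProd]
  | insert p S hp ih =>
    cases K with
    | zero =>
      rw [truncError_zero]
      simpa using half_le_prod h
    | succ K =>
      rw [Finset.sum_insert hp] at h ⊢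
      have hp0 : 0 ≤ (p : ℝ)⁻¹ := by positivity
      have hpε := hS p (Finset.mem_insert_self _ _)
      have ih' := ih (fun r hr ↦ hS r (Finset.mem_insert_of_mem hr)) (by linarith)
      rw [truncError_insert K hp]
      set t := ∑ p ∈ S, (p : ℝ)⁻¹
      set a := (p : ℝ)⁻¹
      have i1 := ih' (K + 1)
      have i0 := mul_le_mul_of_nonneg_left (ih' K) hp0
      set m := max (t - ((K + 1 : ℕ) : ℝ) * ε) 0 with hm
      set M := max (a + t - ((K + 1 : ℕ) : ℝ) * ε) 0 with hM
      have hm0 : 0 ≤ m := le_max_right _ _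
      have hM0 : 0 ≤ M := le_max_right _ _
      have hmM : m ≤ M := max_le_max (by linarith) le_rfl
      have hMm : M - m ≤ a := by
        rw [sub_le_iff_le_add, hM, max_le_iff]
        constructor
        · linarith [le_max_left (t - ((K + 1 : ℕ) : ℝ) * ε) 0]
        · linarith
      have hM' : M ≤ max (t - K * ε) 0 := max_le_max (by push_cast; linarith) le_rfl
      have key : M ^ (K + 1) ≤ m ^ (K + 1) + (K + 1) * a * max (t - K * ε) 0 ^ K := by
        have := pow_succ_sub_le hm0 hmM K
        have h2 : (K + 1) * (M - m) * M ^ K ≤ (K + 1) * a * max (t - K * ε) 0 ^ K := by gcongr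
        linarith
      calc (1 / 2 : ℝ) * (M ^ (K + 1) / (K + 1).factorial)
          ≤ (1 / 2) * ((m ^ (K + 1) + (K + 1) * a * max (t - K * ε) 0 ^ K) /
            (K + 1).factorial) := by gcongr
        _ = (1 / 2) * (m ^ (K + 1) / (K + 1).factorial) +
            a * ((1 / 2) * (max (t - K * ε) 0 ^ K / K.factorial)) := by
          rw [Nat.factorial_succ]; push_cast; field_simp
        _ ≤ _ := by linarith

/-- The number of `1 ≤ j ≤ U` coprime to `q`. -/
def coprimeCount (q U : ℕ) : ℕ := ((Finset.Ioc 0 U).filter (Nat.Coprime q)).card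

lemma coprimeCount_eq {S : Finset ℕ} (hS : ∀ p ∈ S, p.Prime) (U : ℕ) :
    (coprimeCount (∏ p ∈ S, p) U : ℝ) =
      ∑ T ∈ S.powerset, (-1 : ℝ) ^ T.card * ((U / ∏ p ∈ T, p : ℕ) : ℝ) := by
  have h1 (j : ℕ) : (if Nat.Coprime (∏ p ∈ S, p) j then (1 : ℝ) else 0) =
      ∏ p ∈ S, (1 + if p ∣ j then -1 else 0) := by
    by_cases h : Nat.Coprime (∏ p ∈ S, p) j
    · rw [if_pos h]
      refine (Finset.prod_eq_one fun p hp ↦ ?_).symm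
      rw [if_neg, add_zero]
      exact (Nat.Prime.coprime_iff_not_dvd (hS p hp)).mp (Nat.coprime_prod_left_iff.mp h p hp)
    · rw [if_neg h]
      rw [Nat.coprime_prod_left_iff] at h
      push Not at h
      obtain ⟨p, hp, hpj⟩ := h
      refine (Finset.prod_eq_zero hp ?_).symm
      change ¬ Nat.Coprime p j at hpj
      rw [Nat.Prime.coprime_iff_not_dvd (hS p hp), not_not] at hpj
      simp [hpj]
  have h2 (j : ℕ) : ∏ p ∈ S, (1 + if p ∣ j then (-1 : ℝ) else 0) =
      ∑ T ∈ S.powerset, (-1 : ℝ) ^ T.card * if ∏ p ∈ T, p ∣ j then 1 else 0 := by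
    rw [Finset.prod_one_add]
    refine Finset.sum_congr rfl fun T hT ↦ ?_
    have hTS := Finset.mem_powerset.mp hT
    by_cases h : ∏ p ∈ T, p ∣ j
    · rw [if_pos h, mul_one, ← Finset.prod_const]
      refine Finset.prod_congr rfl fun p hp ↦ if_pos ((Finset.dvd_prod_of_mem _ hp).trans h)
    · rw [if_neg h, mul_zero]
      have : ∃ p ∈ T, ¬ p ∣ j := by
        by_contra! hc
        exact h (Finset.prod_primes_dvd _ (fun p hp ↦ (hS p (hTS hp)).prime) hc)
      obtain ⟨p, hp, hpj⟩ := this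
      exact Finset.prod_eq_zero hp (if_neg hpj)
  rw [coprimeCount, Finset.card_filter]
  push_cast
  simp_rw [h1, h2]
  rw [Finset.sum_comm]
  refine Finset.sum_congr rfl fun T _ ↦ ?_
  rw [← Finset.mul_sum, ← Nat.Ioc_filter_dvd_card_eq_div, Finset.card_filter]
  push_cast
  rfl

lemma abs_coprimeCount_sub_le {S : Finset ℕ} (hS : ∀ p ∈ S, p.Prime) {U K : ℕ} {y z : ℝ}
    (hK : 1 ≤ K) (hy : 0 ≤ y) (hyS : ∀ p ∈ S, y ≤ p) (hy1 : 1 ≤ y) (hz : S.card ≤ z) (hz1 : 1 ≤ z)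
    (hU : U < y ^ K) :
    |(coprimeCount (∏ p ∈ S, p) U : ℝ) - U * truncProd K S| ≤ K * z ^ (K - 1) := by
  rw [coprimeCount_eq hS, truncProd, Finset.mul_sum, ← Finset.sum_sub_distrib]
  have h1 : ∀ T ∈ S.powerset, |(-1 : ℝ) ^ T.card * ((U / ∏ p ∈ T, p : ℕ) : ℝ) -
      U * (if T.card < K then (-1) ^ T.card * ∏ p ∈ T, (p : ℝ)⁻¹ else 0)| ≤
      if T.card < K then 1 else 0 := by
    intro T hT
    have hTS := Finset.mem_powerset.mp hT
    have hpos : 0 < ∏ p ∈ T, p := Finset.prod_pos fun p hp ↦ (hS p (hTS hp)).pos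
    split_ifs with h
    · have e : (-1 : ℝ) ^ T.card * ((U / ∏ p ∈ T, p : ℕ) : ℝ) -
          U * ((-1) ^ T.card * ∏ p ∈ T, (p : ℝ)⁻¹) =
          (-1) ^ T.card * (((U / ∏ p ∈ T, p : ℕ) : ℝ) - U / ((∏ p ∈ T, p : ℕ) : ℝ)) := by
        rw [Finset.prod_inv_distrib]; push_cast; ring
      rw [e, abs_mul, abs_pow, abs_neg, abs_one, one_pow, one_mul, abs_le]
      have a1 : (((U / ∏ p ∈ T, p : ℕ) : ℝ)) ≤ U / ((∏ p ∈ T, p : ℕ) : ℝ) := Nat.cast_div_le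
      have a2 : (U : ℝ) / ((∏ p ∈ T, p : ℕ) : ℝ) < ((U / ∏ p ∈ T, p : ℕ) : ℝ) + 1 := by
        rw [div_lt_iff₀ (mod_cast hpos), mul_comm]
        exact_mod_cast Nat.lt_mul_div_succ U hpos
      constructor <;> linarith
    · have : U < ∏ p ∈ T, p := by
        have : (U : ℝ) < ((∏ p ∈ T, p : ℕ) : ℝ) := by
          push_cast
          calc (U : ℝ) < y ^ K := hU
            _ ≤ y ^ T.card := pow_le_pow_right₀ hy1 (by lia)
            _ = ∏ p ∈ T, y := (Finset.prod_const _).symm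
            _ ≤ _ := Finset.prod_le_prod (fun _ _ ↦ hy) fun p hp ↦ hyS p (hTS hp)
        exact_mod_cast this
      simp [Nat.div_eq_of_lt this]
  refine (Finset.abs_sum_le_sum_abs _ _).trans ((Finset.sum_le_sum h1).trans ?_)
  rw [← Finset.sum_filter, Finset.sum_const, nsmul_eq_mul, mul_one]
  have h2 : (S.powerset.filter fun T ↦ T.card < K) ⊆
      (Finset.range K).biUnion fun i ↦ S.powersetCard i := by
    intro T hT
    simp only [Finset.mem_filter, Finset.mem_powerset] at hT
    simp [Finset.mem_powersetCard, hT]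
  calc ((S.powerset.filter fun T ↦ T.card < K).card : ℝ)
      ≤ ∑ i ∈ Finset.range K, ((S.powersetCard i).card : ℝ) := by
        exact_mod_cast (Finset.card_le_card h2).trans Finset.card_biUnion_le
    _ ≤ ∑ i ∈ Finset.range K, z ^ (K - 1) := by
        refine Finset.sum_le_sum fun i hi ↦ ?_
        rw [Finset.card_powersetCard]
        calc ((S.card.choose i : ℕ) : ℝ) ≤ (S.card : ℝ) ^ i := mod_cast Nat.choose_le_pow _ _
          _ ≤ z ^ i := by gcongr
          _ ≤ z ^ (K - 1) := pow_le_pow_right₀ hz1 (by have := Finset.mem_range.mp hi; lia)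
    _ = _ := by simp

lemma eventually_le_theta_sub : ∀ᶠ w : ℝ in atTop,
    w ≤ Chebyshev.theta (4 * w) - Chebyshev.theta w := by
  have h0 : ∀ᶠ x : ℝ in atTop, Real.log x ≤ (1 / 100) * x ^ (1 / 2 : ℝ) := by
    have := (isLittleO_log_rpow_atTop (show (0 : ℝ) < 1 / 2 by norm_num)).bound
      (show (0 : ℝ) < 1 / 100 by norm_num)
    filter_upwards [this, eventually_ge_atTop 1] with x hx hx1
    rw [Real.norm_of_nonneg (Real.log_nonneg hx1), Real.norm_of_nonneg (by positivity)] at hx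
    exact hx
  have h1 := (tendsto_id.const_mul_atTop (show (0 : ℝ) < 4 by norm_num)).eventually h0
  filter_upwards [h1, eventually_ge_atTop 100] with w hw hw1
  simp only [id] at hw
  set x := 4 * w with hx
  rw [← Real.sqrt_eq_rpow] at hw
  have hup := Chebyshev.theta_le_log4_mul_x (show 0 ≤ w by linarith)
  have hlo := Chebyshev.theta_ge' (show 1 ≤ x by linarith)
  have hs : √x * √x = x := Real.mul_self_sqrt (by linarith)
  have hs1 : 1 ≤ √x := Real.one_le_sqrt.mpr (by linarith)
  have a1 : √x * Real.log x ≤ (1 / 100) * x := by nlinarith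
  have a2 : Real.log (x + 2) ≤ (1 / 50) * x := by
    calc Real.log (x + 2) ≤ Real.log (x ^ 2) := Real.log_le_log (by linarith) (by nlinarith)
      _ = 2 * Real.log x := by rw [Real.log_pow]; norm_num
      _ ≤ _ := by nlinarith
  have l2 := Real.log_two_gt_d9
  have l2' := Real.log_two_lt_d9
  have l4 : Real.log 4 = 2 * Real.log 2 := by
    rw [show (4 : ℝ) = 2 ^ 2 by norm_num, Real.log_pow]; norm_num
  rw [l4] at hup
  nlinarith

lemma sum_log_primes_Ioc {a b : ℝ} (hab : a ≤ b) :
    ∑ p ∈ (Finset.Ioc ⌊a⌋₊ ⌊b⌋₊).filter Nat.Prime, Real.log p =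
      Chebyshev.theta b - Chebyshev.theta a := by
  rw [eq_sub_iff_add_eq, Chebyshev.theta, Chebyshev.theta, ← Finset.sum_union,
    ← Finset.filter_union,
    Finset.union_comm, Finset.Ioc_union_Ioc_eq_Ioc (Nat.zero_le _) (Nat.floor_le_floor hab)]
  exact (Finset.disjoint_filter_filter (Finset.Ioc_disjoint_Ioc_of_le le_rfl).symm)

lemma exists_le_sum_log_div : ∃ w₀ : ℝ, 1 ≤ w₀ ∧ ∀ (m : ℕ) (z : ℝ), w₀ ≤ z / 4 ^ m →
    (m : ℝ) / 4 ≤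
      ∑ p ∈ (Finset.Ioc ⌊z / 4 ^ m⌋₊ ⌊z⌋₊).filter Nat.Prime, Real.log p / p := by
  obtain ⟨w₀, hw₀⟩ := eventually_atTop.mp eventually_le_theta_sub
  refine ⟨max w₀ 1, le_max_right _ _, fun m z hz ↦ ?_⟩
  induction m with
  | zero => simp
  | succ m ih =>
    set w := z / 4 ^ (m + 1) with hw
    have hw1 : 1 ≤ w := (le_max_right _ _).trans hz
    have hw4 : z / 4 ^ m = 4 * w := by rw [hw, pow_succ]; field_simp
    have ih' := ih (hz.trans (by rw [hw4]; linarith))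
    rw [hw4] at ih'
    have hz4 : 4 * w ≤ z := by
      rw [← hw4]
      refine div_le_self ?_ (one_le_pow₀ (by norm_num))
      by_contra! h
      have : w ≤ 0 := div_nonpos_of_nonpos_of_nonneg h.le (by positivity)
      linarith
    have hblock : (1 : ℝ) / 4 ≤
        ∑ p ∈ (Finset.Ioc ⌊w⌋₊ ⌊4 * w⌋₊).filter Nat.Prime, Real.log p / p := by
      have h1 := hw₀ w ((le_max_left _ _).trans hz)
      rw [← sum_log_primes_Ioc (by linarith)] at h1
      calc (1 : ℝ) / 4 = w / (4 * w) := by field_simp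
        _ ≤ (∑ p ∈ (Finset.Ioc ⌊w⌋₊ ⌊4 * w⌋₊).filter Nat.Prime, Real.log p) / (4 * w) := by
          gcongr
        _ ≤ _ := by
          rw [Finset.sum_div]
          refine Finset.sum_le_sum fun p hp ↦ ?_
          rw [Finset.mem_filter, Finset.mem_Ioc] at hp
          have h2 := (Nat.le_floor_iff (by linarith : 0 ≤ 4 * w)).mp hp.1.2
          have h3 : (0 : ℝ) < p := mod_cast hp.2.pos
          have := Real.log_natCast_nonneg p
          gcongr
    rw [← Finset.Ioc_union_Ioc_eq_Ioc (Nat.floor_le_floor (show w ≤ 4 * w by linarith))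
      (Nat.floor_le_floor hz4), Finset.filter_union, Finset.sum_union
        (Finset.disjoint_filter_filter (Finset.Ioc_disjoint_Ioc_of_le le_rfl))]
    push_cast
    linarith

lemma exists_subset_sum {S : Finset ℕ} {f : ℕ → ℝ} {c ε : ℝ} (hc : 0 ≤ c) (hε : 0 ≤ ε)
    (hf : ∀ p ∈ S, f p ≤ ε) (h : c ≤ ∑ p ∈ S, f p) :
    ∃ T ⊆ S, c ≤ ∑ p ∈ T, f p ∧ ∑ p ∈ T, f p ≤ c + ε := by
  induction S using Finset.induction_on with
  | empty => exact ⟨∅, by simp, h, by simp; linarith⟩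
  | insert p S hp ih =>
    by_cases hS : c ≤ ∑ p ∈ S, f p
    · obtain ⟨T, hT, h1⟩ := ih (fun r hr ↦ hf r (Finset.mem_insert_of_mem hr)) hS
      exact ⟨T, hT.trans (Finset.subset_insert _ _), h1⟩
    · refine ⟨_, subset_rfl, h, ?_⟩
      rw [Finset.sum_insert hp]
      linarith [hf p (Finset.mem_insert_self _ _)]

lemma exists_primes_sum_inv {K : ℕ} (hK : 1 ≤ K) : ∀ᶠ z : ℕ in atTop, 1 / (64 * K : ℝ) ≤
    ∑ p ∈ (Finset.Ioc ⌊(z : ℝ) ^ (1 - 1 / (4 * K) : ℝ)⌋₊ z).filter Nat.Prime, (p : ℝ)⁻¹ := by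
  obtain ⟨w₀, hw₀, H⟩ := exists_le_sum_log_div
  have hK0 : (1 : ℝ) ≤ K := mod_cast hK
  have hc : (1 / (4 * K) : ℝ) ≤ 1 / 4 := by
    rw [div_le_div_iff₀ (by positivity) (by positivity)]; linarith
  have t1 : ∀ᶠ z : ℕ in atTop, w₀ ≤ (z : ℝ) ^ (1 - 1 / (4 * K) : ℝ) :=
    ((tendsto_rpow_atTop (by linarith)).comp tendsto_natCast_atTop_atTop).eventually_ge_atTop _
  have t2 : ∀ᶠ z : ℕ in atTop, (32 * K : ℝ) ≤ Real.log z :=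
    (Real.tendsto_log_atTop.comp tendsto_natCast_atTop_atTop).eventually_ge_atTop _
  filter_upwards [t1, t2, eventually_ge_atTop 1] with z h1 h2 hz
  have hz0 : (0 : ℝ) < z := mod_cast hz
  set L := Real.log z
  set m := ⌊L / (8 * K)⌋₊ with hm
  have hm1 : (m : ℝ) ≤ L / (8 * K) := Nat.floor_le (by positivity)
  have hm2 : L / (8 * K) < m + 1 := Nat.lt_floor_add_one _
  have h4m : (4 : ℝ) ^ m ≤ (z : ℝ) ^ (1 / (4 * K) : ℝ) := by
    have l4 : Real.log 4 = 2 * Real.log 2 := by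
      rw [show (4 : ℝ) = 2 ^ 2 by norm_num, Real.log_pow]; norm_num
    have := Real.log_two_lt_d9
    rw [← Real.log_le_log_iff (by positivity) (by positivity), Real.log_pow, Real.log_rpow hz0]
    calc m * Real.log 4 ≤ L / (8 * K) * 2 := by gcongr; linarith
      _ = 1 / (4 * K) * L := by field_simp; ring
  have hy : (z : ℝ) ^ (1 - 1 / (4 * K) : ℝ) ≤ z / 4 ^ m := by
    rw [Real.rpow_sub hz0, Real.rpow_one]; gcongr
  have := H m z (h1.trans hy)
  rw [Nat.floor_natCast] at this
  have hLpos : 0 < L := by linarith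
  calc 1 / (64 * K : ℝ) ≤ (m / 4) / L := by
        rw [div_le_div_iff₀ (by positivity) hLpos]
        have : L < (m + 1) * (8 * K) := (div_lt_iff₀ (by positivity)).mp hm2
        nlinarith
    _ ≤ (∑ p ∈ (Finset.Ioc ⌊z / (4 : ℝ) ^ m⌋₊ z).filter Nat.Prime, Real.log p / p) / L := by
        gcongr
    _ ≤ ∑ p ∈ (Finset.Ioc ⌊z / (4 : ℝ) ^ m⌋₊ z).filter Nat.Prime, (p : ℝ)⁻¹ := by
        rw [Finset.sum_div]
        refine Finset.sum_le_sum fun p hp ↦ ?_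
        rw [Finset.mem_filter, Finset.mem_Ioc] at hp
        have hp0 : (0 : ℝ) < p := mod_cast hp.2.pos
        rw [div_div, div_le_iff₀ (by positivity)]
        have : Real.log p ≤ L := Real.log_le_log hp0 (mod_cast hp.1.2)
        field_simp
        exact this
    _ ≤ _ := by
        refine Finset.sum_le_sum_of_subset_of_nonneg ?_ fun _ _ _ ↦ by positivity
        refine Finset.filter_subset_filter _ (Finset.Ioc_subset_Ioc_left (Nat.floor_le_floor hy))

theorem exists_sieve {K : ℕ} (hK : 1 ≤ K) : ∃ δ : ℝ, 0 < δ ∧ ∀ᶠ z : ℕ in atTop,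
    ∃ S : Finset ℕ, (∀ p ∈ S, p.Prime ∧ p ≤ z) ∧ S.Nonempty ∧ ∏ p ∈ S, p ≤ 4 ^ z ∧
    ∀ p ∈ S, ∀ U : ℕ, (z : ℝ) ^ (K - 2 / 3 : ℝ) ≤ U → (U : ℝ) ≤ (z : ℝ) ^ (K - 1 / 3 : ℝ) →
      U < ∏ r ∈ S.erase p, r ∧
      δ ≤ (-1) ^ K * (((∏ r ∈ S.erase p, r).totient : ℝ) / (∏ r ∈ S.erase p, r : ℕ) -
        coprimeCount (∏ r ∈ S.erase p, r) U / U) := by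
  have hK0 : (1 : ℝ) ≤ K := mod_cast hK
  set c : ℝ := 1 / (64 * K) with hcdef
  have hc0 : 0 < c := by positivity
  have hc1 : c ≤ 1 / 64 := by
    rw [hcdef, div_le_div_iff₀ (by positivity) (by positivity)]; linarith
  have hc : (1 / (4 * K) : ℝ) ≤ 1 / 4 := by
    rw [div_le_div_iff₀ (by positivity) (by positivity)]; linarith
  set δ : ℝ := (1 / 4) * ((c / 2) ^ K / K.factorial) with hδ
  have hδ0 : 0 < δ := by positivity
  refine ⟨δ, hδ0, ?_⟩
  have t1 : ∀ᶠ z : ℕ in atTop, 2 * (K + 1) / c ≤ (z : ℝ) ^ (1 - 1 / (4 * K) : ℝ) :=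
    ((tendsto_rpow_atTop (by linarith)).comp tendsto_natCast_atTop_atTop).eventually_ge_atTop _
  have t2 : ∀ᶠ z : ℕ in atTop, K / δ ≤ (z : ℝ) ^ (1 / 3 : ℝ) :=
    ((tendsto_rpow_atTop (by norm_num)).comp tendsto_natCast_atTop_atTop).eventually_ge_atTop _
  filter_upwards [t1, t2, exists_primes_sum_inv hK, eventually_ge_atTop 2] with z h1 h2 h3 hz
  have hz1 : (1 : ℝ) < z := mod_cast hz
  have hz0 : (0 : ℝ) < z := by linarith
  set y := (z : ℝ) ^ (1 - 1 / (4 * K) : ℝ) with hy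
  have hy2 : 2 * (K + 1) ≤ y * c := (div_le_iff₀ hc0).mp h1
  have hy0 : 0 < y := by positivity
  have hy1 : 1 ≤ y := by nlinarith
  have hyinv : y⁻¹ * (K + 1) ≤ c / 2 := by
    rw [inv_mul_le_iff₀ hy0]; linarith
  have hyinv0 : 0 < y⁻¹ := by positivity
  have hbig : ∀ p ∈ (Finset.Ioc ⌊y⌋₊ z).filter Nat.Prime, y ≤ p := by
    intro p hp
    rw [Finset.mem_filter, Finset.mem_Ioc] at hp
    exact (Nat.lt_of_floor_lt hp.1.1).le
  obtain ⟨S, hS, hS1, hS2⟩ := exists_subset_sum (ε := y⁻¹) hc0.le (by positivity)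
    (fun p hp ↦ inv_anti₀ hy0 (hbig p hp)) h3
  have hSy : ∀ p ∈ S, y ≤ p := fun p hp ↦ hbig p (hS hp)
  have hSp : ∀ p ∈ S, p.Prime ∧ p ≤ z := fun p hp ↦ by
    have := hS hp
    rw [Finset.mem_filter, Finset.mem_Ioc] at this
    exact ⟨this.2, this.1.2⟩
  refine ⟨S, hSp, ?_, ?_, ?_⟩
  · by_contra h
    rw [Finset.not_nonempty_iff_eq_empty] at h
    simp [h] at hS1; linarith
  · refine le_trans ?_ (primorial_le_four_pow z)
    refine Finset.prod_le_prod_of_subset_of_one_le' ?_ ?_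
    · intro p hp
      have := hSp p hp
      simp [this.1, this.2]
    · intro p hp _
      exact (Finset.mem_filter.mp hp).2.one_le
  intro p hp U hU1 hU2
  set S' := S.erase p with hS'
  have hsub : S' ⊆ S := Finset.erase_subset _ _
  have hS'p : ∀ r ∈ S', r.Prime := fun r hr ↦ (hSp r (hsub hr)).1
  have hS'y : ∀ r ∈ S', y ≤ r := fun r hr ↦ hSy r (hsub hr)
  have hinv : ∀ r ∈ S', (r : ℝ)⁻¹ ≤ y⁻¹ := fun r hr ↦ inv_anti₀ hy0 (hS'y r hr)
  have hsum := Finset.add_sum_erase S (fun r : ℕ ↦ (r : ℝ)⁻¹) hp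
  have hpy : (p : ℝ)⁻¹ ≤ y⁻¹ := inv_anti₀ hy0 (hSy p hp)
  have hp0 : 0 ≤ (p : ℝ)⁻¹ := by positivity
  simp only [← hS'] at hsum
  have hτ1 : c - y⁻¹ ≤ ∑ r ∈ S', (r : ℝ)⁻¹ := by linarith
  have hτ2 : ∑ r ∈ S', (r : ℝ)⁻¹ ≤ 1 / 2 := by nlinarith
  have hyK : y ^ K = (z : ℝ) ^ (K - 1 / 4 : ℝ) := by
    rw [hy, ← Real.rpow_natCast, ← Real.rpow_mul hz0.le]
    congr 1; field_simp
  have hUy : (U : ℝ) < y ^ K := by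
    rw [hyK]
    exact hU2.trans_lt (Real.rpow_lt_rpow_of_exponent_lt hz1 (by linarith))
  have hcard : K ≤ S'.card := by
    have : ∑ r ∈ S', (r : ℝ)⁻¹ ≤ S'.card * y⁻¹ := by
      simpa using Finset.sum_le_card_nsmul S' _ _ hinv
    have h4 : c / 2 ≤ S'.card * y⁻¹ := by nlinarith
    rw [← div_eq_mul_inv, le_div_iff₀ hy0] at h4
    have : (K : ℝ) ≤ S'.card := by linarith
    exact_mod_cast this
  have hcardz : (S'.card : ℝ) ≤ z := by
    have : S' ⊆ Finset.Ioc 0 z := fun r hr ↦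
      Finset.mem_Ioc.mpr ⟨(hS'p r hr).pos, (hSp r (hsub hr)).2⟩
    have := Finset.card_le_card this
    rw [Nat.card_Ioc] at this
    exact_mod_cast this
  have hU0 : (0 : ℝ) < U := lt_of_lt_of_le (by positivity) hU1
  constructor
  · have : (U : ℝ) < ((∏ r ∈ S', r : ℕ) : ℝ) := by
      push_cast
      calc (U : ℝ) < y ^ K := hUy
        _ ≤ y ^ S'.card := pow_le_pow_right₀ hy1 hcard
        _ = ∏ r ∈ S', y := (Finset.prod_const _).symm
        _ ≤ _ := Finset.prod_le_prod (fun _ _ ↦ hy0.le) hS'y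
    exact_mod_cast this
  have hq0 : ((∏ r ∈ S', r : ℕ) : ℝ) ≠ 0 := by
    have : ∏ r ∈ S', r ≠ 0 := Finset.prod_ne_zero_iff.mpr fun r hr ↦ (hS'p r hr).ne_zero
    exact_mod_cast this
  have htot : ((∏ r ∈ S', r).totient : ℝ) / (∏ r ∈ S', r : ℕ) = ∏ r ∈ S', (1 - (r : ℝ)⁻¹) := by
    rw [div_eq_iff hq0]
    have := Nat.totient_eq_mul_prod_factors (∏ r ∈ S', r)
    rw [Nat.primeFactors_prod hS'p] at this
    have h5 : (((∏ r ∈ S', r).totient : ℚ) : ℝ) =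
        (((∏ r ∈ S', r : ℕ) : ℚ) * ∏ r ∈ S', (1 - (r : ℚ)⁻¹) : ℚ) := by rw [this]
    push_cast at h5 ⊢
    rw [h5, mul_comm]
  rw [htot]
  have hmain : 2 * δ ≤ truncError K S' := by
    refine le_trans ?_ (le_truncError (ε := y⁻¹) hyinv0.le hinv hτ2 K)
    have : c / 2 ≤ max (∑ r ∈ S', (r : ℝ)⁻¹ - K * y⁻¹) 0 := by
      refine le_max_of_le_left ?_
      linarith
    calc 2 * δ = (1 / 2) * ((c / 2) ^ K / K.factorial) := by rw [hδ]; ring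
      _ ≤ _ := by gcongr
  have herr := abs_coprimeCount_sub_le hS'p hK hy0.le hS'y hy1 hcardz hz1.le hUy
  have herr2 : |truncProd K S' - (coprimeCount (∏ r ∈ S', r) U : ℝ) / U| ≤ δ := by
    have e : truncProd K S' - (coprimeCount (∏ r ∈ S', r) U : ℝ) / U =
        -((coprimeCount (∏ r ∈ S', r) U : ℝ) - U * truncProd K S') / U := by
      field_simp; ring
    rw [e, abs_div, abs_neg, abs_of_pos hU0, div_le_iff₀ hU0]
    refine herr.trans ?_
    have e2 : (z : ℝ) ^ (K - 1) * (z : ℝ) ^ (1 / 3 : ℝ) = (z : ℝ) ^ (K - 2 / 3 : ℝ) := by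
      rw [← Real.rpow_natCast, ← Real.rpow_add hz0, Nat.cast_sub hK]
      congr 1; push_cast; ring
    calc K * (z : ℝ) ^ (K - 1) = δ * ((z : ℝ) ^ (K - 1) * (K / δ)) := by field_simp
      _ ≤ δ * ((z : ℝ) ^ (K - 1) * (z : ℝ) ^ (1 / 3 : ℝ)) := by gcongr
      _ ≤ δ * U := by rw [e2]; gcongr
  have hsplit : (-1) ^ K * (∏ r ∈ S', (1 - (r : ℝ)⁻¹) -
      (coprimeCount (∏ r ∈ S', r) U : ℝ) / U) = truncError K S' +
      (-1) ^ K * (truncProd K S' - (coprimeCount (∏ r ∈ S', r) U : ℝ) / U) := by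
    unfold truncError; ring
  rw [hsplit]
  have : |(-1) ^ K * (truncProd K S' - (coprimeCount (∏ r ∈ S', r) U : ℝ) / U)| ≤ δ := by
    rw [abs_mul, abs_pow, abs_neg, abs_one, one_pow, one_mul]; exact herr2
  linarith [(abs_le.mp this).1]

lemma wt_le_wt {η : ℝ} {k a b : ℕ} (hη : 0 < η) (hk : 1 ≤ k) (ha : (k : ℝ) ≤ Real.log a)
    (hab : a ≤ b) : wt η k b ≤ wt η k a := by
  have hk0 : (0 : ℝ) < k := mod_cast hk
  have ha0 : (0 : ℝ) < a := by
    rcases Nat.eq_zero_or_pos a with rfl | h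
    · simp at ha; linarith
    · exact_mod_cast h
  have hab' : (a : ℝ) ≤ b := mod_cast hab
  have hb0 : (0 : ℝ) < b := ha0.trans_le hab'
  have key (x : ℝ) (hx : 0 < x) : wt η k x = (Real.log x / x ^ ((1 + η) / k)) ^ k := by
    rw [div_pow, ← Real.rpow_natCast (x ^ _), ← Real.rpow_mul hx.le, div_mul_cancel₀ _ hk0.ne',
      wt, Real.rpow_neg hx.le, div_eq_mul_inv]
  rw [key _ ha0, key _ hb0]
  have hlogb : 0 ≤ Real.log b := Real.log_natCast_nonneg b
  refine pow_le_pow_left₀ (by positivity) ?_ k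
  have hmem (x : ℝ) (hx : 0 < x) (h : k ≤ Real.log x) :
      x ∈ Set.Ici (Real.exp ((1 + η) / k)⁻¹) := by
    rw [Set.mem_Ici, ← Real.le_log_iff_exp_le hx, inv_div]
    exact (div_le_self hk0.le (by linarith)).trans h
  exact Real.log_div_self_rpow_antitoneOn (by positivity) (hmem _ ha0 ha)
    (hmem _ hb0 (ha.trans (Real.log_le_log ha0 hab'))) hab'

/-- Each weight at a point of `P` is dominated by the average of the weights in the preceding block
of length `q`. -/
lemma sum_le_mul_tsum {q : ℕ} (hq : 0 < q) {P : Finset ℕ} {w : ℕ → ℝ} (hw : ∀ n, 0 ≤ w n)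
    (hs : Summable w) {N : ℝ} (hN0 : 0 ≤ N) (h1 : ∀ p ∈ P, 1 ≤ p / q)
    (hanti : ∀ p ∈ P, ∀ n, n / q + 1 = p / q → w p ≤ w n)
    (hN : ∀ p ∈ P, ((P.filter fun r ↦ r / q = p / q).card : ℝ) ≤ N) :
    ∑ p ∈ P, w p ≤ N / q * ∑' n, w n := by
  have hq0 : (0 : ℝ) < q := mod_cast hq
  set B : ℕ → Finset ℕ := fun m ↦ Finset.Ico ((m - 1) * q) ((m - 1) * q + q) with hB
  have hBmem {m n : ℕ} (hm : 1 ≤ m) : n ∈ B m ↔ n / q + 1 = m := by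
    have : n / q = m - 1 ↔ n / q + 1 = m := by lia
    rw [← this, Nat.div_eq_iff hq, hB, Finset.mem_Ico]
    constructor
    · rintro ⟨h, h'⟩; exact ⟨h, by lia⟩
    · rintro ⟨h, h'⟩; exact ⟨h, by lia⟩
  set V : Finset ℕ := P.biUnion fun p ↦ B (p / q)
  have step : ∀ p ∈ P, q * w p ≤ ∑ n ∈ B (p / q), w n := by
    intro p hp
    have := Finset.card_nsmul_le_sum (B (p / q)) w (w p)
      fun n hn ↦ hanti p hp n ((hBmem (h1 p hp)).mp hn)
    simpa [hB] using this
  have hswap : ∑ p ∈ P, ∑ n ∈ B (p / q), w n =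
      ∑ n ∈ V, ∑ _p ∈ P.filter (fun p ↦ n ∈ B (p / q)), w n := by
    refine Finset.sum_comm' fun p n ↦ ?_
    simp only [Finset.mem_filter, V, Finset.mem_biUnion]
    constructor
    · rintro ⟨hp, hn⟩; exact ⟨⟨hp, hn⟩, p, hp, hn⟩
    · rintro ⟨⟨hp, hn⟩, -⟩; exact ⟨hp, hn⟩
  have hbound : ∑ p ∈ P, q * w p ≤ N * ∑' n, w n := by
    calc ∑ p ∈ P, q * w p ≤ ∑ p ∈ P, ∑ n ∈ B (p / q), w n := Finset.sum_le_sum step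
      _ = ∑ n ∈ V, ∑ _p ∈ P.filter (fun p ↦ n ∈ B (p / q)), w n := hswap
      _ ≤ ∑ n ∈ V, N * w n := by
        refine Finset.sum_le_sum fun n hn ↦ ?_
        rw [Finset.sum_const, nsmul_eq_mul]
        refine mul_le_mul_of_nonneg_right ?_ (hw n)
        obtain ⟨p, hp, hpn⟩ := Finset.mem_biUnion.mp hn
        refine le_trans ?_ (hN p hp)
        refine mod_cast Finset.card_le_card fun r hr ↦ ?_
        rw [Finset.mem_filter] at hr ⊢
        refine ⟨hr.1, ?_⟩
        rw [← (hBmem (h1 r hr.1)).mp hr.2, (hBmem (h1 p hp)).mp hpn]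
      _ = N * ∑ n ∈ V, w n := by rw [Finset.mul_sum]
      _ ≤ N * ∑' n, w n := by
        gcongr
        exact hs.sum_le_tsum _ fun n _ ↦ hw n
  rw [← Finset.mul_sum] at hbound
  rw [div_mul_eq_mul_div, le_div_iff₀ hq0]
  linarith

/-- Each weight at a point of `P` dominates the average of the weights in the following block of
length `q`. -/
lemma mul_sum_le {q : ℕ} (hq : 0 < q) {P M : Finset ℕ} {w : ℕ → ℝ} (hw : ∀ n, 0 ≤ w n) {N : ℝ}
    (hanti : ∀ p ∈ P, ∀ n ∈ M, n / q = p / q + 1 → w n ≤ w p)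
    (hN : ∀ n ∈ M, N ≤ ((P.filter fun p ↦ n / q = p / q + 1).card : ℝ)) :
    N / q * ∑ n ∈ M, w n ≤ ∑ p ∈ P, w p := by
  have hq0 : (0 : ℝ) < q := mod_cast hq
  have hbound : N * ∑ n ∈ M, w n ≤ ∑ p ∈ P, q * w p := by
    calc N * ∑ n ∈ M, w n = ∑ n ∈ M, N * w n := by rw [Finset.mul_sum]
      _ ≤ ∑ n ∈ M, ∑ _p ∈ P.filter (fun p ↦ n / q = p / q + 1), w n := by
        refine Finset.sum_le_sum fun n hn ↦ ?_
        rw [Finset.sum_const, nsmul_eq_mul]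
        exact mul_le_mul_of_nonneg_right (hN n hn) (hw n)
      _ = ∑ p ∈ P, ∑ n ∈ M.filter (fun n ↦ n / q = p / q + 1), w n := by
        refine Finset.sum_comm' fun n p ↦ ?_
        simp only [Finset.mem_filter]; tauto
      _ ≤ _ := by
        refine Finset.sum_le_sum fun p hp ↦ ?_
        have h1 := Finset.sum_le_card_nsmul (M.filter (fun n ↦ n / q = p / q + 1)) w (w p) (by
          intro n hn
          rw [Finset.mem_filter] at hn
          exact hanti p hp n hn.1 hn.2)
        refine h1.trans ?_
        rw [nsmul_eq_mul]
        refine mul_le_mul_of_nonneg_right ?_ (hw p)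
        have h2 : M.filter (fun n ↦ n / q = p / q + 1) ⊆
            Finset.Ico ((p / q + 1) * q) ((p / q + 1) * q + q) := by
          intro n hn
          rw [Finset.mem_filter, Nat.div_eq_iff hq] at hn
          rw [Finset.mem_Ico]
          exact ⟨hn.2.1, by lia⟩
        have := Finset.card_le_card h2
        rw [Nat.card_Ico, Nat.add_sub_cancel_left] at this
        exact_mod_cast this
  rw [← Finset.mul_sum] at hbound
  rw [div_mul_eq_mul_div, div_le_iff₀ hq0]
  linarith

lemma sum_residueClass_mul {q : ℕ} {J M : Finset ℕ} (hJ : ∀ j ∈ J, j < q) (w : ℕ → ℝ) :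
    ∑ j ∈ J, ∑ n ∈ M, residueClass (j : ZMod q) n * w n =
      ∑ n ∈ M.filter (fun n ↦ n % q ∈ J), ArithmeticFunction.vonMangoldt n * w n := by
  rw [Finset.sum_comm, Finset.sum_filter]
  refine Finset.sum_congr rfl fun n _ ↦ ?_
  have h (j : ℕ) (hj : j ∈ J) : residueClass (j : ZMod q) n * w n =
      if n % q = j then ArithmeticFunction.vonMangoldt n * w n else 0 := by
    have : n ∈ {m : ℕ | (m : ZMod q) = j} ↔ n % q = j := by
      rw [Set.mem_ofPred_eq, ZMod.natCast_eq_natCast_iff', Nat.mod_eq_of_lt (hJ j hj)]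
    rw [residueClass, Set.indicator_apply]
    simp only [this]
    split_ifs <;> simp
  rw [Finset.sum_congr rfl h, Finset.sum_ite_eq]

lemma residueClass_nonneg {q : ℕ} (a : ZMod q) (n : ℕ) : 0 ≤ residueClass a n :=
  Set.indicator_nonneg (fun _ _ ↦ ArithmeticFunction.vonMangoldt_nonneg) n

lemma wt_le_div {η : ℝ} {k n : ℕ} (hη : 0 < η) (hn : 1 ≤ n) :
    wt η k n ≤ k.factorial / η ^ k / n := by
  have hn0 : (0 : ℝ) < n := mod_cast hn
  have hlog := Real.log_natCast_nonneg n
  have h := Real.pow_div_factorial_le_exp (η * Real.log n) (by positivity) k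
  rw [div_le_iff₀ (by positivity), mul_pow] at h
  have e : (n : ℝ) ^ (-(1 + η)) = (Real.exp (η * Real.log n))⁻¹ / n := by
    rw [Real.rpow_neg hn0.le, Real.rpow_add hn0, Real.rpow_one, Real.rpow_def_of_pos hn0 η,
      mul_inv, mul_comm (Real.log n)]
    ring
  rw [wt, e, mul_div_assoc']
  gcongr
  rw [← div_eq_mul_inv, div_le_iff₀ (Real.exp_pos _), div_mul_eq_mul_div,
    le_div_iff₀ (by positivity)]
  linarith

/-- The contribution of proper prime powers is negligible. -/
lemma sum_not_prime_le {η ε : ℝ} {k : ℕ} (hη : 0 < η) (hk : 1 ≤ k) (hε : 0 < ε) (hε1 : ε ≤ 1 / 6) :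
    ∑ n ∈ (mid (k / η) ε).filter (fun n ↦ ¬ n.Prime),
      ArithmeticFunction.vonMangoldt n * wt η k n ≤
      (k.factorial / η ^ (k + 1)) * (4 * k * Real.exp (-((k / η) / 4))) := by
  have hk0 : (0 : ℝ) < k := mod_cast hk
  set Y := (k : ℝ) / η with hY
  have hY0 : 0 < Y := by positivity
  have hYη : Y * η = k := by rw [hY]; field_simp
  set m := (k.factorial : ℝ) / η ^ (k + 1) with hm
  have hm' : (k.factorial : ℝ) / η ^ k = m * η := by rw [hm, pow_succ]; field_simp
  have hterm : ∀ n ∈ (mid Y ε).filter (fun n ↦ ¬ n.Prime),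
      ArithmeticFunction.vonMangoldt n * wt η k n ≤
        ArithmeticFunction.vonMangoldt n * (m * η / Real.exp ((1 - ε) * Y)) := by
    intro n hn
    refine mul_le_mul_of_nonneg_left ?_ ArithmeticFunction.vonMangoldt_nonneg
    rw [Finset.mem_filter, mem_mid, abs_le] at hn
    have hn1 : 1 ≤ n := by
      by_contra h
      have : n = 0 := by lia
      subst this
      have := hn.1.1
      simp at this
      nlinarith
    refine (wt_le_div hη hn1).trans ?_
    rw [hm']
    gcongr
    rw [← Real.le_log_iff_exp_le (mod_cast hn1)]
    linarith [hn.1.1]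
  refine (Finset.sum_le_sum hterm).trans ?_
  rw [← Finset.sum_mul]
  set x := Real.exp ((1 + ε) * Y) with hx
  have hx1 : 1 ≤ x := Real.one_le_exp (by positivity)
  have hpsi : ∑ n ∈ (mid Y ε).filter (fun n ↦ ¬ n.Prime), ArithmeticFunction.vonMangoldt n ≤
      2 * √x * Real.log x := by
    refine le_trans ?_ (Chebyshev.psi_sub_theta_le hx1)
    rw [Chebyshev.psi_sub_theta_eq_sum_not_prime]
    have hsub : ((mid Y ε).filter (fun n ↦ ¬ n.Prime)).erase 0 ⊆
        (Finset.Ioc 0 ⌊x⌋₊).filter (fun n ↦ ¬ n.Prime) := by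
      intro n hn
      simp only [Finset.mem_erase, Finset.mem_filter, mid, Finset.mem_range] at hn
      simp only [Finset.mem_filter, Finset.mem_Ioc]
      exact ⟨⟨by lia, by lia⟩, hn.2.2⟩
    rw [← Finset.sum_erase (a := 0) _ (by simp)]
    exact Finset.sum_le_sum_of_subset_of_nonneg hsub
      fun _ _ _ ↦ ArithmeticFunction.vonMangoldt_nonneg
  have hsqrt : √x = Real.exp ((1 + ε) * Y / 2) := by rw [hx, ← Real.exp_half]
  rw [hsqrt, hx, Real.log_exp] at hpsi
  calc _ ≤ 2 * Real.exp ((1 + ε) * Y / 2) * ((1 + ε) * Y) * (m * η / Real.exp ((1 - ε) * Y)) := by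
        gcongr
    _ = m * (2 * (1 + ε) * k * (Real.exp ((1 + ε) * Y / 2) / Real.exp ((1 - ε) * Y))) := by
        rw [← hYη]; ring
    _ ≤ m * (4 * k * Real.exp (-(Y / 4))) := by
        rw [← Real.exp_sub]
        gcongr
        · linarith
        · nlinarith

lemma le_log_of_mem_mid {Y ε : ℝ} {q n m : ℕ} (hn : n ∈ mid Y ε) (hY : 0 < Y) (hε1 : ε ≤ 1 / 6)
    (hεY : 1 ≤ ε * Y) (hq : 4 * (q : ℝ) ≤ Real.exp ((1 - ε) * Y)) (h : n ≤ m + 2 * q) :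
    (1 - 2 * ε) * Y ≤ Real.log m := by
  rw [mem_mid, abs_le] at hn
  have hn0 : (0 : ℝ) < n := by
    rcases Nat.eq_zero_or_pos n with rfl | hn0
    · have := hn.1
      simp at this
      nlinarith
    · exact_mod_cast hn0
  have h1 : Real.exp ((1 - ε) * Y) ≤ n := by
    rw [← Real.le_log_iff_exp_le hn0]; linarith [hn.1]
  have h2 : (n : ℝ) ≤ m + 2 * q := mod_cast h
  have h3 : Real.exp ((1 - ε) * Y) = Real.exp ((1 - 2 * ε) * Y) * Real.exp (ε * Y) := by
    rw [← Real.exp_add]; congr 1; ring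
  have h4 : 2 ≤ Real.exp (ε * Y) := by linarith [Real.add_one_le_exp (ε * Y)]
  have h5 : Real.exp ((1 - 2 * ε) * Y) ≤ m := by
    have := Real.exp_pos ((1 - 2 * ε) * Y)
    nlinarith
  rwa [Real.le_log_iff_exp_le ((Real.exp_pos _).trans_le h5)]

lemma log_le_of_mem_mid {Y ε : ℝ} {n m : ℕ} (hn : n ∈ mid Y ε) (hm : 1 ≤ m) (h : m ≤ n) :
    Real.log m ≤ (1 + ε) * Y := by
  rw [mem_mid, abs_le] at hn
  have : Real.log m ≤ Real.log n := Real.log_le_log (mod_cast hm) (mod_cast h)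
  linarith [hn.2]

lemma one_le_of_le_log {m : ℕ} {c : ℝ} (hc : 0 < c) (h : c ≤ Real.log m) : 1 ≤ m := by
  by_contra hm
  have : m = 0 := by lia
  subst this
  simp at h; linarith

/-- Counting primes in the matrix with rows `(rq, rq + U]` by columns (from below) and by rows
(from above). -/
lemma columns_le_rows {q U k : ℕ} {η ε E N : ℝ} (hq : 0 < q) (hU : U < q) (hη : 0 < η)
    (hkη : (k : ℝ) ≤ (1 - 2 * ε) * (k / η)) (hk : 1 ≤ k) (hε : 0 < ε) (hε1 : ε ≤ 1 / 6) (hE : 0 ≤ E)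
    (h1 : Moments (fun _ ↦ 1) 1 η k E)
    (hm : ∀ a : ZMod q, IsUnit a → Moments (residueClass a) (q.totient : ℝ)⁻¹ η k E)
    (hq4 : 4 * (q : ℝ) ≤ Real.exp ((1 - ε) * (k / η))) (hεY : 1 ≤ ε * (k / η)) (hN0 : 0 ≤ N)
    (hN : ∀ x : ℕ, (1 - 2 * ε) * (k / η) ≤ Real.log x → Real.log x ≤ (1 + ε) * (k / η) →
      (((Finset.Ioc x (x + U)).filter Nat.Prime).card : ℝ) ≤ N) :
    coprimeCount q U * (q.totient : ℝ)⁻¹ * (1 - E - (3 / k + 11 * E) / ε ^ 2) ≤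
      (1 + ε) * (k / η) * (N / q * (1 + E)) + 4 * k * Real.exp (-((k / η) / 4)) := by
  have hk0 : (0 : ℝ) < k := mod_cast hk
  set Y := (k : ℝ) / η with hY
  have hY0 : 0 < Y := by positivity
  set m := (k.factorial : ℝ) / η ^ (k + 1) with hmdef
  have hm0 : 0 < m := by positivity
  set J := (Finset.Ioc 0 U).filter (Nat.Coprime q) with hJ
  have hJq : ∀ j ∈ J, j < q := by
    intro j hj
    rw [hJ, Finset.mem_filter, Finset.mem_Ioc] at hj
    lia
  set M := (mid Y ε).filter (fun n ↦ n % q ∈ J) with hM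
  have hlow : coprimeCount q U * (q.totient : ℝ)⁻¹ * (1 - E - (3 / k + 11 * E) / ε ^ 2) * m ≤
      ∑ n ∈ M, ArithmeticFunction.vonMangoldt n * wt η k n := by
    rw [hM, ← sum_residueClass_mul hJq (fun n ↦ wt η k n)]
    have h2 : ∀ j ∈ J, (1 - E - (3 / k + 11 * E) / ε ^ 2) * ((q.totient : ℝ)⁻¹ * m) ≤
        ∑ n ∈ mid Y ε, residueClass (j : ZMod q) n * wt η k n := by
      intro j hj
      refine (hm j ?_).le_sum_mid (residueClass_nonneg _) (by positivity) hη hk hE hε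
      rw [ZMod.isUnit_iff_coprime]
      exact (Finset.mem_filter.mp hj).2.symm
    have h3 := Finset.card_nsmul_le_sum J _ _ h2
    rw [nsmul_eq_mul] at h3
    refine le_trans (le_of_eq ?_) h3
    rw [coprimeCount]; ring
  set P := M.filter Nat.Prime with hP
  have hPmid : ∀ p ∈ P, p ∈ mid Y ε := fun p hp ↦
    Finset.filter_subset _ _ (Finset.filter_subset _ _ hp)
  have hPdm : ∀ p ∈ P, p / q * q < p ∧ p ≤ p / q * q + U := by
    intro p hp
    have h2 := (Finset.mem_filter.mp (Finset.mem_filter.mp hp).1).2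
    rw [hJ, Finset.mem_filter, Finset.mem_Ioc] at h2
    have := Nat.div_add_mod' p q
    lia
  have hPlog : ∀ p ∈ P, (1 - 2 * ε) * Y ≤ Real.log (p / q * q : ℕ) := fun p hp ↦
    le_log_of_mem_mid (hPmid p hp) hY0 hε1 hεY hq4 (by have := (hPdm p hp).2; lia)
  have hc : 0 < (1 - 2 * ε) * Y := mul_pos (by linarith) hY0
  have hPge : ∀ p ∈ P, 1 ≤ p / q * q := fun p hp ↦ one_le_of_le_log hc (hPlog p hp)
  have hrows : ∑ p ∈ P, wt η k p ≤ N / q * ∑' n : ℕ, wt η k n := by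
    refine sum_le_mul_tsum hq (wt_nonneg η k) ?_ hN0 ?_ ?_ ?_
    · simpa using (h1 k le_rfl).1
    · intro p hp
      exact Nat.pos_of_mul_pos_right (hPge p hp)
    · intro p hp n hn
      have hmod := Nat.div_add_mod' n q
      have hmodlt := Nat.mod_lt n hq
      have hpq : p / q * q = n / q * q + q := by rw [← hn]; ring
      have := hPdm p hp
      refine wt_le_wt hη hk (hkη.trans ?_) (by lia)
      exact le_log_of_mem_mid (hPmid p hp) hY0 hε1 hεY hq4 (by lia)
    · intro p hp
      refine le_trans ?_ (hN (p / q * q) (hPlog p hp)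
        (log_le_of_mem_mid (hPmid p hp) (hPge p hp) (hPdm p hp).1.le))
      refine mod_cast Finset.card_le_card fun r hr ↦ ?_
      rw [Finset.mem_filter] at hr
      have h2 := hPdm r hr.1
      rw [hr.2] at h2
      rw [Finset.mem_filter, Finset.mem_Ioc]
      exact ⟨h2, (Finset.mem_filter.mp hr.1).2⟩
  have hprime : ∑ p ∈ P, ArithmeticFunction.vonMangoldt p * wt η k p ≤
      (1 + ε) * Y * (N / q * ((1 + E) * m)) := by
    calc _ ≤ ∑ p ∈ P, (1 + ε) * Y * wt η k p := by
          refine Finset.sum_le_sum fun p hp ↦ mul_le_mul_of_nonneg_right ?_ (wt_nonneg _ _ _)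
          have hpp := (Finset.mem_filter.mp hp).2
          rw [ArithmeticFunction.vonMangoldt_apply_prime hpp]
          exact log_le_of_mem_mid (hPmid p hp) hpp.one_le le_rfl
      _ = (1 + ε) * Y * ∑ p ∈ P, wt η k p := by rw [Finset.mul_sum]
      _ ≤ (1 + ε) * Y * (N / q * ∑' n : ℕ, wt η k n) := by gcongr
      _ ≤ _ := by
        gcongr
        simpa using h1.le
  have hnonprime : ∑ p ∈ M.filter (fun n ↦ ¬ n.Prime), ArithmeticFunction.vonMangoldt p * wt η k p ≤
      m * (4 * k * Real.exp (-(Y / 4))) := by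
    refine le_trans ?_ (sum_not_prime_le hη hk hε hε1)
    exact Finset.sum_le_sum_of_subset_of_nonneg
      (Finset.filter_subset_filter _ (Finset.filter_subset _ _))
      fun _ _ _ ↦ mul_nonneg ArithmeticFunction.vonMangoldt_nonneg (wt_nonneg _ _ _)
  rw [← Finset.sum_filter_add_sum_filter_not M Nat.Prime] at hlow
  refine le_of_mul_le_mul_right ?_ hm0
  linarith

/-- Counting primes in the matrix with rows `(rq, rq + U]` by rows (from below) and by columns
(from above). -/
lemma rows_le_columns {q U k : ℕ} {η ε E N : ℝ} (hq : 0 < q) (hU : U < q) (hη : 0 < η)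
    (hkη : (k : ℝ) ≤ (1 - 2 * ε) * (k / η)) (hk : 1 ≤ k) (hε : 0 < ε) (hε1 : ε ≤ 1 / 6) (hE : 0 ≤ E)
    (h1 : Moments (fun _ ↦ 1) 1 η k E)
    (hm : ∀ a : ZMod q, IsUnit a → Moments (residueClass a) (q.totient : ℝ)⁻¹ η k E)
    (hq4 : 4 * (q : ℝ) ≤ Real.exp ((1 - 2 * ε) * (k / η))) (hεY : 1 ≤ ε * (k / η)) (hN0 : 0 ≤ N)
    (hN : ∀ x : ℕ, (1 - 2 * ε) * (k / η) ≤ Real.log x → Real.log x ≤ (1 + ε) * (k / η) →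
      N ≤ (((Finset.Ioc x (x + U)).filter Nat.Prime).card : ℝ)) :
    (1 - 2 * ε) * (k / η) * (N / q * (1 - E - (3 / k + 11 * E) / ε ^ 2)) ≤
      coprimeCount q U * (q.totient : ℝ)⁻¹ * (1 + E) := by
  have hk0 : (0 : ℝ) < k := mod_cast hk
  have hq0 : (0 : ℝ) < q := mod_cast hq
  set Y := (k : ℝ) / η with hY
  have hY0 : 0 < Y := by positivity
  set m := (k.factorial : ℝ) / η ^ (k + 1) with hmdef
  have hm0 : 0 < m := by positivity
  have hc : 0 < (1 - 2 * ε) * Y := mul_pos (by linarith) hY0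
  have hq4' : 4 * (q : ℝ) ≤ Real.exp ((1 - ε) * Y) :=
    hq4.trans (Real.exp_le_exp.mpr (by nlinarith))
  set J := (Finset.Ioc 0 U).filter (Nat.Coprime q) with hJ
  have hJq : ∀ j ∈ J, j < q := by
    intro j hj
    rw [hJ, Finset.mem_filter, Finset.mem_Ioc] at hj
    lia
  set P := (mid Y (2 * ε)).filter (fun p ↦ p.Prime ∧ p % q ∈ Finset.Ioc 0 U) with hP
  have hPlog : ∀ p ∈ P, (1 - 2 * ε) * Y ≤ Real.log p := by
    intro p hp
    have := (Finset.mem_filter.mp hp).1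
    rw [mem_mid, abs_le] at this
    linarith [this.1]
  have hPJ : ∀ p ∈ P, p % q ∈ J := by
    intro p hp
    have h2 := (Finset.mem_filter.mp hp).2
    rw [hJ, Finset.mem_filter]
    refine ⟨h2.2, ?_⟩
    rw [Nat.Coprime, Nat.gcd_comm, ← Nat.gcd_rec, Nat.gcd_comm]
    change Nat.Coprime p q
    rw [h2.1.coprime_iff_not_dvd]
    intro hdvd
    have h3 : p ≤ q := Nat.le_of_dvd hq hdvd
    have h4 := hPlog p hp
    rw [Real.le_log_iff_exp_le (mod_cast h2.1.pos)] at h4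
    have : (p : ℝ) ≤ q := mod_cast h3
    linarith
  have hup : ∑ p ∈ P, ArithmeticFunction.vonMangoldt p * wt η k p ≤
      coprimeCount q U * (q.totient : ℝ)⁻¹ * (1 + E) * m := by
    have h2 : ∀ j ∈ J, ∑ n ∈ P, residueClass (j : ZMod q) n * wt η k n ≤
        (1 + E) * ((q.totient : ℝ)⁻¹ * m) := by
      intro j hj
      have hju : IsUnit (j : ZMod q) := by
        rw [ZMod.isUnit_iff_coprime]
        exact (Finset.mem_filter.mp hj).2.symm
      refine le_trans ?_ (hm j hju).le
      exact ((hm j hju) k le_rfl).1.sum_le_tsum _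
        fun n _ ↦ mul_nonneg (residueClass_nonneg _ _) (wt_nonneg _ _ _)
    have h3 := Finset.sum_le_card_nsmul J _ _ h2
    rw [sum_residueClass_mul hJq (fun n ↦ wt η k n), Finset.filter_true_of_mem hPJ,
      nsmul_eq_mul] at h3
    refine h3.trans (le_of_eq ?_)
    rw [coprimeCount]; ring
  have hrows : N / q * ∑ n ∈ mid Y ε, wt η k n ≤ ∑ p ∈ P, wt η k p := by
    refine mul_sum_le hq (wt_nonneg η k) ?_ ?_
    · intro p hp n hn hnp
      refine wt_le_wt hη hk (hkη.trans (hPlog p hp)) ?_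
      exact (Nat.lt_of_div_lt_div (by lia : p / q < n / q)).le
    · intro n hn
      have hdm := Nat.div_add_mod' n q
      have hml := Nat.mod_lt n hq
      have hnq : 1 ≤ n / q := by
        have h2 := one_le_of_le_log hc (le_log_of_mem_mid (q := q) (m := n - q) hn hY0 hε1 hεY hq4'
          (by lia))
        by_contra h
        have : n / q = 0 := by lia
        rw [this] at hdm
        lia
      obtain ⟨r, hr⟩ : ∃ r, n / q = r + 1 := ⟨n / q - 1, by lia⟩
      have hrq : n / q * q = r * q + q := by rw [hr]; ring
      have hlog := le_log_of_mem_mid (q := q) (m := r * q) hn hY0 hε1 hεY hq4' (by lia)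
      have hr1 := one_le_of_le_log hc hlog
      refine (hN (r * q) hlog (log_le_of_mem_mid hn hr1 (by lia))).trans ?_
      refine mod_cast Finset.card_le_card fun p hp ↦ ?_
      rw [Finset.mem_filter, Finset.mem_Ioc] at hp
      have hpr : p / q = r := by rw [Nat.div_eq_iff hq]; lia
      have hdp := Nat.div_add_mod' p q
      rw [hpr] at hdp
      have hp1 : Real.log (r * q : ℕ) ≤ Real.log p :=
        Real.log_le_log (mod_cast hr1) (mod_cast hp.1.1.le)
      have hp2 := log_le_of_mem_mid (m := p) hn (by lia) (by lia)
      rw [Finset.mem_filter, hP, Finset.mem_filter, mem_mid, abs_le, Finset.mem_Ioc, hpr, hr]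
      refine ⟨⟨⟨by linarith, by nlinarith⟩, hp.2, by lia, by lia⟩, rfl⟩
  have hmain : (1 - 2 * ε) * Y * (N / q * ((1 - E - (3 / k + 11 * E) / ε ^ 2) * m)) ≤
      ∑ p ∈ P, ArithmeticFunction.vonMangoldt p * wt η k p := by
    calc _ ≤ (1 - 2 * ε) * Y * (N / q * ∑ n ∈ mid Y ε, wt η k n) := by
          gcongr
          simpa using h1.le_sum_mid (fun _ ↦ zero_le_one) zero_le_one hη hk hE hε
      _ ≤ (1 - 2 * ε) * Y * ∑ p ∈ P, wt η k p := by gcongr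
      _ = ∑ p ∈ P, (1 - 2 * ε) * Y * wt η k p := by rw [Finset.mul_sum]
      _ ≤ _ := by
        refine Finset.sum_le_sum fun p hp ↦ mul_le_mul_of_nonneg_right ?_ (wt_nonneg _ _ _)
        rw [ArithmeticFunction.vonMangoldt_apply_prime (Finset.mem_filter.mp hp).2.1]
        exact hPlog p hp
  refine le_of_mul_le_mul_right ?_ hm0
  linarith

lemma pow_le_rpow {β : ℝ} (hβ : 13 ≤ β) {z : ℕ} (hz : 1 ≤ z) : (z : ℝ) ^ 13 ≤ (z : ℝ) ^ β := by
  rw [← Real.rpow_natCast]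
  exact Real.rpow_le_rpow_of_exponent_le (mod_cast hz) (by norm_num; exact hβ)

lemma four_pow_le_exp (z : ℕ) : (4 : ℝ) ^ z ≤ Real.exp (2 * z) := by
  have : (4 : ℝ) ≤ Real.exp 2 := by
    have h := Real.exp_one_gt_d9
    rw [show (2 : ℝ) = 1 + 1 by norm_num, Real.exp_add]
    nlinarith
  calc (4 : ℝ) ^ z ≤ Real.exp 2 ^ z := by gcongr
    _ = _ := by rw [← Real.exp_nat_mul, mul_comm]

lemma eventually_mul_rpow_add_le {a b c d : ℝ} (hb : 0 < b) (hab : a < b) :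
    ∀ᶠ z : ℕ in atTop, c * (z : ℝ) ^ a + d ≤ (z : ℝ) ^ b := by
  have h1 : ∀ᶠ z : ℕ in atTop, 2 * c ≤ (z : ℝ) ^ (b - a) :=
    ((tendsto_rpow_atTop (by linarith)).comp tendsto_natCast_atTop_atTop).eventually_ge_atTop _
  have h2 : ∀ᶠ z : ℕ in atTop, 2 * d ≤ (z : ℝ) ^ b :=
    ((tendsto_rpow_atTop hb).comp tendsto_natCast_atTop_atTop).eventually_ge_atTop _
  filter_upwards [h1, h2, eventually_ge_atTop 1] with z hz1 hz2 hz
  have hz0 : (0 : ℝ) < z := by exact_mod_cast hz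
  have h3 : (z : ℝ) ^ b = (z : ℝ) ^ (b - a) * (z : ℝ) ^ a := by
    rw [← Real.rpow_add hz0]; ring_nf
  have h4 : 2 * c * (z : ℝ) ^ a ≤ (z : ℝ) ^ b := by
    rw [h3]; gcongr
  linarith

theorem exists_matrix {lam : ℝ} (hlam : 1 < lam) {K : ℕ} (hK : 13 * lam + 1 ≤ K) :
    ∃ δ C : ℝ, 0 < δ ∧ δ ≤ 1 / 2 ∧ 0 ≤ C ∧ ∀ ε : ℝ, 0 < ε → ε ≤ 1 / 6 → ∀ᶠ z : ℕ in atTop, ∀ U : ℕ,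
    ((1 - 2 * ε) * (z : ℝ) ^ ((K - 1 / 2) / lam)) ^ lam - 1 ≤ U →
    (U : ℝ) ≤ ((1 + ε) * (z : ℝ) ^ ((K - 1 / 2) / lam)) ^ lam + 1 →
    ∃ (q : ℕ) (η : ℝ), ((10 * z : ℕ) : ℝ) / η = (z : ℝ) ^ ((K - 1 / 2) / lam) ∧ 0 < η ∧ 0 < q ∧
      q ≤ 4 ^ z ∧ U < q ∧ 0 < U ∧ Moments (fun _ ↦ 1) 1 η (10 * z) (C * (1 / 2) ^ z) ∧
      (∀ a : ZMod q, IsUnit a →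
        Moments (residueClass a) (q.totient : ℝ)⁻¹ η (10 * z) (C * (1 / 2) ^ z)) ∧
      δ ≤ (-1) ^ K * ((q.totient : ℝ) / q - coprimeCount q U / U) := by
  have hlam0 : 0 < lam := by linarith
  have hK1 : 1 ≤ K := by
    have : (1 : ℝ) ≤ K := by linarith
    exact_mod_cast this
  obtain ⟨δ, hδ, hS⟩ := exists_sieve hK1
  obtain ⟨C, hC, hM⟩ := exists_moments
  refine ⟨min δ (1 / 2), C, by positivity, min_le_right _ _, hC, fun ε hε hε6 ↦ ?_⟩
  set β : ℝ := (K - 1 / 2) / lam with hβ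
  have hβ13 : 13 ≤ β := by rw [hβ, le_div_iff₀ hlam0]; linarith
  have h2ε : (0 : ℝ) < 1 - 2 * ε := by linarith
  have hc : 0 < (1 - 2 * ε) ^ lam := by positivity
  have hK0 : (14 : ℝ) ≤ K := by linarith
  have hlow := eventually_mul_rpow_add_le (a := K - 2 / 3) (b := K - 1 / 2)
    (c := 1 / (1 - 2 * ε) ^ lam) (d := 1 / (1 - 2 * ε) ^ lam) (by linarith) (by linarith)
  have hupp := eventually_mul_rpow_add_le (a := K - 1 / 2) (b := K - 1 / 3)
    (c := (1 + ε) ^ lam) (d := 1) (by linarith) (by linarith)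
  filter_upwards [hS, hM, hlow, hupp, eventually_ge_atTop (10 ^ 9)] with
    z hSz hMz hl hu hz U hU1 hU2
  have hz9 : (10 ^ 9 : ℝ) ≤ z := by exact_mod_cast hz
  have hz1 : 1 ≤ z := by lia
  have hz0 : (0 : ℝ) < z := by linarith
  have hY : 0 < (z : ℝ) ^ β := by positivity
  have hYl : ((z : ℝ) ^ β) ^ lam = (z : ℝ) ^ (K - 1 / 2 : ℝ) := by
    rw [← Real.rpow_mul hz0.le, hβ, div_mul_cancel₀ _ hlam0.ne']
  rw [Real.mul_rpow (by linarith) hY.le, hYl] at hU1 hU2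
  have hl' : (z : ℝ) ^ (K - 2 / 3 : ℝ) + 1 ≤ (1 - 2 * ε) ^ lam * (z : ℝ) ^ (K - 1 / 2 : ℝ) := by
    calc (z : ℝ) ^ (K - 2 / 3 : ℝ) + 1 = (1 - 2 * ε) ^ lam *
        (1 / (1 - 2 * ε) ^ lam * (z : ℝ) ^ (K - 2 / 3 : ℝ) + 1 / (1 - 2 * ε) ^ lam) := by
          field_simp
      _ ≤ _ := by gcongr
  obtain ⟨S, hSp, hne, hS4, hSU⟩ := hSz
  have hSpos : 0 < ∏ p ∈ S, p := Finset.prod_pos fun p hp ↦ (hSp p hp).1.pos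
  have hlog : Real.log (∏ r ∈ S, r : ℕ) ≤ 2 * z := by
    rw [Real.log_le_iff_le_exp (by exact_mod_cast hSpos)]
    exact le_trans (by exact_mod_cast hS4) (four_pow_le_exp z)
  obtain ⟨p, hp, hgood⟩ := exists_goodModulus (fun p hp ↦ (hSp p hp).1) hne (by linarith) hlog
  have hq0 : 0 < ∏ r ∈ S.erase p, r :=
    Finset.prod_pos fun r hr ↦ (hSp r (Finset.mem_of_mem_erase hr)).1.pos
  have hq4 : ∏ r ∈ S.erase p, r ≤ 4 ^ z := by
    refine le_trans (Nat.le_of_dvd hSpos ?_) hS4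
    exact Finset.prod_dvd_prod_of_subset _ _ _ (Finset.erase_subset _ _)
  obtain ⟨hUq, hδU⟩ := hSU p hp U (by linarith) (by linarith)
  have hU0 : 0 < U := by
    have : (0 : ℝ) < U := lt_of_lt_of_le (by positivity : (0 : ℝ) < (z : ℝ) ^ (K - 2 / 3 : ℝ))
      (by linarith)
    exact_mod_cast this
  have hη : 0 < ((10 * z : ℕ) : ℝ) / (z : ℝ) ^ β := by push_cast; positivity
  have h3η : 3 * (((10 * z : ℕ) : ℝ) / (z : ℝ) ^ β) ≤ 1 / (10 ^ 13 * (2 * z : ℝ) ^ 10) := by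
    have h13 := pow_le_rpow hβ13 hz1
    calc 3 * (((10 * z : ℕ) : ℝ) / (z : ℝ) ^ β) ≤ 3 * (((10 * z : ℕ) : ℝ) / (z : ℝ) ^ 13) := by
          gcongr
      _ ≤ _ := by
          push_cast
          rw [← mul_div_assoc, div_le_div_iff₀ (by positivity) (by positivity)]
          have : (307200 * 10 ^ 12 : ℝ) ≤ (z : ℝ) ^ 2 := by nlinarith
          calc 3 * (10 * (z : ℝ)) * (10 ^ 13 * (2 * z : ℝ) ^ 10)
              = (z : ℝ) ^ 11 * (307200 * 10 ^ 12) := by ring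
            _ ≤ (z : ℝ) ^ 11 * (z : ℝ) ^ 2 := by gcongr
            _ = _ := by ring
  obtain ⟨hM1, hM2⟩ := hMz _ hη h3η
  refine ⟨∏ r ∈ S.erase p, r, _, ?_, hη, hq0, hq4, hUq, hU0, hM1, hM2 _ hgood hq4,
    (min_le_left _ _).trans hδU⟩
  have : ((10 * z : ℕ) : ℝ) ≠ 0 := by push_cast; positivity
  field_simp

lemma primePi_add_sub (x : ℕ) {H : ℝ} (hH : 0 ≤ H) :
    (primePi (x + H) : ℝ) - primePi x =
      ((Finset.Ioc x (x + ⌊H⌋₊)).filter Nat.Prime).card := by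
  have h : ⌊(x : ℝ) + H⌋₊ = x + ⌊H⌋₊ := by
    rw [add_comm, Nat.floor_add_natCast hH, add_comm]
  have hd : Finset.range (x + ⌊H⌋₊ + 1) = Finset.range (x + 1) ∪ Finset.Ioc x (x + ⌊H⌋₊) := by
    ext n; simp only [Finset.mem_range, Finset.mem_union, Finset.mem_Ioc]; lia
  have hdis : Disjoint (Finset.range (x + 1)) (Finset.Ioc x (x + ⌊H⌋₊)) := by
    rw [Finset.disjoint_left]; intro n; simp only [Finset.mem_range, Finset.mem_Ioc]; lia
  rw [primePi, primePi, h, Nat.floor_natCast, hd, Finset.filter_union,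
    Finset.card_union_of_disjoint (Finset.disjoint_filter_filter hdis)]
  push_cast; ring

lemma eventually_side_conditions {β ε : ℝ} (hβ : 13 ≤ β) (hε : 0 < ε) (hε6 : ε ≤ 1 / 6) (T : ℝ) :
    ∀ᶠ z : ℕ in atTop, 10 * (z : ℝ) ≤ (1 - 2 * ε) * (z : ℝ) ^ β ∧
      4 * (4 : ℝ) ^ z ≤ Real.exp ((1 - 2 * ε) * (z : ℝ) ^ β) ∧ 1 ≤ ε * (z : ℝ) ^ β ∧
      T ≤ (1 - 2 * ε) * (z : ℝ) ^ β ∧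
      (4 : ℝ) ^ z * (4 * (10 * z) * Real.exp (-((z : ℝ) ^ β / 4))) ≤ 1 := by
  have ht : Tendsto (fun z : ℕ ↦ (z : ℝ) ^ β) atTop atTop :=
    (tendsto_rpow_atTop (by linarith)).comp tendsto_natCast_atTop_atTop
  filter_upwards [ht.eventually_ge_atTop (1 / ε), ht.eventually_ge_atTop (3 / 2 * |T|),
    eventually_ge_atTop 10] with z h1 h2 hz
  have hz10 : (10 : ℝ) ≤ z := by exact_mod_cast hz
  have h13 := pow_le_rpow hβ (by lia : 1 ≤ z)
  have hz12 : (10 : ℝ) ^ 12 ≤ (z : ℝ) ^ 12 := by gcongr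
  have hzY : 10 ^ 12 * (z : ℝ) ≤ (z : ℝ) ^ β := by
    calc 10 ^ 12 * (z : ℝ) ≤ (z : ℝ) ^ 12 * z := by gcongr
      _ = (z : ℝ) ^ 13 := by ring
      _ ≤ _ := h13
  have hY : 2 / 3 * (z : ℝ) ^ β ≤ (1 - 2 * ε) * (z : ℝ) ^ β := by gcongr; linarith
  have h4 := four_pow_le_exp z
  refine ⟨by linarith, ?_, ?_, by linarith [le_abs_self T], ?_⟩
  · calc 4 * (4 : ℝ) ^ z = 4 ^ (z + 1) := by ring
      _ ≤ Real.exp (2 * (z + 1 : ℕ)) := four_pow_le_exp _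
      _ ≤ _ := by
        rw [Real.exp_le_exp]; push_cast; linarith
  · rwa [div_le_iff₀ hε, mul_comm] at h1
  · have h40 : 4 * (10 * (z : ℝ)) ≤ Real.exp (40 * z) := by
      linarith [Real.add_one_le_exp (40 * (z : ℝ))]
    calc (4 : ℝ) ^ z * (4 * (10 * z) * Real.exp (-((z : ℝ) ^ β / 4)))
        ≤ Real.exp (2 * z) * (Real.exp (40 * z) * Real.exp (-((z : ℝ) ^ β / 4))) := by gcongr
      _ = Real.exp (2 * z + (40 * z + -((z : ℝ) ^ β / 4))) := by rw [Real.exp_add, Real.exp_add]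
      _ ≤ 1 := by rw [Real.exp_le_one_iff]; linarith

lemma tendsto_const_mul_half_pow (C : ℝ) :
    Tendsto (fun z : ℕ ↦ C * (1 / 2 : ℝ) ^ z) atTop (𝓝 0) := by
  simpa using (tendsto_pow_atTop_nhds_zero_of_lt_one (r := (1 / 2 : ℝ)) (by norm_num)
    (by norm_num)).const_mul C

lemma tendsto_error (C ε : ℝ) :
    Tendsto (fun z : ℕ ↦ 1 - C * (1 / 2 : ℝ) ^ z -
      (3 / ((10 * z : ℕ) : ℝ) + 11 * (C * (1 / 2 : ℝ) ^ z)) / ε ^ 2) atTop (𝓝 1) := by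
  have hE := tendsto_const_mul_half_pow C
  have hk : Tendsto (fun z : ℕ ↦ 3 / ((10 * z : ℕ) : ℝ)) atTop (𝓝 0) :=
    tendsto_const_nhds.div_atTop (tendsto_natCast_atTop_atTop.comp
      (tendsto_id.const_mul_atTop' (by norm_num)))
  simpa using (hE.const_sub 1).sub ((hk.add (hE.const_mul 11)).div_const (ε ^ 2))

lemma le_of_forall_prime_count_le {lam : ℝ} (hlam : 1 < lam) {K : ℕ} (hK : 13 * lam + 1 ≤ K)
    (hodd : Odd K) : ∃ δ : ℝ, 0 < δ ∧ ∀ ε : ℝ, 0 < ε → ε ≤ 1 / 6 →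
    (∀ᶠ x : ℕ in atTop, (((Finset.Ioc x (x + ⌊Real.log x ^ lam⌋₊)).filter Nat.Prime).card : ℝ) ≤
      (1 + ε) * Real.log x ^ (lam - 1)) →
    (1 - 2 * ε) ^ lam * (1 + δ) ≤ (1 + ε) * (1 + ε) ^ lam := by
  obtain ⟨δ, C, hδ, hδ2, hC, H⟩ := exists_matrix hlam hK
  refine ⟨δ, hδ, fun ε hε hε6 hx ↦ ?_⟩
  have hlam0 : 0 < lam := by linarith
  set β : ℝ := (K - 1 / 2) / lam with hβ
  have hβ13 : 13 ≤ β := by rw [hβ, le_div_iff₀ hlam0]; linarith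
  have h2ε : (0 : ℝ) < 1 - 2 * ε := by linarith
  obtain ⟨X, hX⟩ := eventually_atTop.1 hx
  have hV : Tendsto (fun z : ℕ ↦ (((z : ℝ) ^ β) ^ lam)⁻¹) atTop (𝓝 0) :=
    tendsto_inv_atTop_zero.comp ((tendsto_rpow_atTop hlam0).comp
      ((tendsto_rpow_atTop (by linarith)).comp tendsto_natCast_atTop_atTop))
  have hκ := tendsto_error C ε
  have hE := tendsto_const_mul_half_pow C
  have key : ∀ᶠ z : ℕ in atTop,
      ((1 - 2 * ε) ^ lam - (((z : ℝ) ^ β) ^ lam)⁻¹) * (1 + δ) *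
        (1 - C * (1 / 2 : ℝ) ^ z - (3 / ((10 * z : ℕ) : ℝ) + 11 * (C * (1 / 2 : ℝ) ^ z)) / ε ^ 2) ≤
      (1 + ε) * (1 + ε) ^ lam * (1 + C * (1 / 2 : ℝ) ^ z) + (((z : ℝ) ^ β) ^ lam)⁻¹ := by
    filter_upwards [H ε hε hε6, eventually_side_conditions hβ13 hε hε6 (Real.log (X + 1)),
      hκ.eventually (eventually_ge_nhds (by norm_num : (0 : ℝ) < 1)), eventually_ge_atTop 1] with
      z hz ⟨hs1, hs2, hs3, hs4, hs5⟩ hκ0 hz1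
    set Y : ℝ := (z : ℝ) ^ β
    have hz0 : (0 : ℝ) < z := by exact_mod_cast hz1
    have hY : 0 < Y := by positivity
    have hUle := Nat.floor_le (by positivity : 0 ≤ ((1 - 2 * ε) * Y) ^ lam)
    have hUge := (Nat.sub_one_lt_floor (((1 - 2 * ε) * Y) ^ lam)).le
    set U := ⌊((1 - 2 * ε) * Y) ^ lam⌋₊
    obtain ⟨q, η, hkη, hη, hq, hq4, hUq, hU, hM1, hM2, hδU⟩ := hz U hUge (by
      have : ((1 - 2 * ε) * Y) ^ lam ≤ ((1 + ε) * Y) ^ lam := by gcongr; linarith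
      linarith)
    set E := C * (1 / 2 : ℝ) ^ z with hEdef
    have hE0 : 0 ≤ E := by positivity
    have hq0 : (0 : ℝ) < q := by exact_mod_cast hq
    have hU0 : (0 : ℝ) < U := by exact_mod_cast hU
    have hφ : (0 : ℝ) < q.totient := by exact_mod_cast Nat.totient_pos.2 hq
    have hφq : (q.totient : ℝ) ≤ q := by exact_mod_cast Nat.totient_le q
    have hq4' : (q : ℝ) ≤ 4 ^ z := by exact_mod_cast hq4
    have hmain := columns_le_rows (N := (1 + ε) * ((1 + ε) * Y) ^ (lam - 1)) hq hUq hη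
      (by rw [hkη]; push_cast; exact hs1) (by lia) hε hε6 hE0 hM1 hM2
      (by
        rw [hkη]
        calc 4 * (q : ℝ) ≤ 4 * 4 ^ z := by gcongr
          _ ≤ _ := hs2
          _ ≤ _ := by gcongr; linarith)
      (by rw [hkη]; exact hs3) (by positivity) (by
        rw [hkη]
        intro x hx1 hx2
        have hlog : 0 < Real.log x := lt_of_lt_of_le (by positivity) hx1
        have hx0 : (0 : ℝ) < x := by
          rcases Nat.eq_zero_or_pos x with rfl | h
          · simp at hlog
          · exact_mod_cast h
        have hXx : X ≤ x := by
          have : (X : ℝ) + 1 ≤ x := (Real.log_le_log_iff (by positivity) hx0).1 (hs4.trans hx1)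
          have : (X : ℝ) ≤ x := by linarith
          exact_mod_cast this
        calc (((Finset.Ioc x (x + U)).filter Nat.Prime).card : ℝ)
            ≤ ((Finset.Ioc x (x + ⌊Real.log x ^ lam⌋₊)).filter Nat.Prime).card := by
              norm_cast
              refine Finset.card_le_card (Finset.filter_subset_filter _
                (Finset.Ioc_subset_Ioc_right (Nat.add_le_add_left (Nat.floor_mono ?_) _)))
              gcongr
          _ ≤ (1 + ε) * Real.log x ^ (lam - 1) := hX x hXx
          _ ≤ _ := by
            gcongr)
    rw [hkη] at hmain
    set κ := 1 - E - (3 / ((10 * z : ℕ) : ℝ) + 11 * E) / ε ^ 2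
    have hΦ : U * (1 + δ) ≤ q * (coprimeCount q U * (q.totient : ℝ)⁻¹) := by
      rw [hodd.neg_one_pow] at hδU
      have h1 : (q.totient : ℝ) / q * (1 + δ) ≤ coprimeCount q U / U := by
        have : (q.totient : ℝ) / q ≤ 1 := div_le_one_of_le₀ hφq hq0.le
        nlinarith
      rw [le_div_iff₀ hU0, div_mul_eq_mul_div, div_mul_eq_mul_div, div_le_iff₀ hq0] at h1
      rw [← div_eq_mul_inv, ← mul_div_assoc, le_div_iff₀ hφ]
      linarith
    have hVpos : 0 < Y ^ lam := by positivity
    have hYl : Y * Y ^ (lam - 1) = Y ^ lam := by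
      rw [← Real.rpow_one_add' hY.le (by linarith)]; ring_nf
    have hεl : (1 + ε) * (1 + ε) ^ (lam - 1) = (1 + ε) ^ lam := by
      rw [← Real.rpow_one_add' (by linarith) (by linarith)]; ring_nf
    rw [Real.mul_rpow h2ε.le hY.le] at hUge
    rw [Real.mul_rpow (by linarith : 0 ≤ 1 + ε) hY.le] at hmain
    have hfin : ((1 - 2 * ε) ^ lam * Y ^ lam - 1) * (1 + δ) * κ ≤
        (1 + ε) * (1 + ε) ^ lam * Y ^ lam * (1 + E) + 1 := by
      calc ((1 - 2 * ε) ^ lam * Y ^ lam - 1) * (1 + δ) * κ ≤ U * (1 + δ) * κ := by gcongr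
        _ ≤ q * (coprimeCount q U * (q.totient : ℝ)⁻¹) * κ := by gcongr
        _ = q * (coprimeCount q U * (q.totient : ℝ)⁻¹ * κ) := by ring
        _ ≤ _ := mul_le_mul_of_nonneg_left hmain hq0.le
        _ = (1 + ε) * ((1 + ε) * (1 + ε) ^ (lam - 1)) * (Y * Y ^ (lam - 1)) * (1 + E) +
            q * (4 * (10 * z : ℕ) * Real.exp (-(Y / 4))) := by field_simp
        _ ≤ (1 + ε) * (1 + ε) ^ lam * Y ^ lam * (1 + E) +
            4 ^ z * (4 * (10 * z : ℕ) * Real.exp (-(Y / 4))) := by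
          rw [hYl, hεl]; gcongr
        _ ≤ _ := by push_cast; linarith
    rw [← mul_le_mul_iff_of_pos_right hVpos]
    calc _ = ((1 - 2 * ε) ^ lam * Y ^ lam - 1) * (1 + δ) * κ := by field_simp
      _ ≤ _ := hfin
      _ = _ := by field_simp
  have hlim := le_of_tendsto_of_tendsto
    (((hV.const_sub ((1 - 2 * ε) ^ lam)).mul_const (1 + δ)).mul hκ)
    (((hE.const_add 1).const_mul ((1 + ε) * (1 + ε) ^ lam)).add hV) key
  simpa using hlim

lemma le_of_forall_le_prime_count {lam : ℝ} (hlam : 1 < lam) {K : ℕ} (hK : 13 * lam + 1 ≤ K)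
    (heven : Even K) : ∃ δ : ℝ, 0 < δ ∧ ∀ ε : ℝ, 0 < ε → ε ≤ 1 / 6 →
    (∀ᶠ x : ℕ in atTop, (1 - ε) * Real.log x ^ (lam - 1) ≤
      (((Finset.Ioc x (x + ⌊Real.log x ^ lam⌋₊)).filter Nat.Prime).card : ℝ)) →
    (1 - ε) * (1 - 2 * ε) ^ lam ≤ (1 + ε) ^ lam * (1 - δ) := by
  obtain ⟨δ, C, hδ, hδ2, hC, H⟩ := exists_matrix hlam hK
  refine ⟨δ, hδ, fun ε hε hε6 hx ↦ ?_⟩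
  have hlam0 : 0 < lam := by linarith
  set β : ℝ := (K - 1 / 2) / lam with hβ
  have hβ13 : 13 ≤ β := by rw [hβ, le_div_iff₀ hlam0]; linarith
  have h2ε : (0 : ℝ) < 1 - 2 * ε := by linarith
  obtain ⟨X, hX⟩ := eventually_atTop.1 hx
  have hV : Tendsto (fun z : ℕ ↦ (((z : ℝ) ^ β) ^ lam)⁻¹) atTop (𝓝 0) :=
    tendsto_inv_atTop_zero.comp ((tendsto_rpow_atTop hlam0).comp
      ((tendsto_rpow_atTop (by linarith)).comp tendsto_natCast_atTop_atTop))
  have hκ := tendsto_error C ε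
  have hE := tendsto_const_mul_half_pow C
  have key : ∀ᶠ z : ℕ in atTop, (1 - ε) * (1 - 2 * ε) ^ lam *
        (1 - C * (1 / 2 : ℝ) ^ z - (3 / ((10 * z : ℕ) : ℝ) + 11 * (C * (1 / 2 : ℝ) ^ z)) / ε ^ 2) ≤
      ((1 + ε) ^ lam + (((z : ℝ) ^ β) ^ lam)⁻¹) * (1 - δ) * (1 + C * (1 / 2 : ℝ) ^ z) := by
    filter_upwards [H ε hε hε6, eventually_side_conditions hβ13 hε hε6 (Real.log (X + 1)),
      eventually_ge_atTop 1] with z hz ⟨hs1, hs2, hs3, hs4, _⟩ hz1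
    set Y : ℝ := (z : ℝ) ^ β
    have hz0 : (0 : ℝ) < z := by exact_mod_cast hz1
    have hY : 0 < Y := by positivity
    have hUge := Nat.le_ceil (((1 + ε) * Y) ^ lam)
    have hUle := (Nat.ceil_lt_add_one (by positivity : 0 ≤ ((1 + ε) * Y) ^ lam)).le
    set U := ⌈((1 + ε) * Y) ^ lam⌉₊
    obtain ⟨q, η, hkη, hη, hq, hq4, hUq, hU, hM1, hM2, hδU⟩ := hz U (by
      have : ((1 - 2 * ε) * Y) ^ lam ≤ ((1 + ε) * Y) ^ lam := by gcongr; linarith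
      linarith) hUle
    set E := C * (1 / 2 : ℝ) ^ z with hEdef
    have hE0 : 0 ≤ E := by positivity
    have hq0 : (0 : ℝ) < q := by exact_mod_cast hq
    have hU0 : (0 : ℝ) < U := by exact_mod_cast hU
    have hφ : (0 : ℝ) < q.totient := by exact_mod_cast Nat.totient_pos.2 hq
    have hφq : (q.totient : ℝ) ≤ q := by exact_mod_cast Nat.totient_le q
    have hq4' : (q : ℝ) ≤ 4 ^ z := by exact_mod_cast hq4
    have hε1 : 0 < 1 - ε := by linarith
    have hmain := rows_le_columns (N := (1 - ε) * ((1 - 2 * ε) * Y) ^ (lam - 1)) hq hUq hη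
      (by rw [hkη]; push_cast; exact hs1) (by lia) hε hε6 hE0 hM1 hM2
      (by
        rw [hkη]
        calc 4 * (q : ℝ) ≤ 4 * 4 ^ z := by gcongr
          _ ≤ _ := hs2)
      (by rw [hkη]; exact hs3) (by positivity) (by
        rw [hkη]
        intro x hx1 hx2
        have hlog : 0 < Real.log x := lt_of_lt_of_le (by positivity) hx1
        have hx0 : (0 : ℝ) < x := by
          rcases Nat.eq_zero_or_pos x with rfl | h
          · simp at hlog
          · exact_mod_cast h
        have hXx : X ≤ x := by
          have : (X : ℝ) + 1 ≤ x := (Real.log_le_log_iff (by positivity) hx0).1 (hs4.trans hx1)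
          have : (X : ℝ) ≤ x := by linarith
          exact_mod_cast this
        calc (1 - ε) * ((1 - 2 * ε) * Y) ^ (lam - 1) ≤ (1 - ε) * Real.log x ^ (lam - 1) := by
              gcongr
          _ ≤ ((Finset.Ioc x (x + ⌊Real.log x ^ lam⌋₊)).filter Nat.Prime).card := hX x hXx
          _ ≤ (((Finset.Ioc x (x + U)).filter Nat.Prime).card : ℝ) := by
            norm_cast
            refine Finset.card_le_card (Finset.filter_subset_filter _
              (Finset.Ioc_subset_Ioc_right (Nat.add_le_add_left ?_ _)))
            refine (Nat.floor_le_ceil _).trans (Nat.ceil_mono ?_)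
            gcongr)
    rw [hkη] at hmain
    set κ := 1 - E - (3 / ((10 * z : ℕ) : ℝ) + 11 * E) / ε ^ 2
    have hΦ : q * (coprimeCount q U * (q.totient : ℝ)⁻¹) ≤ U * (1 - δ) := by
      rw [heven.neg_one_pow] at hδU
      have h1 : coprimeCount q U / U ≤ (q.totient : ℝ) / q * (1 - δ) := by
        have : (q.totient : ℝ) / q ≤ 1 := div_le_one_of_le₀ hφq hq0.le
        nlinarith
      rw [div_le_iff₀ hU0, div_mul_eq_mul_div, div_mul_eq_mul_div, le_div_iff₀ hq0] at h1
      rw [← div_eq_mul_inv, ← mul_div_assoc, div_le_iff₀ hφ]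
      linarith
    have hVpos : 0 < Y ^ lam := by positivity
    have hYl : Y * Y ^ (lam - 1) = Y ^ lam := by
      rw [← Real.rpow_one_add' hY.le (by linarith)]; ring_nf
    have hεl : (1 - 2 * ε) * (1 - 2 * ε) ^ (lam - 1) = (1 - 2 * ε) ^ lam := by
      rw [← Real.rpow_one_add' h2ε.le (by linarith)]; ring_nf
    rw [Real.mul_rpow (by linarith : 0 ≤ 1 + ε) hY.le] at hUle
    rw [Real.mul_rpow h2ε.le hY.le] at hmain
    have hfin : (1 - ε) * (1 - 2 * ε) ^ lam * Y ^ lam * κ ≤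
        ((1 + ε) ^ lam * Y ^ lam + 1) * (1 - δ) * (1 + E) := by
      calc (1 - ε) * (1 - 2 * ε) ^ lam * Y ^ lam * κ
          = q * ((1 - 2 * ε) * Y *
              ((1 - ε) * ((1 - 2 * ε) ^ (lam - 1) * Y ^ (lam - 1)) / q * κ)) := by
            rw [← hYl, ← hεl]; field_simp
        _ ≤ _ := mul_le_mul_of_nonneg_left hmain hq0.le
        _ = q * (coprimeCount q U * (q.totient : ℝ)⁻¹) * (1 + E) := by ring
        _ ≤ U * (1 - δ) * (1 + E) := by gcongr
        _ ≤ _ := by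
          have : 0 ≤ 1 - δ := by linarith
          gcongr
    rw [← mul_le_mul_iff_of_pos_right hVpos]
    calc _ = (1 - ε) * (1 - 2 * ε) ^ lam * Y ^ lam * κ := by ring
      _ ≤ _ := hfin
      _ = _ := by field_simp
  have hlim := le_of_tendsto_of_tendsto (hκ.const_mul ((1 - ε) * (1 - 2 * ε) ^ lam))
    (((hV.const_add ((1 + ε) ^ lam)).mul_const (1 - δ)).mul (hE.const_add 1)) key
  simpa using hlim

lemma exists_pos_rpow_lt {lam δ : ℝ} (hδ : 0 < δ) : ∃ ε : ℝ, 0 < ε ∧ ε ≤ 1 / 6 ∧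
    (1 + ε) * (1 + ε) ^ lam < (1 - 2 * ε) ^ lam * (1 + δ) ∧
    (1 + ε) ^ lam * (1 - δ) < (1 - ε) * (1 - 2 * ε) ^ lam := by
  have h1 : ContinuousAt (fun ε : ℝ ↦ (1 + ε) ^ lam) 0 :=
    (by fun_prop : ContinuousAt (fun ε : ℝ ↦ 1 + ε) 0).rpow_const (by norm_num)
  have h2 : ContinuousAt (fun ε : ℝ ↦ (1 - 2 * ε) ^ lam) 0 :=
    (by fun_prop : ContinuousAt (fun ε : ℝ ↦ 1 - 2 * ε) 0).rpow_const (by norm_num)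
  have h3 : ContinuousAt (fun ε : ℝ ↦ 1 + ε) 0 := by fun_prop
  have h4 : ContinuousAt (fun ε : ℝ ↦ 1 - ε) 0 := by fun_prop
  have e1 := (h3.mul h1).eventually_lt (h2.mul_const (1 + δ)) (by simpa using hδ)
  have e2 := (h1.mul_const (1 - δ)).eventually_lt (h4.mul h2) (by simpa using hδ)
  have e3 : ∀ᶠ ε : ℝ in 𝓝 0, ε ≤ 1 / 6 := eventually_le_nhds (by norm_num)
  obtain ⟨ε, ⟨h1, h2, h3⟩, h4⟩ := (((e1.and (e2.and e3)).filter_mono nhdsWithin_le_nhds).and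
    (self_mem_nhdsWithin (s := Ioi (0 : ℝ)))).exists
  exact ⟨ε, h4, h3, h1, h2⟩

lemma eventually_prime_count_eq (lam : ℝ) : ∀ᶠ x : ℕ in atTop, 0 < Real.log x ^ (lam - 1) ∧
    ((primePi ((x : ℝ) + Real.log x ^ lam) : ℝ) - (primePi x : ℝ)) /
        (Real.log x ^ lam / Real.log x) =
      ((Finset.Ioc x (x + ⌊Real.log x ^ lam⌋₊)).filter Nat.Prime).card /
        Real.log x ^ (lam - 1) := by
  filter_upwards [eventually_ge_atTop 2] with x hx
  have hlog : 0 < Real.log x := Real.log_pos (by exact_mod_cast hx)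
  rw [primePi_add_sub x (by positivity), Real.rpow_sub_one hlog.ne']
  exact ⟨by positivity, rfl⟩

end Maier

/-- **Maier's theorem**: for fixed `λ > 1` and `H = (log X)^λ`,
`limsup_{X→∞} (π(X+H) − π(X)) / (H / log X) > 1` and
`liminf_{X→∞} (π(X+H) − π(X)) / (H / log X) < 1`. -/
theorem maier_short_intervals (lam : ℝ) (hlam : 1 < lam) :
    (1 : EReal) < Filter.limsup
      (fun X : ℝ => ((((primePi (X + Real.log X ^ lam) : ℝ) - (primePi X : ℝ))
        / (Real.log X ^ lam / Real.log X) : ℝ) : EReal)) Filter.atTop ∧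
    Filter.liminf
      (fun X : ℝ => ((((primePi (X + Real.log X ^ lam) : ℝ) - (primePi X : ℝ))
        / (Real.log X ^ lam / Real.log X) : ℝ) : EReal)) Filter.atTop < (1 : EReal) := by
  obtain ⟨n, hn⟩ := exists_nat_ge (13 * lam + 1)
  have hn0 : (0 : ℝ) ≤ n := n.cast_nonneg
  constructor
  · obtain ⟨δ, hδ, H⟩ := Maier.le_of_forall_prime_count_le hlam (K := 2 * n + 1)
      (by push_cast; linarith) (odd_two_mul_add_one n)
    obtain ⟨ε, hε, hε6, h1, -⟩ := Maier.exists_pos_rpow_lt (lam := lam) hδ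
    by_contra! hcon
    refine h1.not_ge (H ε hε hε6 ?_)
    have hlt := eventually_lt_of_limsup_lt
      (hcon.trans_lt (b := ((1 : ℝ) : EReal)) (c := ((1 + ε : ℝ) : EReal))
        (EReal.coe_lt_coe_iff.2 (by linarith)))
    filter_upwards [tendsto_natCast_atTop_atTop.eventually hlt,
      Maier.eventually_prime_count_eq lam] with
      x hx ⟨h0, heq⟩
    rw [heq, EReal.coe_lt_coe_iff, div_lt_iff₀ h0] at hx
    exact hx.le
  · obtain ⟨δ, hδ, H⟩ := Maier.le_of_forall_le_prime_count hlam (K := 2 * n)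
      (by push_cast; linarith) (even_two_mul n)
    obtain ⟨ε, hε, hε6, -, h1⟩ := Maier.exists_pos_rpow_lt (lam := lam) hδ
    by_contra! hcon
    refine h1.not_ge (H ε hε hε6 ?_)
    have hlt := eventually_lt_of_lt_liminf
      (lt_of_lt_of_le (a := ((1 - ε : ℝ) : EReal)) (b := ((1 : ℝ) : EReal))
        (EReal.coe_lt_coe_iff.2 (by linarith)) hcon)
    filter_upwards [tendsto_natCast_atTop_atTop.eventually hlt,
      Maier.eventually_prime_count_eq lam] with
      x hx ⟨h0, heq⟩
    rw [heq, EReal.coe_lt_coe_iff, lt_div_iff₀ h0] at hx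
    exact hx.le
end

section
/- Let ω : [1,∞) → ℝ be the Buchstab function and γ the Euler–Mascheroni constant. For every real u₀ ≥ 1 there exist u⁺, u⁻ ≥ u₀ such that e^γ·ω(u⁺) > 1 and e^γ·ω(u⁻) < 1. -/
open Filter

open Set MeasureTheory Topology

/-- The continuous extension of `t ↦ (1 - e⁻ᵗ) / t`. -/
noncomputable def einIntegrand : ℝ → ℝ := dslope (fun t => -Real.exp (-t)) 0

lemma einIntegrand_of_ne {t : ℝ} (ht : t ≠ 0) : einIntegrand t = (1 - Real.exp (-t)) / t := by
  rw [einIntegrand, dslope_of_ne _ ht, slope_def_field]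
  simp only [neg_zero, Real.exp_zero, sub_zero]
  ring

lemma continuous_einIntegrand : Continuous einIntegrand := by
  rw [← continuousOn_univ]
  exact (continuousOn_dslope univ_mem).2 ⟨by fun_prop, by fun_prop⟩

lemma mul_einIntegrand (t : ℝ) : t * einIntegrand t = 1 - Real.exp (-t) := by
  rcases eq_or_ne t 0 with rfl | ht
  · simp
  · rw [einIntegrand_of_ne ht]; field_simp

lemma einIntegrand_mem_Icc {t : ℝ} (ht : 0 ≤ t) : einIntegrand t ∈ Icc (0 : ℝ) 1 := by
  rcases ht.eq_or_lt with rfl | ht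
  · have h : HasDerivAt (fun t : ℝ => -Real.exp (-t)) 1 0 :=
      (hasDerivAt_neg (0 : ℝ)).exp.fun_neg.congr_deriv (by simp)
    simp [einIntegrand, dslope_same, h.deriv]
  · rw [einIntegrand_of_ne ht.ne']
    have h1 := Real.add_one_le_exp (-t)
    have h2 := Real.exp_le_one_iff.2 (neg_nonpos.2 ht.le)
    exact ⟨div_nonneg (by linarith) ht.le, (div_le_one ht).2 (by linarith)⟩

/-- The entire exponential integral `Ein`. -/
noncomputable def ein (x : ℝ) : ℝ := ∫ t in (0 : ℝ)..x, einIntegrand t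

lemma hasDerivAt_ein (x : ℝ) : HasDerivAt ein (einIntegrand x) x :=
  continuous_einIntegrand.integral_hasStrictDerivAt 0 x |>.hasDerivAt

lemma ein_nonneg {x : ℝ} (hx : 0 ≤ x) : 0 ≤ ein x :=
  intervalIntegral.integral_nonneg hx fun _ ht => (einIntegrand_mem_Icc ht.1).1

lemma ein_le {x : ℝ} (hx : 0 ≤ x) : ein x ≤ x := by
  have := intervalIntegral.integral_mono_on hx (continuous_einIntegrand.intervalIntegrable 0 x)
    (intervalIntegrable_const (μ := volume) (c := (1 : ℝ))) fun t ht => (einIntegrand_mem_Icc ht.1).2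
  simpa [ein] using this

lemma integral_log_mul_exp_neg :
    ∫ t in Ioi (0 : ℝ), Real.log t * Real.exp (-t) = -Real.eulerMascheroniConstant := by
  have h := Complex.hasDerivAt_GammaIntegral (s := 1) (by simp)
  have h' : HasDerivAt Complex.GammaIntegral (-(Real.eulerMascheroniConstant : ℂ)) 1 := by
    refine Complex.hasDerivAt_Gamma_one.congr_of_eventuallyEq ?_
    have : {s : ℂ | 0 < s.re} ∈ 𝓝 (1 : ℂ) :=
      (isOpen_lt continuous_const Complex.continuous_re).mem_nhds (by simp)
    filter_upwards [this] with s hs using (Complex.Gamma_eq_integral hs).symm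
  have := h.unique h'
  simp only [sub_self, Complex.cpow_zero, one_mul] at this
  exact_mod_cast this

lemma integrableOn_log_mul_exp_neg :
    IntegrableOn (fun t : ℝ => Real.log t * Real.exp (-t)) (Ioi 0) := by
  by_contra h
  have := integral_undef h
  rw [integral_log_mul_exp_neg] at this
  linarith [Real.one_half_lt_eulerMascheroniConstant]

lemma continuous_one_sub_exp_neg_mul_log :
    Continuous fun t : ℝ => (1 - Real.exp (-t)) * Real.log t := by
  have : (fun t : ℝ => (1 - Real.exp (-t)) * Real.log t) =
      fun t => einIntegrand t * (t * Real.log t) := by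
    ext t; rw [← mul_einIntegrand]; ring
  rw [this]
  exact continuous_einIntegrand.mul Real.continuous_mul_log

lemma ein_eq {x : ℝ} (hx : 0 < x) :
    ein x = (1 - Real.exp (-x)) * Real.log x - ∫ t in (0 : ℝ)..x, Real.log t * Real.exp (-t) := by
  have hint : IntervalIntegrable (fun t : ℝ => Real.log t * Real.exp (-t)) volume 0 x := by
    rw [intervalIntegrable_iff_integrableOn_Ioc_of_le hx.le]
    exact integrableOn_log_mul_exp_neg.mono_set Ioc_subset_Ioi_self
  have h := intervalIntegral.integral_eq_sub_of_hasDerivAt_of_le hx.le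
    (f := fun t : ℝ => (1 - Real.exp (-t)) * Real.log t)
    (f' := fun t => Real.log t * Real.exp (-t) + einIntegrand t)
    continuous_one_sub_exp_neg_mul_log.continuousOn (fun t ht => by
      have h1 : HasDerivAt (fun t : ℝ => 1 - Real.exp (-t)) (Real.exp (-t)) t := by
        simpa using ((hasDerivAt_neg t).exp).const_sub 1
      refine (h1.mul (Real.hasDerivAt_log ht.1.ne')).congr_deriv ?_
      rw [einIntegrand_of_ne ht.1.ne']
      ring)
    (hint.add (continuous_einIntegrand.intervalIntegrable 0 x))
  rw [intervalIntegral.integral_add hint (continuous_einIntegrand.intervalIntegrable 0 x)] at h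
  simp only [neg_zero, Real.exp_zero, sub_self, zero_mul, sub_zero] at h
  rw [ein, ← h]
  ring

lemma tendsto_ein_sub_log :
    Tendsto (fun x => ein x - Real.log x) atTop (𝓝 Real.eulerMascheroniConstant) := by
  have h1 := intervalIntegral_tendsto_integral_Ioi 0 integrableOn_log_mul_exp_neg tendsto_id
  rw [integral_log_mul_exp_neg] at h1
  have h2 : Tendsto (fun x : ℝ => Real.exp (-x) * Real.log x) atTop (𝓝 0) := by
    have h3 : Tendsto (fun x : ℝ => x * Real.exp (-x)) atTop (𝓝 0) := by
      simpa using Real.tendsto_pow_mul_exp_neg_atTop_nhds_zero 1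
    refine tendsto_of_tendsto_of_tendsto_of_le_of_le' tendsto_const_nhds h3 ?_ ?_
    · filter_upwards [eventually_ge_atTop 1] with x hx
      exact mul_nonneg (Real.exp_pos _).le (Real.log_nonneg hx)
    · filter_upwards [eventually_ge_atTop 1] with x hx
      rw [mul_comm]
      exact mul_le_mul_of_nonneg_right (Real.log_le_self (by linarith)) (Real.exp_pos _).le
  have h3 := (h2.add h1).neg
  rw [zero_add, neg_neg] at h3
  refine h3.congr' ?_
  filter_upwards [eventually_gt_atTop 0] with x hx
  rw [ein_eq hx]
  simp only [id]
  ring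

lemma tendsto_mul_exp_neg_ein :
    Tendsto (fun x => x * Real.exp (-ein x)) atTop
      (𝓝 (Real.exp (-Real.eulerMascheroniConstant))) := by
  refine (Real.continuous_exp.continuousAt.tendsto.comp tendsto_ein_sub_log.neg).congr' ?_
  filter_upwards [eventually_gt_atTop 0] with x hx
  simp only [Function.comp, neg_sub]
  rw [sub_eq_add_neg, Real.exp_add, Real.exp_log hx]

lemma hasDerivAt_exp_mul_exp_neg_ein (u x : ℝ) :
    HasDerivAt (fun x => Real.exp (-(u * x)) * (x * Real.exp (-ein x)))
      (Real.exp (-((u + 1) * x)) * Real.exp (-ein x)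
        - u * (x * (Real.exp (-(u * x)) * Real.exp (-ein x)))) x := by
  have h1 : HasDerivAt (fun x : ℝ => Real.exp (-(u * x))) (Real.exp (-(u * x)) * (-(u * 1))) x :=
    (((hasDerivAt_id x).const_mul u).neg).exp
  have h2 := (hasDerivAt_id' x).fun_mul (hasDerivAt_ein x).fun_neg.exp
  refine (h1.mul h2).congr_deriv ?_
  have h3 := mul_einIntegrand x
  have h4 : Real.exp (-((u + 1) * x)) = Real.exp (-(u * x)) * Real.exp (-x) := by
    rw [← Real.exp_add]; ring_nf
  rw [h4, eq_sub_of_add_eq' (show x * einIntegrand x + Real.exp (-x) = 1 by linarith)]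
  ring

/-- The decreasing positive solution of `u * da/du = -a (u + 1)`, the equation adjoint to that of the
Buchstab function. -/
noncomputable def buchstabAdjoint (u : ℝ) : ℝ :=
  ∫ x in Ioi (0 : ℝ), Real.exp (-(u * x)) * Real.exp (-ein x)

lemma continuous_ein : Continuous ein :=
  continuous_iff_continuousAt.2 fun x => (hasDerivAt_ein x).continuousAt

lemma integrableOn_mul_exp_neg {u : ℝ} (hu : 0 < u) :
    IntegrableOn (fun x : ℝ => x * Real.exp (-(u * x))) (Ioi 0) := by
  simpa using integrableOn_rpow_mul_exp_neg_mul_rpow (s := 1) (p := 1) (b := u) (by norm_num)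
    one_pos hu

lemma integrableOn_exp_neg_mul {u : ℝ} (hu : 0 < u) :
    IntegrableOn (fun x : ℝ => Real.exp (-(u * x))) (Ioi 0) := by
  simpa using integrableOn_exp_mul_Ioi (neg_lt_zero.2 hu) 0

lemma exp_neg_ein_le_one {x : ℝ} (hx : 0 ≤ x) : Real.exp (-ein x) ≤ 1 :=
  Real.exp_le_one_iff.2 (neg_nonpos.2 (ein_nonneg hx))

lemma integrableOn_buchstabAdjoint {u : ℝ} (hu : 0 < u) :
    IntegrableOn (fun x : ℝ => Real.exp (-(u * x)) * Real.exp (-ein x)) (Ioi 0) := by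
  have := continuous_ein
  refine (integrableOn_exp_neg_mul hu).mono' (by fun_prop) ?_
  filter_upwards [ae_restrict_mem measurableSet_Ioi] with x hx
  rw [Real.norm_of_nonneg (by positivity)]
  exact mul_le_of_le_one_right (Real.exp_pos _).le (exp_neg_ein_le_one (le_of_lt hx))

lemma hasDerivAt_buchstabAdjoint {u : ℝ} (hu : 0 < u) :
    HasDerivAt buchstabAdjoint (-buchstabAdjoint (u + 1) / u) u := by
  have hc := continuous_ein
  have h := hasDerivAt_integral_of_dominated_loc_of_deriv_le (μ := volume.restrict (Ioi (0 : ℝ)))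
    (F := fun u x : ℝ => Real.exp (-(u * x)) * Real.exp (-ein x))
    (F' := fun u x : ℝ => -(x * (Real.exp (-(u * x)) * Real.exp (-ein x))))
    (bound := fun x => x * Real.exp (-(u / 2 * x))) (x₀ := u) (s := Ioi (u / 2))
    (Ioi_mem_nhds (by linarith)) (.of_forall fun v => by fun_prop)
    (integrableOn_buchstabAdjoint hu) (by fun_prop) ?_ (integrableOn_mul_exp_neg (half_pos hu)) ?_
  · refine h.2.congr_deriv ?_
    have hi := h.1.neg
    simp only [Pi.neg_def, neg_neg] at hi
    have hlim : Tendsto (fun x => Real.exp (-(u * x)) * (x * Real.exp (-ein x))) atTop (𝓝 0) := by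
      have h1 : Tendsto (fun x : ℝ => Real.exp (-(u * x))) atTop (𝓝 0) :=
        Real.tendsto_exp_neg_atTop_nhds_zero.comp (tendsto_id.const_mul_atTop hu)
      simpa using h1.mul tendsto_mul_exp_neg_ein
    have h2 := integral_Ioi_of_hasDerivAt_of_tendsto' (a := 0)
      (fun x _ => hasDerivAt_exp_mul_exp_neg_ein u x)
      ((integrableOn_buchstabAdjoint (by linarith : 0 < u + 1)).sub (hi.const_mul u)) hlim
    rw [integral_sub (integrableOn_buchstabAdjoint (by linarith : 0 < u + 1)) (hi.const_mul u),
      integral_const_mul] at h2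
    simp only [mul_zero, zero_mul, sub_zero] at h2
    rw [integral_neg, buchstabAdjoint, sub_eq_zero.1 h2, neg_div, mul_div_cancel_left₀ _ hu.ne']
  · filter_upwards [ae_restrict_mem measurableSet_Ioi] with x hx v hv
    have hx : 0 < x := hx
    have hv : u / 2 < v := hv
    rw [norm_neg, Real.norm_of_nonneg (by positivity)]
    gcongr
    refine (mul_le_of_le_one_right (Real.exp_pos _).le (exp_neg_ein_le_one hx.le)).trans ?_
    gcongr
  · refine .of_forall fun x v _ => ?_
    have h1 : HasDerivAt (fun v : ℝ => Real.exp (-(v * x))) (Real.exp (-(v * x)) * (-(1 * x))) v :=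
      (((hasDerivAt_id v).mul_const x).neg).exp
    exact (h1.mul_const _).congr_deriv (by ring)

lemma buchstabAdjoint_one :
    buchstabAdjoint 1 = Real.exp (-Real.eulerMascheroniConstant) := by
  have h := integral_Ioi_of_hasDerivAt_of_tendsto' (a := 0)
      (fun x _ => hasDerivAt_exp_mul_exp_neg_ein 0 x)
      (by simpa using integrableOn_buchstabAdjoint one_pos)
      (by simpa using tendsto_mul_exp_neg_ein)
  simpa [buchstabAdjoint] using h

lemma buchstabAdjoint_le {u : ℝ} (hu : 0 < u) : buchstabAdjoint u ≤ 1 / u := by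
  have h := setIntegral_mono_on (integrableOn_buchstabAdjoint hu) (integrableOn_exp_neg_mul hu)
    measurableSet_Ioi fun x hx =>
      mul_le_of_le_one_right (Real.exp_pos _).le (exp_neg_ein_le_one (le_of_lt hx))
  have h2 := integral_exp_mul_Ioi (neg_lt_zero.2 hu) 0
  simp only [neg_mul, mul_zero, Real.exp_zero, neg_div_neg_eq] at h2
  rwa [h2] at h

lemma le_buchstabAdjoint {u : ℝ} (hu : 0 < u) : 1 / (u + 1) ≤ buchstabAdjoint u := by
  have h := setIntegral_mono_on (integrableOn_exp_neg_mul (by linarith : 0 < u + 1))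
    (integrableOn_buchstabAdjoint hu) measurableSet_Ioi fun x hx => by
      have := ein_le (le_of_lt hx)
      rw [← Real.exp_add]
      gcongr
      linarith
  have h2 := integral_exp_mul_Ioi (neg_lt_zero.2 (by linarith : 0 < u + 1)) 0
  simp only [neg_mul, mul_zero, Real.exp_zero, neg_div_neg_eq] at h2
  rwa [h2] at h

lemma buchstabAdjoint_pos {u : ℝ} (hu : 0 < u) : 0 < buchstabAdjoint u :=
  lt_of_lt_of_le (by positivity) (le_buchstabAdjoint hu)

lemma tendsto_mul_buchstabAdjoint :
    Tendsto (fun u => u * buchstabAdjoint u) atTop (𝓝 1) := by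
  have h1 : Tendsto (fun u : ℝ => 1 - 1 / (u + 1)) atTop (𝓝 1) := by
    have : Tendsto (fun u : ℝ => 1 / (u + 1)) atTop (𝓝 0) := by
      simp only [one_div]
      exact (tendsto_atTop_add_const_right atTop (1 : ℝ) tendsto_id).inv_tendsto_atTop
    simpa using this.const_sub 1
  refine tendsto_of_tendsto_of_tendsto_of_le_of_le' h1 tendsto_const_nhds ?_ ?_
  · filter_upwards [eventually_gt_atTop 0] with u hu
    have := mul_le_mul_of_nonneg_left (le_buchstabAdjoint hu) hu.le
    convert this using 1
    field_simp
    ring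
  · filter_upwards [eventually_gt_atTop 0] with u hu
    have := mul_le_mul_of_nonneg_left (buchstabAdjoint_le hu) hu.le
    rwa [mul_one_div_cancel hu.ne'] at this

/-- The bilinear pairing of a solution `W` of the Buchstab equation with the adjoint solution. -/
noncomputable def buchstabPairing (W : ℝ → ℝ) (u : ℝ) : ℝ :=
  u * W u * buchstabAdjoint u + ∫ t in (u - 1)..u, W t * buchstabAdjoint (t + 1)

lemma continuousOn_buchstabAdjoint_add_one :
    ContinuousOn (fun t => buchstabAdjoint (t + 1)) (Ioi (-1)) := fun t ht =>
  ((hasDerivAt_buchstabAdjoint (neg_lt_iff_pos_add.1 ht)).continuousAt.comp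
    (f := fun t => t + 1) (by fun_prop)).continuousWithinAt

lemma intervalIntegrable_mul_buchstabAdjoint {W : ℝ → ℝ} (hW : Continuous W) {x y : ℝ}
    (hx : 0 ≤ x) (hy : 0 ≤ y) :
    IntervalIntegrable (fun t => W t * buchstabAdjoint (t + 1)) volume x y := by
  refine (hW.continuousOn.mul (continuousOn_buchstabAdjoint_add_one.mono ?_)).intervalIntegrable
  intro t ht
  have : 0 ≤ t := (le_min hx hy).trans ht.1
  exact lt_of_lt_of_le (by norm_num) this

lemma hasDerivAt_integral_mul_buchstabAdjoint {W : ℝ → ℝ} (hW : Continuous W) {x : ℝ}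
    (hx : 0 < x) :
    HasDerivAt (fun u => ∫ t in (1 : ℝ)..u, W t * buchstabAdjoint (t + 1))
      (W x * buchstabAdjoint (x + 1)) x := by
  have hc : ContinuousOn (fun t => W t * buchstabAdjoint (t + 1)) (Ioi (-1)) :=
    hW.continuousOn.mul continuousOn_buchstabAdjoint_add_one
  exact intervalIntegral.integral_hasDerivAt_right
    (intervalIntegrable_mul_buchstabAdjoint hW zero_le_one hx.le)
    (hc.stronglyMeasurableAtFilter isOpen_Ioi x (by simp; linarith))
    (hc.continuousAt (Ioi_mem_nhds (by linarith)))

lemma buchstabPairing_eq {W : ℝ → ℝ} (hW : Continuous W) {u : ℝ} (hu : 1 < u) :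
    buchstabPairing W u = u * W u * buchstabAdjoint u +
      ((∫ t in (1 : ℝ)..u, W t * buchstabAdjoint (t + 1)) -
        ∫ t in (1 : ℝ)..(u - 1), W t * buchstabAdjoint (t + 1)) := by
  rw [buchstabPairing, intervalIntegral.integral_interval_sub_left
    (intervalIntegrable_mul_buchstabAdjoint hW zero_le_one (by linarith))
    (intervalIntegrable_mul_buchstabAdjoint hW zero_le_one (by linarith))]

lemma buchstabPairing_eq_two {W : ℝ → ℝ} (hW : Continuous W)
    (hd : ∀ u, 2 < u → HasDerivAt (fun u => u * W u) (W (u - 1)) u) {u : ℝ} (hu : 2 ≤ u) :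
    buchstabPairing W u = buchstabPairing W 2 := by
  let P : ℝ → ℝ := fun u => u * W u * buchstabAdjoint u +
      ((∫ t in (1 : ℝ)..u, W t * buchstabAdjoint (t + 1)) -
        ∫ t in (1 : ℝ)..(u - 1), W t * buchstabAdjoint (t + 1))
  have hI : ∀ v, 1 < v → HasDerivAt (fun u =>
      (∫ t in (1 : ℝ)..u, W t * buchstabAdjoint (t + 1)) -
        ∫ t in (1 : ℝ)..(u - 1), W t * buchstabAdjoint (t + 1))
      (W v * buchstabAdjoint (v + 1) - W (v - 1) * buchstabAdjoint v) v := fun v hv => by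
    have h := (hasDerivAt_integral_mul_buchstabAdjoint hW (by linarith : 0 < v - 1)).comp_sub_const
    rw [sub_add_cancel] at h
    exact (hasDerivAt_integral_mul_buchstabAdjoint hW (by linarith)).fun_sub h
  have hP : ∀ v, 2 < v → HasDerivAt P 0 v := fun v hv => by
    refine (((hd v hv).fun_mul (hasDerivAt_buchstabAdjoint (by linarith : 0 < v))).fun_add
      (hI v (by linarith))).congr_deriv ?_
    field_simp
    ring
  have hc : ContinuousOn P (Ici 2) := fun v hv => by
    have hv : 2 ≤ v := hv
    exact ((continuous_id.mul hW).continuousAt.mul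
      (hasDerivAt_buchstabAdjoint (by linarith : 0 < v)).continuousAt |>.add
      (hI v (by linarith)).continuousAt).continuousWithinAt
  have : P u = P 2 := by
    rcases hu.eq_or_lt with rfl | hu
    · rfl
    · obtain ⟨v, -, hv⟩ := exists_hasDerivAt_eq_slope P (fun _ => 0) hu
        (hc.mono Icc_subset_Ici_self) fun v hv => hP v hv.1
      rw [eq_div_iff (by linarith), zero_mul] at hv
      linarith
  rw [buchstabPairing_eq hW (by linarith), buchstabPairing_eq hW one_lt_two]
  exact this

lemma buchstabPairing_one : buchstabPairing (fun _ => 1) 2 = 1 := by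
  have h : Tendsto (buchstabPairing fun _ => 1) atTop (𝓝 (1 + 0)) := by
    refine .add (by simpa using tendsto_mul_buchstabAdjoint) ?_
    refine squeeze_zero' (g := fun u : ℝ => u⁻¹) ?_ ?_ tendsto_inv_atTop_zero
    · filter_upwards [eventually_ge_atTop 1] with u hu
      refine intervalIntegral.integral_nonneg (by linarith) fun t ht => ?_
      have := (buchstabAdjoint_pos (by linarith [ht.1] : 0 < t + 1)).le
      simpa using this
    · filter_upwards [eventually_ge_atTop 1] with u hu
      have := intervalIntegral.integral_mono_on (a := u - 1) (b := u) (by linarith)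
        (intervalIntegrable_mul_buchstabAdjoint (W := fun _ => 1) continuous_const
          (by linarith) (by linarith))
        (intervalIntegrable_const (μ := volume) (c := u⁻¹)) fun t ht => by
          rw [one_mul]
          refine (buchstabAdjoint_le (by linarith [ht.1])).trans ?_
          rw [one_div]
          exact inv_anti₀ (by linarith) (by linarith [ht.1])
      simpa using this
  rw [add_zero] at h
  refine tendsto_nhds_unique (tendsto_const_nhds.congr' ?_) h
  filter_upwards [eventually_ge_atTop 2] with u hu
  refine (buchstabPairing_eq_two continuous_const (fun v _ => ?_) hu).symm
  simpa using hasDerivAt_id' v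

lemma buchstabPairing_inv {W : ℝ → ℝ} (hW : ∀ u ∈ Icc (1 : ℝ) 2, W u = 1 / u) :
    buchstabPairing W 2 = Real.exp (-Real.eulerMascheroniConstant) := by
  have hpos : ∀ t ∈ uIcc (1 : ℝ) 2, 0 < t := fun t ht => by
    rw [uIcc_of_le one_le_two] at ht
    linarith [ht.1]
  have hcong : ∀ t ∈ uIcc (1 : ℝ) 2,
      W t * buchstabAdjoint (t + 1) = -(-buchstabAdjoint (t + 1) / t) := fun t ht => by
    rw [hW t (by rwa [uIcc_of_le one_le_two] at ht)]
    ring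
  rw [buchstabPairing, show (2 : ℝ) - 1 = 1 by norm_num, intervalIntegral.integral_congr hcong,
    intervalIntegral.integral_neg, intervalIntegral.integral_eq_sub_of_hasDerivAt
      (fun t ht => hasDerivAt_buchstabAdjoint (hpos t ht)), buchstabAdjoint_one,
    hW 2 (right_mem_Icc.2 one_le_two)]
  · ring
  · refine ContinuousOn.intervalIntegrable ?_
    refine ((continuousOn_buchstabAdjoint_add_one.mono fun t ht => ?_).neg).div continuousOn_id
      fun t ht => (hpos t ht).ne'
    exact lt_trans (by norm_num) (hpos t ht)

lemma buchstabPairing_sub {V W : ℝ → ℝ} (hV : Continuous V) (hW : Continuous W) {u : ℝ}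
    (hu : 1 ≤ u) :
    buchstabPairing (fun t => V t - W t) u = buchstabPairing V u - buchstabPairing W u := by
  simp only [buchstabPairing, sub_mul, mul_sub]
  rw [intervalIntegral.integral_sub
    (intervalIntegrable_mul_buchstabAdjoint hV (by linarith) (by linarith))
    (intervalIntegrable_mul_buchstabAdjoint hW (by linarith) (by linarith))]
  ring

lemma buchstabPairing_const_mul (c : ℝ) (W : ℝ → ℝ) (u : ℝ) :
    buchstabPairing (fun t => c * W t) u = c * buchstabPairing W u := by
  simp only [buchstabPairing, mul_assoc, intervalIntegral.integral_const_mul]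
  ring

lemma eq_zero_of_buchstabPairing_eq_zero {D : ℝ → ℝ} {u : ℝ} (hu : 1 ≤ u)
    (h0 : buchstabPairing D u = 0) (hD : ∀ t, u - 1 ≤ t → 0 ≤ D t) : D u = 0 := by
  have h1 : 0 ≤ ∫ t in (u - 1)..u, D t * buchstabAdjoint (t + 1) :=
    intervalIntegral.integral_nonneg (by linarith) fun t ht =>
      mul_nonneg (hD t ht.1) (buchstabAdjoint_pos (by linarith [ht.1])).le
  have h2 := hD u (by linarith)
  have h3 := buchstabAdjoint_pos (by linarith : 0 < u)
  have h4 : u * D u * buchstabAdjoint u = 0 :=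
    le_antisymm (by rw [buchstabPairing] at h0; linarith) (by positivity)
  simpa [h3.ne', (by linarith : u ≠ 0)] using h4

/-- A solution of the Buchstab equation that vanishes eventually vanishes on `(1, ∞)`. -/
lemma eq_zero_of_eventually_eq_zero {D : ℝ → ℝ}
    (hd : ∀ u, 2 < u → HasDerivAt (fun u => u * D u) (D (u - 1)) u) (n : ℕ)
    (hn : ∀ t, (n : ℝ) + 1 < t → D t = 0) : ∀ t, 1 < t → D t = 0 := by
  induction n with
  | zero => simpa using hn
  | succ n ih =>
    refine ih fun t ht => ?_
    push_cast at hn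
    have hn0 : (0 : ℝ) ≤ n := n.cast_nonneg
    have h := hd (t + 1) (by linarith)
    rw [add_sub_cancel_right] at h
    refine h.unique ((hasDerivAt_const (t + 1) (0 : ℝ)).congr_of_eventuallyEq ?_)
    filter_upwards [Ioi_mem_nhds (by linarith : (n : ℝ) + 1 + 1 < t + 1)] with v hv
    rw [hn v hv, mul_zero]

/-- A solution of the Buchstab equation orthogonal to the adjoint solution that is eventually
nonnegative vanishes on `(1, ∞)`. -/
lemma eq_zero_of_eventually_nonneg {D : ℝ → ℝ} (hc : Continuous D)
    (hd : ∀ u, 2 < u → HasDerivAt (fun u => u * D u) (D (u - 1)) u)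
    (h0 : buchstabPairing D 2 = 0) {u₀ : ℝ} (hD : ∀ t, u₀ ≤ t → 0 ≤ D t) :
    ∀ t, 1 < t → D t = 0 := by
  obtain ⟨n, hn⟩ := exists_nat_ge (max u₀ 1)
  have hn0 := (le_max_left _ _).trans hn
  have hn1 := (le_max_right _ _).trans hn
  refine eq_zero_of_eventually_eq_zero hd n fun t ht => ?_
  refine eq_zero_of_buchstabPairing_eq_zero (by linarith) ?_ fun s hs => hD s (by linarith)
  rw [buchstabPairing_eq_two hc hd (by linarith), h0]

/-- The differential form of the Buchstab equation, for the constant extension to `(-∞, 1)`. -/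
lemma hasDerivAt_mul_buchstab {ω : ℝ → ℝ} (hcont : ContinuousOn ω (Ici 1))
    (hrec : ∀ u : ℝ, 2 ≤ u → u * ω u = 2 * ω 2 + ∫ v in (2 : ℝ)..u, ω (v - 1)) {u : ℝ}
    (hu : 2 < u) : HasDerivAt (fun u => u * ω (max 1 u)) (ω (max 1 (u - 1))) u := by
  have hW : Continuous fun v => ω (max 1 (v - 1)) :=
    hcont.comp_continuous (by fun_prop) fun v => mem_Ici.2 (le_max_left _ _)
  refine ((hW.integral_hasStrictDerivAt 2 u).hasDerivAt.const_add
    (2 * ω 2)).congr_of_eventuallyEq ?_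
  filter_upwards [Ioi_mem_nhds hu] with v hv
  have hv : 2 < v := hv
  rw [max_eq_right (by linarith), hrec v hv.le]
  congr 1
  refine intervalIntegral.integral_congr fun t ht => ?_
  rw [uIcc_of_le hv.le] at ht
  simp only [max_eq_right (by linarith [ht.1] : 1 ≤ t - 1)]

/-- **Oscillation of the Buchstab function around `e^{−γ}`**: if `ω` is the Buchstab function
(the unique continuous function on `[1,∞)` with `ω(u) = 1/u` on `[1,2]` and
`u·ω(u) = 2·ω(2) + ∫_2^u ω(v−1) dv` for `u ≥ 2`), then for every `u₀ ≥ 1` there are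
`u⁺, u⁻ ≥ u₀` with `e^γ·ω(u⁺) > 1` and `e^γ·ω(u⁻) < 1`. -/
theorem buchstab_oscillation (ω : ℝ → ℝ)
    (hcont : ContinuousOn ω (Set.Ici 1))
    (hinit : ∀ u ∈ Set.Icc (1 : ℝ) 2, ω u = 1 / u)
    (hrec : ∀ u : ℝ, 2 ≤ u → u * ω u = 2 * ω 2 + ∫ v in (2 : ℝ)..u, ω (v - 1)) :
    ∀ u₀ : ℝ, 1 ≤ u₀ →
      (∃ up : ℝ, u₀ ≤ up ∧ 1 < Real.exp Real.eulerMascheroniConstant * ω up) ∧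
      (∃ um : ℝ, u₀ ≤ um ∧ Real.exp Real.eulerMascheroniConstant * ω um < 1) := by
  intro u₀ hu₀
  set c := Real.exp (-Real.eulerMascheroniConstant) with hc
  have hec : Real.exp Real.eulerMascheroniConstant * c = 1 := by
    rw [hc, ← Real.exp_add, add_neg_cancel, Real.exp_zero]
  set W : ℝ → ℝ := fun u => ω (max 1 u) with hWdef
  have hW : Continuous W := hcont.comp_continuous (by fun_prop) fun v => mem_Ici.2 (le_max_left _ _)
  have hWω : ∀ u, 1 ≤ u → W u = ω u := fun u hu => by simp only [hWdef, max_eq_right hu]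
  have hWinit : ∀ u ∈ Icc (1 : ℝ) 2, W u = 1 / u := fun u hu => by
    rw [hWω u hu.1, hinit u hu]
  have hWd : ∀ u, 2 < u → HasDerivAt (fun u => u * W u) (W (u - 1)) u := fun u hu =>
    hasDerivAt_mul_buchstab hcont hrec hu
  have hconst : Continuous fun _ : ℝ => c * 1 := continuous_const
  have hcd : ∀ u : ℝ, HasDerivAt (fun u => u * (c * 1)) (c * 1) u := fun u => by
    simpa using (hasDerivAt_id' u).mul_const c
  have hcP : buchstabPairing (fun _ => c * 1) 2 = c := by
    rw [buchstabPairing_const_mul, buchstabPairing_one, mul_one]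
  have hne : ¬ ∀ t, 1 < t → W t = c := fun h => by
    have h1 := (h 2 (by norm_num)).symm.trans (hWinit 2 (by norm_num))
    have h2 := (h (3 / 2) (by norm_num)).symm.trans (hWinit (3 / 2) (by norm_num))
    norm_num [h1] at h2
  constructor <;> by_contra! hcon <;> refine hne fun t ht => ?_
  · have := eq_zero_of_eventually_nonneg (D := fun t => c * 1 - W t) (hconst.sub hW)
      (fun u hu => by simpa only [mul_sub] using (hcd u).fun_sub (hWd u hu))
      (by rw [buchstabPairing_sub hconst hW one_le_two, hcP, buchstabPairing_inv hWinit, sub_self])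
      (u₀ := u₀) (fun t ht => by
        have := hcon t ht
        rw [← hec, mul_le_mul_iff_right₀ (Real.exp_pos _)] at this
        rw [hWω t (hu₀.trans ht)]
        linarith) t ht
    linarith
  · have := eq_zero_of_eventually_nonneg (D := fun t => W t - c * 1) (hW.sub hconst)
      (fun u hu => by simpa only [mul_sub] using (hWd u hu).fun_sub (hcd u))
      (by rw [buchstabPairing_sub hW hconst one_le_two, hcP, buchstabPairing_inv hWinit, sub_self])
      (u₀ := u₀) (fun t ht => by
        have := hcon t ht
        rw [← hec, mul_le_mul_iff_right₀ (Real.exp_pos _)] at this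
        rw [hWω t (hu₀.trans ht)]
        linarith) t ht
    linarith
end
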